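/- (Classical gamma-function limit of the new A_n beta integral.) Let n ≥ 1 and a_1,…,a_n, b_1,…,b_{n+3} ∈ ℂ with min{Re(a_1),…,Re(a_n), Re(b_1),…,Re(b_{n+3})} > 0, and set B = b_1 + ⋯ + b_{n+3}. Then, with u_{n+1} := −u_1 − ⋯ − u_n and Γ the classical gamma function, (1/(2πi)ⁿ) ∫_{−i∞}^{i∞} ⋯ ∫_{−i∞}^{i∞} ∏_{j=1}^{n+1} [∏_{i=1}^n Γ(a_i + u_j) ∏_{i=1}^{n+3} Γ(b_i − u_j) / ∏_{i=1}^n Γ(B + a_i − u_j)] · ∏_{1≤i<j≤n+1} Γ(B − u_i − u_j)/(Γ(u_i − u_j) Γ(u_j − u_i)) du_1 ⋯ du_n = (n+1)! ∏_{i=1}^n ∏_{j=1}^{n+3} Γ(a_i + b_j)/Γ(B + a_i − b_j) · ∏_{1≤i<j≤n+3} Γ(B − b_i − b_j). -/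

import Mathlib

open Complex Real MeasureTheory

noncomputable section

/-- `uext n u` is `(u_1, …, u_n, u_{n+1})` with `u_{n+1} := −(u_1 + ⋯ + u_n)`. -/
def uext (n : ℕ) (u : Fin n → ℂ) : Fin (n + 1) → ℂ := Fin.snoc u (-∑ i, u i)

namespace AnBeta

lemma continuousAt_rGamma {x : ℝ} (hx : 0 < x) : ContinuousAt Real.Gamma x :=
  (Real.differentiableAt_Gamma (fun m => by have : (0:ℝ) ≤ m := Nat.cast_nonneg m; linarith)).continuousAt

lemma norm_betaIntegral_le {z : ℂ} {s : ℝ} (hz : 0 < z.re) (hs : 0 < s) :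
    ‖Complex.betaIntegral z s‖ ≤ ‖Complex.betaIntegral (z.re : ℂ) s‖ := by
  have h1 : ‖Complex.betaIntegral z s‖ ≤ ∫ x in (0:ℝ)..1, x ^ (z.re - 1) * (1 - x) ^ (s - 1) := by
    unfold Complex.betaIntegral
    refine (intervalIntegral.norm_integral_le_integral_norm (by norm_num)).trans (le_of_eq ?_)
    rw [intervalIntegral.integral_of_le (by norm_num), intervalIntegral.integral_of_le (by norm_num),
      MeasureTheory.integral_Ioc_eq_integral_Ioo, MeasureTheory.integral_Ioc_eq_integral_Ioo]
    refine setIntegral_congr_fun measurableSet_Ioo fun x hx => ?_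
    simp only [norm_mul]
    have e1 : (1 - (x:ℂ)) = ((1 - x : ℝ) : ℂ) := by push_cast; rfl
    rw [e1, Complex.norm_cpow_eq_rpow_re_of_pos hx.1,
      Complex.norm_cpow_eq_rpow_re_of_pos (by linarith [hx.2])]
    simp
  have h2 : Complex.betaIntegral (z.re : ℂ) s =
      ((∫ x in (0:ℝ)..1, x ^ (z.re - 1) * (1 - x) ^ (s - 1) : ℝ) : ℂ) := by
    unfold Complex.betaIntegral
    rw [← intervalIntegral.integral_ofReal]
    rw [intervalIntegral.integral_of_le (by norm_num), intervalIntegral.integral_of_le (by norm_num),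
      MeasureTheory.integral_Ioc_eq_integral_Ioo, MeasureTheory.integral_Ioc_eq_integral_Ioo]
    refine setIntegral_congr_fun measurableSet_Ioo fun x hx => ?_
    rw [Complex.ofReal_mul, Complex.ofReal_cpow hx.1.le, Complex.ofReal_cpow (by linarith [hx.2])]
    push_cast; rfl
  rw [h2, Complex.norm_real]
  exact h1.trans (le_abs_self _)

/-- `|Γ(x+iy)|/Γ(x)` is increasing in `x`. -/
lemma norm_Gamma_mul_le {z : ℂ} {s : ℝ} (hz : 0 < z.re) (hs : 0 < s) :
    ‖Complex.Gamma z‖ * Real.Gamma (z.re + s) ≤ ‖Complex.Gamma (z + s)‖ * Real.Gamma z.re := by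
  have h1 := Complex.Gamma_mul_Gamma_eq_betaIntegral hz (t := (s:ℂ)) (by simpa using hs)
  have h2 := Complex.Gamma_mul_Gamma_eq_betaIntegral (s := (z.re : ℂ)) (t := (s:ℂ))
    (by simpa using hz) (by simpa using hs)
  have h3 := norm_betaIntegral_le hz hs
  have n1 := congrArg norm h1
  have n2 := congrArg norm h2
  rw [norm_mul, norm_mul] at n1 n2
  have gs : ‖Complex.Gamma (s:ℂ)‖ = Real.Gamma s := by
    rw [Complex.Gamma_ofReal, Complex.norm_real, Real.norm_of_nonneg (Real.Gamma_pos_of_pos hs).le]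
  have gz : ‖Complex.Gamma (z.re:ℂ)‖ = Real.Gamma z.re := by
    rw [Complex.Gamma_ofReal, Complex.norm_real, Real.norm_of_nonneg (Real.Gamma_pos_of_pos hz).le]
  have gzs : ‖Complex.Gamma ((z.re:ℂ) + s)‖ = Real.Gamma (z.re + s) := by
    rw [← Complex.ofReal_add, Complex.Gamma_ofReal, Complex.norm_real,
      Real.norm_of_nonneg (Real.Gamma_pos_of_pos (by linarith)).le]
  rw [gs] at n1 n2
  rw [gz, gzs] at n2
  have ps := Real.Gamma_pos_of_pos hs
  refine le_of_mul_le_mul_right ?_ ps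
  calc ‖Complex.Gamma z‖ * Real.Gamma (z.re + s) * Real.Gamma s
      = (‖Complex.Gamma (z + s)‖ * Real.Gamma (z.re + s)) * ‖Complex.betaIntegral z s‖ := by
        rw [mul_right_comm, n1]; ring
    _ ≤ (‖Complex.Gamma (z + s)‖ * Real.Gamma (z.re + s)) * ‖Complex.betaIntegral (z.re:ℂ) s‖ := by
        have := (Real.Gamma_pos_of_pos (show 0 < z.re + s by linarith)).le
        gcongr
    _ = ‖Complex.Gamma (z + s)‖ * Real.Gamma z.re * Real.Gamma s := by
        rw [mul_assoc, mul_assoc, n2]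

lemma norm_Gamma_half_sq (y : ℝ) :
    ‖Complex.Gamma (1/2 + I * y)‖ ^ 2 = π / Real.cosh (π * y) := by
  have h := Complex.Gamma_mul_Gamma_one_sub (1/2 + I * y)
  have e1 : (1 - (1/2 + I * y) : ℂ) = (starRingEnd ℂ) (1/2 + I * y) := by
    simp [Complex.ext_iff]; norm_num
  have e2 : Complex.sin (π * (1/2 + I * y)) = Real.cosh (π * y) := by
    rw [show (π * (1/2 + I * y) : ℂ) = (π * y : ℝ) * I + π / 2 by push_cast; ring,
      Complex.sin_add_pi_div_two, Complex.cos_mul_I, Complex.ofReal_cosh]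
  rw [e1, Complex.Gamma_conj, Complex.mul_conj, e2, Complex.normSq_eq_norm_sq] at h
  exact_mod_cast h

lemma half_upper (y : ℝ) : ‖Complex.Gamma (1/2 + I * y)‖ ≤ 3 * Real.exp (-(π/2) * |y|) := by
  have h := norm_Gamma_half_sq y
  have hc : Real.exp (π * |y|) / 2 ≤ Real.cosh (π * y) := by
    rw [← Real.cosh_abs, abs_mul, abs_of_pos Real.pi_pos, Real.cosh_eq]
    have := Real.exp_pos (-(π * |y|)); linarith
  have h2 : ‖Complex.Gamma (1/2 + I * y)‖ ^ 2 ≤ (3 * Real.exp (-(π/2) * |y|)) ^ 2 := by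
    rw [h, mul_pow, ← Real.exp_nat_mul, div_le_iff₀ (Real.cosh_pos _)]
    calc π ≤ 3 ^ 2 * (1/2) := by linarith [Real.pi_lt_four]
      _ = 3 ^ 2 * Real.exp ((2:ℕ) * (-(π/2) * |y|)) * (Real.exp (π * |y|) / 2) := by
        have : Real.exp ((2:ℕ) * (-(π/2) * |y|)) * Real.exp (π * |y|) = 1 := by
          rw [← Real.exp_add, Real.exp_eq_one_iff]; push_cast; ring
        linear_combination (-9/2) * this
      _ ≤ _ := by gcongr
  exact le_of_sq_le_sq h2 (by positivity)
where le_of_sq_le_sq {a b : ℝ} (h : a ^ 2 ≤ b ^ 2) (hb : 0 ≤ b) : a ≤ b := by nlinarith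

lemma half_lower (y : ℝ) : Real.exp (-(π/2) * |y|) ≤ ‖Complex.Gamma (1/2 + I * y)‖ := by
  have h := norm_Gamma_half_sq y
  have hc : Real.cosh (π * y) ≤ Real.exp (π * |y|) := by
    rw [← Real.cosh_abs, abs_mul, abs_of_pos Real.pi_pos, Real.cosh_eq]
    have : Real.exp (-(π * |y|)) ≤ Real.exp (π * |y|) := by
      apply Real.exp_le_exp.2; have := mul_nonneg Real.pi_pos.le (abs_nonneg y); linarith
    linarith
  have h2 : Real.exp (-(π/2) * |y|) ^ 2 ≤ ‖Complex.Gamma (1/2 + I * y)‖ ^ 2 := by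
    rw [h, ← Real.exp_nat_mul, le_div_iff₀ (Real.cosh_pos _)]
    calc _ ≤ Real.exp ((2:ℕ) * (-(π/2) * |y|)) * Real.exp (π * |y|) := by gcongr
      _ = 1 := by rw [← Real.exp_add, Real.exp_eq_one_iff]; push_cast; ring
      _ ≤ π := by linarith [Real.pi_gt_three]
  exact half_upper.le_of_sq_le_sq h2 (norm_nonneg _)

/-- polynomials are dominated by exponentials -/
lemma pow_le_exp (m : ℕ) (A η : ℝ) (hA : 0 ≤ A) (hη : 0 < η) :
    ∃ C : ℝ, 0 < C ∧ ∀ y : ℝ, 0 ≤ y → (A + y) ^ m ≤ C * Real.exp (η * y) := by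
  refine ⟨(m.factorial : ℝ) / η ^ m * Real.exp (η * A), by positivity, fun y hy => ?_⟩
  have h := Real.pow_div_factorial_le_exp (η * (A + y)) (by positivity) m
  rw [mul_pow, div_le_iff₀ (by positivity)] at h
  rw [mul_assoc, ← Real.exp_add, ← mul_add, div_mul_eq_mul_div, le_div_iff₀ (by positivity)]
  linarith

lemma Gamma_upper (δ M η : ℝ) (hδ : 0 < δ) (hη : 0 < η) : ∃ C : ℝ, 0 < C ∧ ∀ z : ℂ,
    δ ≤ z.re → z.re ≤ M → ‖Complex.Gamma z‖ ≤ C * Real.exp (-(π/2) * |z.im| + η * |z.im|) := by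
  obtain ⟨m, hm⟩ := exists_nat_gt M
  obtain ⟨C1, hC1, h1⟩ := pow_le_exp m (m + 1) η (by positivity) hη
  obtain ⟨C2, hC2⟩ : ∃ C2 : ℝ, ∀ x ∈ Set.Icc δ M, Real.Gamma x ≤ C2 := by
    have := (isCompact_Icc (a := δ) (b := M)).bddAbove_image (f := Real.Gamma) (fun x hx =>
      (continuousAt_rGamma (lt_of_lt_of_le hδ hx.1)).continuousWithinAt)
    obtain ⟨C, hC⟩ := this
    exact ⟨C, fun x hx => hC ⟨x, hx, rfl⟩⟩
  have hhalf : ∀ (k : ℕ) (y : ℝ), k ≤ m → ‖Complex.Gamma ((k : ℂ) + 1/2 + I * y)‖ ≤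
      (m + 1 + |y|) ^ k * (3 * Real.exp (-(π/2) * |y|)) := by
    intro k y
    induction k with
    | zero => intro _; simpa using half_upper y
    | succ k ih =>
      intro hk
      have e : (((k+1 : ℕ) : ℂ) + 1/2 + I * y) = ((k : ℂ) + 1/2 + I * y) + 1 := by push_cast; ring
      have hre : ((k : ℂ) + 1/2 + I * y).re = k + 1/2 := by simp
      have hne : ((k : ℂ) + 1/2 + I * y) ≠ 0 := by
        intro h0; rw [h0] at hre; simp at hre; have : (0:ℝ) ≤ k := Nat.cast_nonneg k; linarith
      rw [e, Complex.Gamma_add_one _ hne, norm_mul, pow_succ']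
      have hn : ‖((k : ℂ) + 1/2 + I * y)‖ ≤ m + 1 + |y| := by
        refine (norm_add_le _ _).trans ?_
        have : ‖((k : ℂ) + 1/2)‖ = k + 1/2 := by
          rw [show ((k : ℂ) + 1/2) = ((k + 1/2 : ℝ) : ℂ) by push_cast; rfl, Complex.norm_real,
            Real.norm_of_nonneg (by positivity)]
        rw [this]; simp
        have : (k:ℝ) + 1 ≤ m := by exact_mod_cast hk
        linarith
      have := ih (by omega)
      rw [mul_assoc]
      gcongr
  have hgm : 0 < Real.Gamma ((m:ℝ) + 1/2) := Real.Gamma_pos_of_pos (by positivity)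
  refine ⟨(|C2| + 1) / Real.Gamma (m + 1/2) * (C1 * 3), by positivity, fun z hz1 hz2 => ?_⟩
  have hz : 0 < z.re := by linarith
  have h := norm_Gamma_mul_le hz (s := m + 1/2 - z.re) (by linarith)
  have e1 : z.re + (m + 1/2 - z.re) = m + 1/2 := by ring
  have e2 : z + ((m + 1/2 - z.re : ℝ) : ℂ) = (m : ℂ) + 1/2 + I * (z.im : ℝ) := by
    apply Complex.ext <;> simp
  rw [e1, e2, ← le_div_iff₀ hgm] at h
  refine h.trans ?_
  have h3 := (hhalf m z.im le_rfl).trans (mul_le_mul_of_nonneg_right (h1 |z.im| (abs_nonneg _)) (by positivity))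
  have h4 : Real.Gamma z.re ≤ |C2| + 1 := (hC2 _ ⟨hz1, hz2⟩).trans (by linarith [le_abs_self C2])
  have h5 := (Real.Gamma_pos_of_pos hz).le
  calc _ ≤ (C1 * Real.exp (η * |z.im|) * (3 * Real.exp (-(π/2) * |z.im|))) * (|C2| + 1) / Real.Gamma (m + 1/2) := by
        gcongr
    _ = _ := by rw [Real.exp_add]; ring

lemma Gamma_inv_upper (δ M η : ℝ) (hδ : 0 < δ) (hη : 0 < η) : ∃ C : ℝ, 0 < C ∧ ∀ z : ℂ,
    δ ≤ z.re → z.re ≤ M → ‖(Complex.Gamma z)⁻¹‖ ≤ C * Real.exp ((π/2) * |z.im| + η * |z.im|) := by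
  obtain ⟨C1, hC1, h1⟩ := pow_le_exp 1 |M| η (by positivity) hη
  obtain ⟨C2, hC2p, hC2⟩ : ∃ C2 : ℝ, 0 < C2 ∧ ∀ x ∈ Set.Icc (δ + 1) (M + 1), C2 ≤ Real.Gamma x := by
    by_cases hne : (Set.Icc (δ + 1) (M + 1)).Nonempty
    · obtain ⟨x, hx, hmin⟩ := (isCompact_Icc (a := δ + 1) (b := M + 1)).exists_isMinOn hne (f := Real.Gamma) (fun x hx =>
        (continuousAt_rGamma (by linarith [hx.1])).continuousWithinAt)
      exact ⟨Real.Gamma x, Real.Gamma_pos_of_pos (by linarith [hx.1]), fun y hy => hmin hy⟩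
    · exact ⟨1, one_pos, fun x hx => (hne ⟨x, hx⟩).elim⟩
  have hgh : 0 < Real.Gamma (1/2) := Real.Gamma_pos_of_pos (by norm_num)
  refine ⟨C1 * Real.Gamma (1/2) / C2, by positivity, fun z hz1 hz2 => ?_⟩
  have hz : 0 < z.re := by linarith
  have hz0 : z ≠ 0 := by rintro rfl; simp at hz
  have h := norm_Gamma_mul_le (z := 1/2 + I * (z.im:ℝ)) (by simp) (s := z.re + 1/2) (by linarith)
  have e0 : (1/2 + I * (z.im:ℝ)).re = 1/2 := by simp
  have e1 : (1/2:ℝ) + (z.re + 1/2) = z.re + 1 := by ring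
  have e2 : 1/2 + I * (z.im:ℝ) + ((z.re + 1/2 : ℝ) : ℂ) = z + 1 := by
    apply Complex.ext <;> simp; ring
  rw [e0, e1, e2, Complex.Gamma_add_one _ hz0, norm_mul] at h
  have h3 := half_lower z.im
  have h4 := hC2 (z.re + 1) ⟨by linarith, by linarith⟩
  have h5 : ‖z‖ ≤ C1 * Real.exp (η * |z.im|) := by
    refine le_trans ?_ (h1 |z.im| (abs_nonneg _))
    rw [pow_one]
    refine (Complex.norm_le_abs_re_add_abs_im z).trans ?_
    have : |z.re| ≤ |M| := by rw [abs_of_pos hz]; exact hz2.trans (le_abs_self _)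
    linarith
  have hG : 0 < ‖Complex.Gamma z‖ := norm_pos_iff.2 (Complex.Gamma_ne_zero_of_re_pos hz)
  rw [norm_inv, inv_le_comm₀ hG (by positivity)]
  have h6 : Real.exp (-(π/2) * |z.im|) * C2 ≤ C1 * Real.exp (η * |z.im|) * ‖Complex.Gamma z‖ * Real.Gamma (1/2) := by
    calc _ ≤ ‖Complex.Gamma (1/2 + I * (z.im:ℝ))‖ * Real.Gamma (z.re + 1) := by gcongr
      _ ≤ _ := h
      _ ≤ _ := by gcongr
  have h7 : Real.exp (-(π/2) * |z.im|) * Real.exp (π/2 * |z.im|) = 1 := by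
    rw [← Real.exp_add, Real.exp_eq_one_iff]; ring
  rw [inv_le_iff_one_le_mul₀ (by positivity), Real.exp_add]
  have h8 := mul_le_mul_of_nonneg_right h6 (Real.exp_pos (π/2 * |z.im|)).le
  rw [mul_right_comm, h7, one_mul] at h8
  have h9 : ‖Complex.Gamma z‖ * (C1 * Real.Gamma (1/2) / C2 * (Real.exp (π/2 * |z.im|) * Real.exp (η * |z.im|)))
     = (C1 * Real.exp (η * |z.im|) * ‖Complex.Gamma z‖ * Real.Gamma (1/2) * Real.exp (π/2 * |z.im|)) / C2 := by ring
  rw [h9, le_div_iff₀ hC2p]; linarith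

end AnBeta

namespace AnBeta

/-! ### Exponential bounds -/

def tw {n : ℕ} (y : Fin n → ℝ) : ℝ := ∑ k, |y k|

lemma tw_nonneg {n : ℕ} (y : Fin n → ℝ) : 0 ≤ tw y := Finset.sum_nonneg fun _ _ => abs_nonneg _

def EB {T : Type*} {n : ℕ} (K : Set T) (l : (Fin n → ℝ) → ℝ) (f : T → (Fin n → ℝ) → ℂ) : Prop :=
  ∀ η : ℝ, 0 < η → ∃ C : ℝ, 0 < C ∧ ∀ τ ∈ K, ∀ y, ‖f τ y‖ ≤ C * Real.exp (l y + η * tw y)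

section EB
variable {T : Type*} {n : ℕ} {K : Set T} {l l' : (Fin n → ℝ) → ℝ} {f g : T → (Fin n → ℝ) → ℂ}

lemma EB.mono (h : EB K l f) (hl : ∀ y, l y ≤ l' y) : EB K l' f := by
  intro η hη
  obtain ⟨C, hC, h⟩ := h η hη
  refine ⟨C, hC, fun τ hτ y => (h τ hτ y).trans ?_⟩
  have := hl y
  gcongr

lemma EB.of_le (h : EB K l f) (hl : ∀ τ ∈ K, ∀ y, ‖g τ y‖ ≤ ‖f τ y‖) : EB K l g := by
  intro η hη
  obtain ⟨C, hC, h⟩ := h η hη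
  exact ⟨C, hC, fun τ hτ y => (hl τ hτ y).trans (h τ hτ y)⟩

lemma EB.mul (h1 : EB K l f) (h2 : EB K l' g) :
    EB K (fun y => l y + l' y) (fun τ y => f τ y * g τ y) := by
  intro η hη
  obtain ⟨C, hC, h⟩ := h1 (η/2) (by positivity)
  obtain ⟨C', hC', h'⟩ := h2 (η/2) (by positivity)
  refine ⟨C * C', by positivity, fun τ hτ y => ?_⟩
  rw [norm_mul]
  calc _ ≤ (C * Real.exp (l y + η/2 * tw y)) * (C' * Real.exp (l' y + η/2 * tw y)) :=
        mul_le_mul (h τ hτ y) (h' τ hτ y) (norm_nonneg _) (by positivity)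
    _ = C * C' * (Real.exp (l y + η/2 * tw y) * Real.exp (l' y + η/2 * tw y)) := by ring
    _ = _ := by rw [← Real.exp_add]; congr 2; ring

lemma EB.one : EB (n := n) K (fun _ => 0) (fun _ _ => 1) := by
  intro η hη
  refine ⟨1, one_pos, fun τ _ y => ?_⟩
  have := tw_nonneg y
  simp only [norm_one, one_mul, zero_add]
  exact Real.one_le_exp (by positivity)

lemma EB.prod {ι : Type*} (s : Finset ι) {l : ι → (Fin n → ℝ) → ℝ} {f : ι → T → (Fin n → ℝ) → ℂ}
    (h : ∀ i ∈ s, EB K (l i) (f i)) :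
    EB K (fun y => ∑ i ∈ s, l i y) (fun τ y => ∏ i ∈ s, f i τ y) := by
  classical
  induction s using Finset.induction_on with
  | empty => simpa using EB.one
  | insert i s hi ih =>
    have h1 := (h i (Finset.mem_insert_self i s)).mul (ih fun j hj => h j (Finset.mem_insert_of_mem hj))
    simpa [Finset.sum_insert hi, Finset.prod_insert hi] using h1

variable [TopologicalSpace T]

lemma exists_bound (hK : IsCompact K) {g : T → ℂ} (hg : ContinuousOn g K) :
    ∃ M : ℝ, 0 < M ∧ ∀ τ ∈ K, ‖g τ‖ ≤ M := by
  obtain ⟨M, hM⟩ := hK.exists_bound_of_continuousOn hg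
  exact ⟨|M| + 1, by positivity, fun τ hτ => (hM τ hτ).trans (by linarith [le_abs_self M])⟩

lemma EB.cont (hK : IsCompact K) {g : T → ℂ} (hg : ContinuousOn g K) :
    EB (n := n) K (fun _ => 0) (fun τ _ => g τ) := by
  obtain ⟨M, hM, h⟩ := exists_bound hK hg
  intro η hη
  refine ⟨M, hM, fun τ hτ y => (h τ hτ).trans ?_⟩
  have := tw_nonneg y
  have : 1 ≤ Real.exp (0 + η * tw y) := Real.one_le_exp (by positivity)
  nlinarith

lemma abs_im_bounds {M s : ℝ} {g : ℂ} (h : ‖g‖ ≤ M) :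
    |(g + I * s).im| ≤ |s| + M ∧ |s| ≤ |(g + I * s).im| + M := by
  have h1 : (g + I * s).im = g.im + s := by simp
  have h2 : |g.im| ≤ M := (Complex.abs_im_le_norm g).trans h
  rw [h1]
  constructor
  · linarith [abs_add_le g.im s]
  · have := abs_sub_abs_le_abs_sub (g.im + s) g.im
    have := abs_add_le (g.im + s) (-g.im)
    rw [abs_neg, show g.im + s + -g.im = s by ring] at this
    linarith

lemma EB.Gamma (hK : IsCompact K) {g : T → ℂ} (hg : ContinuousOn g K) (hpos : ∀ τ ∈ K, 0 < (g τ).re)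
    {s : (Fin n → ℝ) → ℝ} (hs : ∀ y, |s y| ≤ 2 * tw y) :
    EB K (fun y => -(π/2) * |s y|) (fun τ y => Complex.Gamma (g τ + I * s y)) := by
  obtain ⟨M, hM, h⟩ := exists_bound hK hg
  obtain ⟨δ, hδ, hδ'⟩ := hK.exists_forall_le' (Complex.continuous_re.comp_continuousOn hg) hpos
  intro η hη
  obtain ⟨C, hC, hup⟩ := Gamma_upper δ M (η/2) hδ (by positivity)
  refine ⟨C * Real.exp (π/2 * M + η/2 * M), by positivity, fun τ hτ y => ?_⟩
  have hre : (g τ + I * s y).re = (g τ).re := by simp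
  refine (hup _ (by rw [hre]; exact hδ' τ hτ)
    (by rw [hre]; exact (Complex.re_le_norm _).trans (h τ hτ))).trans ?_
  obtain ⟨i1, i2⟩ := abs_im_bounds (s := s y) (h τ hτ)
  rw [mul_assoc, ← Real.exp_add]
  have := hs y
  refine mul_le_mul_of_nonneg_left (Real.exp_le_exp.2 ?_) hC.le
  have k2 := mul_le_mul_of_nonneg_left i2 (half_pos Real.pi_pos).le
  have k1 := mul_le_mul_of_nonneg_left i1 (half_pos hη).le
  have k3 := mul_le_mul_of_nonneg_left this (half_pos hη).le
  linarith

lemma EB.invGamma (hK : IsCompact K) {g : T → ℂ} (hg : ContinuousOn g K) (hpos : ∀ τ ∈ K, 0 < (g τ).re)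
    {s : (Fin n → ℝ) → ℝ} (hs : ∀ y, |s y| ≤ 2 * tw y) :
    EB K (fun y => (π/2) * |s y|) (fun τ y => (Complex.Gamma (g τ + I * s y))⁻¹) := by
  obtain ⟨M, hM, h⟩ := exists_bound hK hg
  obtain ⟨δ, hδ, hδ'⟩ := hK.exists_forall_le' (Complex.continuous_re.comp_continuousOn hg) hpos
  intro η hη
  obtain ⟨C, hC, hup⟩ := Gamma_inv_upper δ M (η/2) hδ (by positivity)
  refine ⟨C * Real.exp (π/2 * M + η/2 * M), by positivity, fun τ hτ y => ?_⟩
  have hre : (g τ + I * s y).re = (g τ).re := by simp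
  refine (hup _ (by rw [hre]; exact hδ' τ hτ)
    (by rw [hre]; exact (Complex.re_le_norm _).trans (h τ hτ))).trans ?_
  obtain ⟨i1, i2⟩ := abs_im_bounds (s := s y) (h τ hτ)
  rw [mul_assoc, ← Real.exp_add]
  have := hs y
  refine mul_le_mul_of_nonneg_left (Real.exp_le_exp.2 ?_) hC.le
  have k2 := mul_le_mul_of_nonneg_left i1 (half_pos Real.pi_pos).le
  have k1 := mul_le_mul_of_nonneg_left i1 (half_pos hη).le
  have k3 := mul_le_mul_of_nonneg_left this (half_pos hη).le
  linarith

lemma norm_sin_le (z : ℂ) : ‖Complex.sin z‖ ≤ Real.exp |z.im| := by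
  rw [Complex.sin]
  rw [norm_div, norm_mul, Complex.norm_I, mul_one]
  have h1 : ‖Complex.exp (-z * I) - Complex.exp (z * I)‖ ≤ Real.exp |z.im| + Real.exp |z.im| := by
    refine (norm_sub_le _ _).trans (add_le_add ?_ ?_) <;>
    · rw [Complex.norm_exp]; apply Real.exp_le_exp.2; simp [le_abs_self, neg_le_abs]
  have : ‖(2:ℂ)‖ = 2 := by simp
  rw [this]; linarith

lemma EB.sin (hK : IsCompact K) {g : T → ℂ} (hg : ContinuousOn g K)
    {s : (Fin n → ℝ) → ℝ} :
    EB K (fun y => π * |s y|) (fun τ y => Complex.sin (π * (g τ + I * s y))) := by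
  obtain ⟨M, hM, h⟩ := exists_bound hK hg
  intro η hη
  refine ⟨Real.exp (π * M), by positivity, fun τ hτ y => ?_⟩
  refine (norm_sin_le _).trans ?_
  obtain ⟨i1, i2⟩ := abs_im_bounds (s := s y) (h τ hτ)
  rw [Complex.im_ofReal_mul, abs_mul, abs_of_pos Real.pi_pos, ← Real.exp_add]
  have := tw_nonneg y
  refine Real.exp_le_exp.2 ?_
  have k1 := mul_le_mul_of_nonneg_left i1 Real.pi_pos.le
  have k2 := mul_nonneg hη.le this
  linarith

lemma EB.lin (hK : IsCompact K) {g : T → ℂ} (hg : ContinuousOn g K)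
    {s : (Fin n → ℝ) → ℝ} (hs : ∀ y, |s y| ≤ 2 * tw y) :
    EB K (fun _ => 0) (fun τ y => g τ + I * s y) := by
  obtain ⟨M, hM, h⟩ := exists_bound hK hg
  intro η hη
  obtain ⟨C, hC, hh⟩ := pow_le_exp 1 M (η/2) hM.le (by positivity)
  refine ⟨C, hC, fun τ hτ y => ?_⟩
  refine (norm_add_le _ _).trans ?_
  rw [norm_mul, Complex.norm_I, one_mul, Complex.norm_real, Real.norm_eq_abs]
  have h1 := hh |s y| (abs_nonneg _)
  rw [pow_one] at h1
  refine (add_le_add (h τ hτ) le_rfl).trans (h1.trans ?_)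
  have := hs y
  gcongr
  nlinarith

end EB

lemma integrable_exp_tw (n : ℕ) {κ : ℝ} (hκ : 0 < κ) :
    Integrable (fun y : Fin n → ℝ => Real.exp (-κ * tw y)) := by
  have h1 : Integrable (fun x : ℝ => Real.exp (-κ * |x|)) := by
    have hp : IntegrableOn (fun x : ℝ => Real.exp (-κ * |x|)) (Set.Ioi 0) :=
      (integrableOn_exp_mul_Ioi (a := -κ) (by linarith) 0).congr_fun
        (fun x hx => by rw [abs_of_pos hx]) measurableSet_Ioi
    have hn : IntegrableOn (fun x : ℝ => Real.exp (-κ * |x|)) (Set.Iic 0) :=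
      (integrableOn_exp_mul_Iic (a := κ) (by linarith) 0).congr_fun
        (fun x hx => by simp only [abs_of_nonpos (show x ≤ 0 from hx)]; ring_nf) measurableSet_Iic
    have := hn.union hp
    rwa [Set.Iic_union_Ioi, integrableOn_univ] at this
  have := MeasureTheory.Integrable.fintype_prod (f := fun (_ : Fin n) (x : ℝ) => Real.exp (-κ * |x|))
    (μ := fun _ => volume) (fun _ => h1)
  refine this.congr (Filter.Eventually.of_forall fun y => ?_)
  simp only [tw, Finset.mul_sum, Real.exp_sum]

/-! ### Holomorphic dependence on parameters -/

lemma differentiableOn_integral {Y : Type*} [MeasurableSpace Y] {μ : Measure Y} {U : Set ℂ}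
    (hU : IsOpen U) {f : ℂ → Y → ℂ}
    (hm : ∀ τ ∈ U, AEStronglyMeasurable (f τ) μ)
    (hd : ∀ y, DifferentiableOn ℂ (fun τ => f τ y) U)
    (hb : ∀ K ⊆ U, IsCompact K → ∃ g : Y → ℝ, Integrable g μ ∧ ∀ τ ∈ K, ∀ y, ‖f τ y‖ ≤ g y) :
    DifferentiableOn ℂ (fun τ => ∫ y, f τ y ∂μ) U := by
  intro τ0 hτ0
  obtain ⟨r, hr, hrU⟩ := Metric.isOpen_iff.1 hU τ0 hτ0
  have hball : Metric.closedBall τ0 (r/2) ⊆ U :=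
    (Metric.closedBall_subset_ball (by linarith)).trans hrU
  obtain ⟨g, hg, hgb⟩ := hb _ hball (isCompact_closedBall _ _)
  have hsub : Metric.ball τ0 (r/4) ⊆ U := (Metric.ball_subset_ball (by linarith)).trans hrU
  have hderiv : ∀ y, ∀ x ∈ Metric.ball τ0 (r/4), HasDerivAt (fun τ => f τ y) (deriv (fun τ => f τ y) x) x :=
    fun y x hx => ((hd y).differentiableAt (hU.mem_nhds (hsub hx))).hasDerivAt
  have hmem : τ0 ∈ Metric.ball τ0 (r/4) := Metric.mem_ball_self (by positivity)
  have key := hasDerivAt_integral_of_dominated_loc_of_deriv_le (μ := μ) (F := f)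
    (F' := fun x y => deriv (fun τ => f τ y) x) (bound := fun y => g y / (r/4))
    (x₀ := τ0) (s := Metric.ball τ0 (r/4)) (Metric.ball_mem_nhds _ (by positivity))
    (Filter.eventually_of_mem (hU.mem_nhds hτ0) hm)
    (hg.mono' (hm τ0 hτ0) (Filter.Eventually.of_forall fun y => hgb τ0 (Metric.mem_closedBall_self (by positivity)) y))
    ?_ (Filter.Eventually.of_forall fun y x hx => ?_) (hg.div_const _)
    (Filter.Eventually.of_forall hderiv)
  · exact key.2.differentiableAt.differentiableWithinAt
  · -- measurability of the derivative
    have hseq : Filter.Tendsto (fun k : ℕ => τ0 + ((r/8 / (k+1) : ℝ) : ℂ)) Filter.atTop (nhdsWithin τ0 {τ0}ᶜ) := by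
      apply tendsto_nhdsWithin_of_tendsto_nhds_of_eventually_within
      · have h0 : Filter.Tendsto (fun k : ℕ => (r/8 / (k+1) : ℝ)) Filter.atTop (nhds 0) :=
by
          have := (tendsto_one_div_add_atTop_nhds_zero_nat (𝕜 := ℝ)).const_mul (r/8)
          rw [mul_zero] at this
          refine this.congr fun k => by rw [mul_one_div]
        have h1 := (Complex.continuous_ofReal.tendsto 0).comp h0
        simpa using (tendsto_const_nhds (x := τ0)).add h1
      · refine Filter.Eventually.of_forall fun k => ?_
        have : (0:ℝ) < r/8/(k+1) := by positivity
        simp only [Set.mem_compl_iff, Set.mem_singleton_iff, add_eq_left]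
        exact_mod_cast this.ne'
    refine aestronglyMeasurable_of_tendsto_ae Filter.atTop
      (f := fun (k : ℕ) y => slope (fun τ => f τ y) τ0 (τ0 + ((r/8 / (k+1) : ℝ) : ℂ))) (fun k => ?_)
      (Filter.Eventually.of_forall fun y => ?_)
    · simp only [slope_def_module]
      refine AEStronglyMeasurable.fun_const_smul (AEStronglyMeasurable.fun_sub (hm _ (hsub ?_)) (hm _ hτ0)) _
      rw [Metric.mem_ball, dist_eq_norm, add_sub_cancel_left, Complex.norm_real, Real.norm_of_nonneg (by positivity)]
      have : r/8/(k+1) ≤ r/8 := div_le_self (by positivity) (by linarith [Nat.cast_nonneg (α := ℝ) k])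
      linarith
    · exact (hasDerivAt_iff_tendsto_slope.1 (hderiv y τ0 hmem)).comp hseq
  · have hcl : Metric.closedBall x (r/4) ⊆ Metric.closedBall τ0 (r/2) := by
      apply Metric.closedBall_subset_closedBall'
      have := Metric.mem_ball.1 hx
      linarith
    refine Complex.norm_deriv_le_of_forall_mem_sphere_norm_le (by positivity) ?_ fun z hz => ?_
    · refine DifferentiableOn.diffContOnCl ?_
      rw [closure_ball _ (by positivity)]
      exact (hd y).mono (hcl.trans hball)
    · exact hgb z (hcl (Metric.sphere_subset_closedBall hz)) y

/-- functions that are continuous in `y`, holomorphic in the parameter, exponentially bounded -/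
structure Nice {n : ℕ} (U : Set ℂ) (l : (Fin n → ℝ) → ℝ) (f : ℂ → (Fin n → ℝ) → ℂ) : Prop where
  cont : ∀ τ ∈ U, Continuous (f τ)
  diff : ∀ y, DifferentiableOn ℂ (fun τ => f τ y) U
  eb : ∀ K ⊆ U, IsCompact K → EB K l f

section Nice
variable {n : ℕ} {U : Set ℂ} {l l' : (Fin n → ℝ) → ℝ} {f g : ℂ → (Fin n → ℝ) → ℂ}

lemma Nice.mul (h1 : Nice U l f) (h2 : Nice U l' g) :
    Nice U (fun y => l y + l' y) (fun τ y => f τ y * g τ y) :=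
  ⟨fun τ hτ => (h1.cont τ hτ).mul (h2.cont τ hτ), fun y => (h1.diff y).mul (h2.diff y),
    fun K hK hc => (h1.eb K hK hc).mul (h2.eb K hK hc)⟩

lemma Nice.mono (h : Nice U l f) (hl : ∀ y, l y ≤ l' y) : Nice U l' f :=
  ⟨h.cont, h.diff, fun K hK hc => (h.eb K hK hc).mono hl⟩

lemma Nice.prod {ι : Type*} (s : Finset ι) {l : ι → (Fin n → ℝ) → ℝ} {f : ι → ℂ → (Fin n → ℝ) → ℂ}
    (h : ∀ i ∈ s, Nice U (l i) (f i)) :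
    Nice U (fun y => ∑ i ∈ s, l i y) (fun τ y => ∏ i ∈ s, f i τ y) :=
  ⟨fun τ hτ => continuous_finsetProd _ fun i hi => (h i hi).cont τ hτ,
   fun y => DifferentiableOn.fun_finsetProd fun i hi => (h i hi).diff y,
   fun K hK hc => EB.prod s fun i hi => (h i hi).eb K hK hc⟩

lemma differentiableAt_Gamma_pos {z : ℂ} (hz : 0 < z.re) : DifferentiableAt ℂ Complex.Gamma z := by
  refine Complex.differentiableAt_Gamma _ fun m h => ?_
  rw [h] at hz; simp at hz
  have : (0:ℝ) ≤ m := Nat.cast_nonneg m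
  linarith

lemma Nice.Gamma {g : ℂ → ℂ} (hg : DifferentiableOn ℂ g U) (hpos : ∀ τ ∈ U, 0 < (g τ).re)
    {s : (Fin n → ℝ) → ℝ} (hsc : Continuous s) (hs : ∀ y, |s y| ≤ 2 * tw y) :
    Nice U (fun y => -(π/2) * |s y|) (fun τ y => Complex.Gamma (g τ + I * s y)) := by
  have hre : ∀ τ y, (g τ + I * s y).re = (g τ).re := fun τ y => by simp
  refine ⟨fun τ hτ => ?_, fun y τ hτ => ?_, fun K hK hc => EB.Gamma hc (hg.continuousOn.mono hK) (fun τ hτ => hpos τ (hK hτ)) hs⟩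
  · rw [continuous_iff_continuousAt]
    intro y
    exact ContinuousAt.comp (f := fun y => g τ + I * s y) (g := Complex.Gamma)
      (differentiableAt_Gamma_pos (by rw [hre]; exact hpos τ hτ)).continuousAt
      (by fun_prop)
  · exact (differentiableAt_Gamma_pos (by rw [hre]; exact hpos τ hτ)).comp_differentiableWithinAt τ
      ((hg τ hτ).add_const _)

lemma Nice.invGamma {g : ℂ → ℂ} (hg : DifferentiableOn ℂ g U) (hpos : ∀ τ ∈ U, 0 < (g τ).re)
    {s : (Fin n → ℝ) → ℝ} (hsc : Continuous s) (hs : ∀ y, |s y| ≤ 2 * tw y) :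
    Nice U (fun y => (π/2) * |s y|) (fun τ y => (Complex.Gamma (g τ + I * s y))⁻¹) := by
  have hre : ∀ τ y, (g τ + I * s y).re = (g τ).re := fun τ y => by simp
  refine ⟨fun τ hτ => ?_, fun y τ hτ => ?_, fun K hK hc => EB.invGamma hc (hg.continuousOn.mono hK) (fun τ hτ => hpos τ (hK hτ)) hs⟩
  · exact Complex.differentiable_one_div_Gamma.continuous.comp (by fun_prop)
  · exact (Complex.differentiable_one_div_Gamma _).comp_differentiableWithinAt τ
      ((hg τ hτ).add_const _)

lemma Nice.sin {g : ℂ → ℂ} (hg : DifferentiableOn ℂ g U)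
    {s : (Fin n → ℝ) → ℝ} (hsc : Continuous s) :
    Nice U (fun y => π * |s y|) (fun τ y => Complex.sin (π * (g τ + I * s y))) := by
  refine ⟨fun τ hτ => by fun_prop, fun y => by fun_prop, fun K hK hc => EB.sin hc (hg.continuousOn.mono hK)⟩

lemma Nice.lin {g : ℂ → ℂ} (hg : DifferentiableOn ℂ g U)
    {s : (Fin n → ℝ) → ℝ} (hsc : Continuous s) (hs : ∀ y, |s y| ≤ 2 * tw y) :
    Nice U (fun _ => 0) (fun τ y => g τ + I * s y) := by
  refine ⟨fun τ hτ => by fun_prop, fun y => by fun_prop, fun K hK hc => EB.lin hc (hg.continuousOn.mono hK) hs⟩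

lemma Nice.param {g : ℂ → ℂ} (hg : DifferentiableOn ℂ g U) :
    Nice (n := n) U (fun _ => 0) (fun τ _ => g τ) :=
  ⟨fun τ hτ => by fun_prop, fun y => hg, fun K hK hc => EB.cont hc (hg.continuousOn.mono hK)⟩

lemma Nice.congr (h : Nice U l f) (hfg : ∀ τ ∈ U, ∀ y, g τ y = f τ y) : Nice U l g := by
  refine ⟨fun τ hτ => ?_, fun y => (h.diff y).congr fun τ hτ => hfg τ hτ y, fun K hK hc => ?_⟩
  · rw [show g τ = f τ from funext (hfg τ hτ)]; exact h.cont τ hτ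
  · exact (h.eb K hK hc).of_le fun τ hτ y => by rw [hfg τ (hK hτ)]

lemma EB.dom {T : Type*} {K : Set T} {f : T → (Fin n → ℝ) → ℂ} (h : EB K l f) {κ : ℝ} (hκ : 0 < κ)
    (hl : ∀ y, l y ≤ -κ * tw y) :
    ∃ C : ℝ, 0 < C ∧ ∀ τ ∈ K, ∀ y, ‖f τ y‖ ≤ C * Real.exp (-(κ/2) * tw y) := by
  obtain ⟨C, hC, h⟩ := h (κ/2) (by positivity)
  refine ⟨C, hC, fun τ hτ y => (h τ hτ y).trans ?_⟩
  have := hl y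
  gcongr
  linarith

lemma Nice.integrable (h : Nice U l f) {κ : ℝ} (hκ : 0 < κ) (hl : ∀ y, l y ≤ -κ * tw y)
    {τ : ℂ} (hτ : τ ∈ U) : Integrable (f τ) := by
  obtain ⟨C, hC, hb⟩ := (h.eb {τ} (by simpa using hτ) isCompact_singleton).dom hκ hl
  exact ((integrable_exp_tw n (half_pos hκ)).const_mul C).mono' (h.cont τ hτ).aestronglyMeasurable
    (Filter.Eventually.of_forall fun y => hb τ rfl y)

lemma Nice.differentiableOn (h : Nice U l f) (hU : IsOpen U) {κ : ℝ} (hκ : 0 < κ)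
    (hl : ∀ y, l y ≤ -κ * tw y) : DifferentiableOn ℂ (fun τ => ∫ y, f τ y) U := by
  refine differentiableOn_integral hU (fun τ hτ => (h.cont τ hτ).aestronglyMeasurable) h.diff
    fun K hK hc => ?_
  obtain ⟨C, hC, hb⟩ := (h.eb K hK hc).dom hκ hl
  exact ⟨_, (integrable_exp_tw n (half_pos hκ)).const_mul C, hb⟩

end Nice

end AnBeta

namespace AnBeta

def sg {n : ℕ} (y : Fin n → ℝ) : Fin (n+1) → ℝ := Fin.snoc y (-∑ i, y i)

section sg
variable {n : ℕ}

@[simp] lemma sg_castSucc (y : Fin n → ℝ) (i : Fin n) : sg y i.castSucc = y i := by simp [sg]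
@[simp] lemma sg_last (y : Fin n → ℝ) : sg y (Fin.last n) = -∑ i, y i := by simp [sg]

lemma sum_sg (y : Fin n → ℝ) : ∑ j, sg y j = 0 := by
  rw [Fin.sum_univ_castSucc]; simp

lemma sg_unique (s : Fin (n+1) → ℝ) (hs : ∑ j, s j = 0) : sg (fun i => s i.castSucc) = s := by
  funext j
  refine Fin.lastCases ?_ (fun i => ?_) j
  · rw [Fin.sum_univ_castSucc] at hs; simp; linarith
  · simp

lemma continuous_sg (j : Fin (n+1)) : Continuous (fun y : Fin n → ℝ => sg y j) := by
  refine Fin.lastCases ?_ (fun i => ?_) j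
  · simp only [sg_last]; fun_prop
  · simp only [sg_castSucc]; fun_prop

lemma abs_sg_le (y : Fin n → ℝ) (j : Fin (n+1)) : |sg y j| ≤ tw y := by
  refine Fin.lastCases ?_ (fun i => ?_) j
  · simp only [sg_last, abs_neg]; exact Finset.abs_sum_le_sum_abs _ _
  · simp only [sg_castSucc]
    exact Finset.single_le_sum (f := fun k => |y k|) (fun _ _ => abs_nonneg _) (Finset.mem_univ i)

lemma tw_le_sum_sg (y : Fin n → ℝ) : tw y ≤ ∑ j, |sg y j| := by
  rw [Fin.sum_univ_castSucc]; simp [tw]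

end sg

/-! ### the exponent inequality -/

lemma abs_add_sub_eq (x y : ℝ) : |x + y| - |x - y| =
    2 * ((SignType.sign x : ℝ) * (SignType.sign y : ℝ) * min |x| |y|) := by
  have key : ∀ x : ℝ, x ≠ 0 → (0 < x ∧ (SignType.sign x : ℝ) = 1 ∧ |x| = x) ∨
      (x < 0 ∧ (SignType.sign x : ℝ) = -1 ∧ |x| = -x) := by
    intro x hx
    rcases hx.lt_or_gt with h | h
    · right; refine ⟨h, ?_, abs_of_neg h⟩; rw [_root_.sign_neg h]; simp
    · left; refine ⟨h, ?_, abs_of_pos h⟩; rw [_root_.sign_pos h]; simp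
  by_cases hx : x = 0
  · simp [hx]
  by_cases hy : y = 0
  · simp [hy]
  rcases key x hx with ⟨h1, h2, h3⟩ | ⟨h1, h2, h3⟩ <;> rcases key y hy with ⟨k1, k2, k3⟩ | ⟨k1, k2, k3⟩ <;>
  rw [h2, k2, h3, k3] <;>
  rcases abs_cases (x+y) with h1 | h1 <;> rcases abs_cases (x-y) with h2 | h2 <;>
  first | (rw [min_eq_left (by linarith)]; linarith) | (rw [min_eq_right (by linarith)]; linarith)

lemma sum_abs_sub_le {N : ℕ} (s : Fin N → ℝ) :
    ∑ i, ∑ j, |s i - s j| ≤ ∑ i, ∑ j, |s i + s j| := by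
  rw [← sub_nonneg]
  set φ : Fin N → ℝ → ℝ := fun i => (Set.Ico 0 |s i|).indicator (fun _ => (SignType.sign (s i) : ℝ)) with hφ
  have hprod : ∀ i j t, φ i t * φ j t = (Set.Ico 0 (min |s i| |s j|)).indicator
      (fun _ => (SignType.sign (s i) : ℝ) * (SignType.sign (s j) : ℝ)) t := by
    intro i j t
    rw [hφ]
    simp only
    rw [← Set.inter_indicator_mul, Set.Ico_inter_Ico, max_self]
  have hInteg : ∀ i j, Integrable (fun t => φ i t * φ j t) := by
    intro i j
    simp_rw [hprod]
    rw [integrable_indicator_iff measurableSet_Ico]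
    exact integrableOn_const (by simp)
  have hval : ∀ i j, ∫ t, φ i t * φ j t =
      (SignType.sign (s i) : ℝ) * (SignType.sign (s j) : ℝ) * min |s i| |s j| := by
    intro i j
    simp_rw [hprod]
    rw [integral_indicator measurableSet_Ico, setIntegral_const, Real.volume_real_Ico_of_le (by positivity)]
    simp [mul_comm]
  have : ∑ i, ∑ j, |s i + s j| - ∑ i, ∑ j, |s i - s j| = 2 * ∫ t, (∑ i, φ i t) ^ 2 := by
    simp_rw [sq, Finset.sum_mul_sum]
    rw [integral_finsetSum _ fun i _ => integrable_finsetSum _ fun j _ => hInteg i j]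
    rw [← Finset.sum_sub_distrib, Finset.mul_sum]
    refine Finset.sum_congr rfl fun i _ => ?_
    rw [integral_finsetSum _ fun j _ => hInteg i j, ← Finset.sum_sub_distrib, Finset.mul_sum]
    refine Finset.sum_congr rfl fun j _ => ?_
    rw [hval, abs_add_sub_eq]
  rw [this]
  have : 0 ≤ ∫ t, (∑ i, φ i t) ^ 2 := integral_nonneg fun t => sq_nonneg _
  positivity

lemma sum_sum_symm {N : ℕ} (h : Fin N → Fin N → ℝ) (hs : ∀ i j, h i j = h j i) :
    ∑ i, ∑ j, h i j = 2 * ∑ i, ∑ j ∈ Finset.Ioi i, h i j + ∑ i, h i i := by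
  have h1 : ∀ i, ∑ j, h i j = ∑ j ∈ Finset.Ioi i, h i j + ∑ j ∈ Finset.Iio i, h i j + h i i := by
    intro i
    rw [add_assoc, Finset.sum_Iio_add_eq_sum_Iic, add_comm]
    have : (Finset.univ : Finset (Fin N)) = (Finset.Iic i) ∪ (Finset.Ioi i) := by
      ext j; simp [le_or_gt]
    rw [this, Finset.sum_union]
    rw [Finset.disjoint_left]; intro j; simp
  have h2 : ∑ i, ∑ j ∈ Finset.Iio i, h i j = ∑ i, ∑ j ∈ Finset.Ioi i, h i j := by
    rw [Finset.sum_comm' (t' := Finset.univ) (s' := fun j => Finset.Ioi j) (by simp)]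
    exact Finset.sum_congr rfl fun i _ => Finset.sum_congr rfl fun j _ => hs _ _
  simp_rw [h1, Finset.sum_add_distrib, h2]; ring

/-- the exponent inequality -/
lemma exponent_le {N : ℕ} (s : Fin N → ℝ) :
    -((N:ℝ)+2) * ∑ i, |s i| - ∑ i, ∑ j ∈ Finset.Ioi i, |s i + s j|
      + 2 * ∑ i, ∑ j ∈ Finset.Ioi i, |s i - s j| ≤ -2 * ∑ i, |s i| := by
  have h1 := sum_abs_sub_le s
  rw [sum_sum_symm (fun i j => |s i - s j|) (fun i j => abs_sub_comm _ _),
    sum_sum_symm (fun i j => |s i + s j|) (fun i j => by simp only [add_comm])] at h1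
  simp only [sub_self, abs_zero, Finset.sum_const_zero, add_zero, ← two_mul, abs_mul, abs_two,
    ← Finset.mul_sum] at h1
  have h2 := sum_sum_symm (fun i j : Fin N => |s i| + |s j|) (fun i j => add_comm _ _)
  have h4 : ∑ i : Fin N, ∑ j : Fin N, (|s i| + |s j|) = 2 * N * ∑ i, |s i| := by
    simp only [Finset.sum_add_distrib, Finset.sum_const, Finset.card_univ, Fintype.card_fin, nsmul_eq_mul,
      ← Finset.mul_sum]; ring
  have h5 : ∑ i : Fin N, (|s i| + |s i|) = 2 * ∑ i, |s i| := by
    rw [Finset.sum_add_distrib]; ring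
  rw [h4, h5] at h2
  have h3 : ∑ i, ∑ j ∈ Finset.Ioi i, |s i - s j| ≤ ∑ i, ∑ j ∈ Finset.Ioi i, (|s i| + |s j|) :=
    Finset.sum_le_sum fun i _ => Finset.sum_le_sum fun j _ => abs_sub _ _
  linarith

/-! ### permutation symmetry of the domain -/

def permL {n : ℕ} (σ : Equiv.Perm (Fin (n+1))) : (Fin n → ℝ) →ₗ[ℝ] (Fin n → ℝ) where
  toFun y := fun i => sg y (σ i.castSucc)
  map_add' x y := by
    funext i
    simp only [Pi.add_apply]
    refine Fin.lastCases ?_ (fun j => ?_) (σ i.castSucc)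
    · simp [Finset.sum_add_distrib]; ring
    · simp
  map_smul' c y := by
    funext i
    simp only [Pi.smul_apply]
    refine Fin.lastCases ?_ (fun j => ?_) (σ i.castSucc)
    · simp [Finset.mul_sum]
    · simp

lemma sg_permL {n : ℕ} (σ : Equiv.Perm (Fin (n+1))) (y : Fin n → ℝ) :
    sg (permL σ y) = sg y ∘ σ := by
  apply sg_unique (sg y ∘ σ)
  simp only [Function.comp]
  rw [Equiv.sum_comp σ (sg y)]; exact sum_sg y

lemma permL_permL {n : ℕ} (σ : Equiv.Perm (Fin (n+1))) (hσ : σ * σ = 1) (y : Fin n → ℝ) :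
    permL σ (permL σ y) = y := by
  funext i
  show sg (permL σ y) (σ i.castSucc) = y i
  rw [sg_permL]
  simp only [Function.comp]
  rw [show σ (σ i.castSucc) = (σ * σ) i.castSucc from rfl, hσ]; simp

lemma permL_mp {n : ℕ} (σ : Equiv.Perm (Fin (n+1))) (hσ : σ * σ = 1) :
    MeasurePreserving (permL σ) ∧ MeasurableEmbedding (permL σ) := by
  have hcomp : permL σ ∘ₗ permL σ = LinearMap.id := LinearMap.ext (permL_permL σ hσ)
  have hdet : LinearMap.det (permL σ) * LinearMap.det (permL σ) = 1 := by
    rw [← LinearMap.det_comp, hcomp, LinearMap.det_id]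
  have habs : |LinearMap.det (permL σ)| = 1 := by
    rcases mul_self_eq_one_iff.1 hdet with h | h <;> simp [h]
  have hne : LinearMap.det (permL σ) ≠ 0 := by intro h; rw [h] at habs; simp at habs
  have hcont : Continuous (permL σ) := LinearMap.continuous_of_finiteDimensional _
  refine ⟨⟨hcont.measurable, ?_⟩, ?_⟩
  · rw [Real.map_linearMap_volume_pi_eq_smul_volume_pi hne, abs_inv, habs]; simp
  · exact (LinearEquiv.toContinuousLinearEquiv (LinearEquiv.ofInvolutive (permL σ) (permL_permL σ hσ))).toHomeomorph.measurableEmbedding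

lemma integral_perm {n : ℕ} (σ : Equiv.Perm (Fin (n+1))) (hσ : σ * σ = 1) (f : (Fin (n+1) → ℝ) → ℂ) :
    ∫ y : Fin n → ℝ, f (sg y ∘ σ) = ∫ y : Fin n → ℝ, f (sg y) := by
  have := (permL_mp σ hσ).1.integral_comp (permL_mp σ hσ).2 (fun y => f (sg y))
  simpa only [sg_permL] using this

lemma integrable_perm {n : ℕ} (σ : Equiv.Perm (Fin (n+1))) (hσ : σ * σ = 1) (f : (Fin (n+1) → ℝ) → ℂ)
    (hf : Integrable (fun y : Fin n → ℝ => f (sg y))) :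
    Integrable (fun y : Fin n → ℝ => f (sg y ∘ σ)) := by
  have := (permL_mp σ hσ).1.integrable_comp_of_integrable hf
  simpa only [Function.comp_def, sg_permL] using this

lemma integral_sum_swap {n : ℕ} (e : Fin (n+1)) (f : (Fin (n+1) → ℝ) → ℂ)
    (hf : Integrable (fun y : Fin n → ℝ => f (sg y))) :
    ∫ y : Fin n → ℝ, ∑ j, f (sg y ∘ Equiv.swap j e) = ((n:ℂ)+1) * ∫ y : Fin n → ℝ, f (sg y) := by
  rw [integral_finsetSum _ fun j _ => integrable_perm _ (Equiv.swap_mul_self _ _) f hf]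
  simp_rw [integral_perm _ (Equiv.swap_mul_self _ _) f]
  simp

/-- symmetric pair products are permutation invariant -/
lemma prod_pair_perm {N : ℕ} (σ : Equiv.Perm (Fin N)) (h : Fin N → Fin N → ℂ) (hs : ∀ i j, h i j = h j i) :
    ∏ i, ∏ j ∈ Finset.Ioi i, h (σ i) (σ j) = ∏ i, ∏ j ∈ Finset.Ioi i, h i j := by
  set d : Fin N → Fin N → ℂ := fun i j => if i < j then 1 else if j < i then -1 else 0 with hd
  have hd1 : ∀ i j, d i j = - d j i := by
    intro i j
    rcases lt_trichotomy i j with hij | hij | hij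
    · simp [hd, hij, hij.not_gt]
    · simp [hd, hij]
    · simp [hd, hij, hij.not_gt]
  have hone : ∏ i, ∏ j ∈ Finset.Ioi i, d i j = 1 := by
    refine Finset.prod_eq_one fun i _ => Finset.prod_eq_one fun j hj => ?_
    simp [hd, Finset.mem_Ioi.1 hj]
  have e1 := σ.prod_Ioi_comp_eq_sign_mul_prod hd1
  have e2 := σ.prod_Ioi_comp_eq_sign_mul_prod (f := fun i j => h i j * d i j)
    (fun i j => by rw [hs i j, hd1 i j]; ring)
  simp only [Finset.prod_mul_distrib] at e2
  rw [e1, hone, mul_one, mul_one, mul_comm] at e2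
  have hne : ((Equiv.Perm.sign σ : ℤ) : ℂ) ≠ 0 := by
    have := (Equiv.Perm.sign σ).ne_zero
    exact_mod_cast this
  exact mul_left_cancel₀ hne e2

end AnBeta

namespace AnBeta

def Sf (x : ℂ) : ℂ := -(x * Complex.sin (π * x) / π)

lemma pi_ne : (π : ℂ) ≠ 0 := by exact_mod_cast Real.pi_ne_zero

lemma Sf_eq (x : ℂ) : (Complex.Gamma x * Complex.Gamma (-x))⁻¹ = Sf x := by
  unfold Sf
  by_cases hx : x = 0
  · simp [hx]
  have h1 := Complex.Gamma_add_one (-x) (neg_ne_zero.2 hx)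
  have h2 := Complex.Gamma_mul_Gamma_one_sub x
  rw [show (1 - x) = -x + 1 by ring, h1] at h2
  have h3 : Complex.Gamma x * Complex.Gamma (-x) = -(π / Complex.sin (π * x)) / x := by
    rw [← h2, eq_div_iff hx]; ring
  rw [h3, neg_div, div_div, inv_neg, inv_div, mul_comm x]

lemma Sf_neg (x : ℂ) : Sf (-x) = Sf x := by
  unfold Sf; rw [mul_neg, Complex.sin_neg]; ring

@[simp] lemma Sf_zero : Sf 0 = 0 := by simp [Sf]

lemma Sf_div (x : ℂ) : Sf x / x = -(Complex.sin (π * x) / π) := by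
  unfold Sf
  by_cases hx : x = 0
  · simp [hx]
  field_simp

def Gf {m r : ℕ} (α : Fin m → ℂ) (c : Fin r → ℂ) (x : ℂ) : ℂ :=
  (∏ i, Complex.Gamma (α i - x) * (Complex.Gamma (α i + x))⁻¹) * ∏ k, Complex.Gamma (c k + x)

def PP {N : ℕ} (v : Fin N → ℂ) : ℂ :=
  ∏ i, ∏ j ∈ Finset.Ioi i, Complex.Gamma (v i + v j) * Sf (v i - v j)

def W {m r N : ℕ} (α : Fin m → ℂ) (c : Fin r → ℂ) (v : Fin N → ℂ) : ℂ :=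
  (∏ j, Gf α c (v j)) * PP v

lemma PP_perm {N : ℕ} (σ : Equiv.Perm (Fin N)) (v : Fin N → ℂ) : PP (v ∘ σ) = PP v := by
  unfold PP
  exact prod_pair_perm σ (fun i j => Complex.Gamma (v i + v j) * Sf (v i - v j))
    (fun i j => by rw [add_comm, ← Sf_neg, neg_sub])

lemma W_perm {m r N : ℕ} (α : Fin m → ℂ) (c : Fin r → ℂ) (σ : Equiv.Perm (Fin N)) (v : Fin N → ℂ) :
    W α c (v ∘ σ) = W α c v := by
  unfold W
  rw [PP_perm, ← Equiv.prod_comp σ (fun j => Gf α c (v j))]; rfl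

lemma PP_eq_zero {N : ℕ} (v : Fin N → ℂ) {i j : Fin N} (hij : i ≠ j) (h : v i = v j) : PP v = 0 := by
  unfold PP
  wlog hlt : i < j generalizing i j
  · exact this hij.symm h.symm (lt_of_le_of_ne (not_lt.1 hlt) hij.symm)
  refine Finset.prod_eq_zero (Finset.mem_univ i) (Finset.prod_eq_zero (Finset.mem_Ioi.2 hlt) ?_)
  simp [h]

lemma prod_pair_castSucc {n : ℕ} (h : Fin (n+1) → Fin (n+1) → ℂ) :
    ∏ i, ∏ j ∈ Finset.Ioi i, h i j =
      (∏ i : Fin n, ∏ j ∈ Finset.Ioi i, h i.castSucc j.castSucc) * ∏ i : Fin n, h i.castSucc (Fin.last n) := by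
  rw [Fin.prod_univ_castSucc]
  have h1 : Finset.Ioi (Fin.last n) = ∅ := by ext; simp [Fin.le_last]
  rw [h1, Finset.prod_empty, mul_one, ← Finset.prod_mul_distrib]
  refine Finset.prod_congr rfl fun i _ => ?_
  have h2 : Finset.Ioi i.castSucc = insert (Fin.last n) ((Finset.Ioi i).map Fin.castSuccEmb) := by
    ext j
    refine Fin.lastCases ?_ (fun j => ?_) j
    · simp [Fin.castSucc_lt_last]
    · simp only [Finset.mem_Ioi, Fin.castSucc_lt_castSucc_iff, Finset.mem_insert, (Fin.castSucc_lt_last j).ne, false_or, Finset.mem_map, Fin.castSuccEmb_apply, Fin.castSucc_inj, exists_eq_right]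
  rw [h2, Finset.prod_insert, Finset.prod_map, mul_comm]
  · rfl
  · simp [(Fin.castSucc_lt_last _).ne]

lemma prod_pair_succ {n : ℕ} (h : Fin (n+1) → Fin (n+1) → ℂ) :
    ∏ i, ∏ j ∈ Finset.Ioi i, h i j =
      (∏ j : Fin n, h 0 j.succ) * ∏ i : Fin n, ∏ j ∈ Finset.Ioi i, h i.succ j.succ := by
  rw [Fin.prod_univ_succ]
  congr 1
  · have : Finset.Ioi (0 : Fin (n+1)) = Finset.univ.map (Fin.succEmb n) := by
      ext j
      refine Fin.cases ?_ (fun j => ?_) j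
      · simp
      · simp
    rw [this, Finset.prod_map]; rfl
  · refine Finset.prod_congr rfl fun i _ => ?_
    have : Finset.Ioi i.succ = (Finset.Ioi i).map (Fin.succEmb n) := by
      ext j
      refine Fin.cases ?_ (fun j => ?_) j
      · simp
      · simp
    rw [this, Finset.prod_map]; rfl

lemma PP_castSucc {n : ℕ} (v : Fin (n+1) → ℂ) : PP v = PP (fun i : Fin n => v i.castSucc) *
    ∏ i : Fin n, (Complex.Gamma (v i.castSucc + v (Fin.last n)) * Sf (v i.castSucc - v (Fin.last n))) := by
  unfold PP; rw [prod_pair_castSucc]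

lemma PP_succ {n : ℕ} (v : Fin (n+1) → ℂ) : PP v =
    (∏ i : Fin n, (Complex.Gamma (v 0 + v i.succ) * Sf (v 0 - v i.succ))) * PP (fun i : Fin n => v i.succ) := by
  unfold PP; rw [prod_pair_succ]

/-! ### niceness -/
section
variable {n : ℕ} {U : Set ℂ}

lemma Nice.Gamma' {z : ℂ → (Fin n → ℝ) → ℂ} (g : ℂ → ℂ) (s : (Fin n → ℝ) → ℝ)
    (hz : ∀ τ y, z τ y = g τ + I * s y) (hg : DifferentiableOn ℂ g U) (hpos : ∀ τ ∈ U, 0 < (g τ).re)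
    (hsc : Continuous s) (hs : ∀ y, |s y| ≤ 2 * tw y) :
    Nice U (fun y => -(π/2) * |s y|) (fun τ y => Complex.Gamma (z τ y)) :=
  (Nice.Gamma hg hpos hsc hs).congr fun τ _ y => by rw [hz]

lemma Nice.invGamma' {z : ℂ → (Fin n → ℝ) → ℂ} (g : ℂ → ℂ) (s : (Fin n → ℝ) → ℝ)
    (hz : ∀ τ y, z τ y = g τ + I * s y) (hg : DifferentiableOn ℂ g U) (hpos : ∀ τ ∈ U, 0 < (g τ).re)
    (hsc : Continuous s) (hs : ∀ y, |s y| ≤ 2 * tw y) :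
    Nice U (fun y => (π/2) * |s y|) (fun τ y => (Complex.Gamma (z τ y))⁻¹) :=
  (Nice.invGamma hg hpos hsc hs).congr fun τ _ y => by rw [hz]

lemma Nice.lin' {z : ℂ → (Fin n → ℝ) → ℂ} (g : ℂ → ℂ) (s : (Fin n → ℝ) → ℝ)
    (hz : ∀ τ y, z τ y = g τ + I * s y) (hg : DifferentiableOn ℂ g U)
    (hsc : Continuous s) (hs : ∀ y, |s y| ≤ 2 * tw y) :
    Nice U (fun _ => 0) z :=
  (Nice.lin hg hsc hs).congr fun τ _ y => by rw [hz]

lemma Nice.sin' {z : ℂ → (Fin n → ℝ) → ℂ} (g : ℂ → ℂ) (s : (Fin n → ℝ) → ℝ)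
    (hz : ∀ τ y, z τ y = g τ + I * s y) (hg : DifferentiableOn ℂ g U)
    (hsc : Continuous s) :
    Nice U (fun y => π * |s y|) (fun τ y => Complex.sin (π * z τ y)) :=
  (Nice.sin hg hsc).congr fun τ _ y => by rw [hz]

lemma niceGf {m r : ℕ} {α : ℂ → Fin m → ℂ} {c : ℂ → Fin r → ℂ} {q : ℂ → ℂ} {s : (Fin n → ℝ) → ℝ}
    (hα : ∀ i, DifferentiableOn ℂ (fun τ => α τ i) U) (hc : ∀ i, DifferentiableOn ℂ (fun τ => c τ i) U)
    (hq : DifferentiableOn ℂ q U) (hsc : Continuous s) (hs : ∀ y, |s y| ≤ tw y)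
    (h1 : ∀ τ ∈ U, ∀ i, 0 < (α τ i - q τ).re) (h2 : ∀ τ ∈ U, ∀ i, 0 < (α τ i + q τ).re)
    (h3 : ∀ τ ∈ U, ∀ k, 0 < (c τ k + q τ).re) :
    Nice U (fun y => -(π/2) * (r * |s y|)) (fun τ y => Gf (α τ) (c τ) (q τ - I * s y)) := by
  have hs' : ∀ y, |s y| ≤ 2 * tw y := fun y => by linarith [hs y, tw_nonneg y]
  have hs'' : ∀ y, |-s y| ≤ 2 * tw y := fun y => by rw [abs_neg]; exact hs' y
  have e1 : Nice U _ (fun τ (y : Fin n → ℝ) => ∏ i, Complex.Gamma (α τ i - (q τ - I * s y)) * (Complex.Gamma (α τ i + (q τ - I * s y)))⁻¹) :=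
    Nice.prod Finset.univ fun i _ =>
      (Nice.Gamma' (fun τ => α τ i - q τ) s (fun τ y => by ring) ((hα i).sub hq) (fun τ hτ => h1 τ hτ i) hsc hs').mul
      (Nice.invGamma' (fun τ => α τ i + q τ) (fun y => -s y) (fun τ y => by push_cast; ring) ((hα i).add hq) (fun τ hτ => h2 τ hτ i) hsc.neg hs'')
  have e2 : Nice U _ (fun τ (y : Fin n → ℝ) => ∏ k, Complex.Gamma (c τ k + (q τ - I * s y))) :=
    Nice.prod Finset.univ fun k _ =>
      (Nice.Gamma' (fun τ => c τ k + q τ) (fun y => -s y) (fun τ y => by push_cast; ring) ((hc k).add hq) (fun τ hτ => h3 τ hτ k) hsc.neg hs'')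
  refine (e1.mul e2).mono fun y => ?_
  simp only [abs_neg, Finset.sum_const, Finset.card_univ, Fintype.card_fin, nsmul_eq_mul]
  apply le_of_eq; ring

lemma nicePP {N : ℕ} {q : ℂ → ℂ} {s : Fin N → (Fin n → ℝ) → ℝ}
    (hq : DifferentiableOn ℂ q U) (hsc : ∀ j, Continuous (s j)) (hs : ∀ j y, |s j y| ≤ tw y)
    (h1 : ∀ τ ∈ U, 0 < (q τ).re) :
    Nice U (fun y => (π/2) * (-(∑ i, ∑ j ∈ Finset.Ioi i, |s i y + s j y|) + 2 * ∑ i, ∑ j ∈ Finset.Ioi i, |s i y - s j y|))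
      (fun τ y => PP (fun j => q τ - I * s j y)) := by
  have hp : ∀ i j y, |-(s i y + s j y)| ≤ 2 * tw y := fun i j y => by
    rw [abs_neg]; exact (abs_add_le _ _).trans (by linarith [hs i y, hs j y])
  have hm : ∀ i j y, |-(s i y - s j y)| ≤ 2 * tw y := fun i j y => by
    rw [abs_neg]; exact (abs_sub _ _).trans (by linarith [hs i y, hs j y])
  have e1 : Nice U _ (fun τ (y : Fin n → ℝ) => ∏ i, ∏ j ∈ Finset.Ioi i,
      (Complex.Gamma ((q τ - I * s i y) + (q τ - I * s j y)) *
        ((-1/π) * ((q τ - I * s i y) - (q τ - I * s j y)) * Complex.sin (π * ((q τ - I * s i y) - (q τ - I * s j y)))))) :=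
    Nice.prod Finset.univ fun i _ => Nice.prod _ fun j _ =>
      (Nice.Gamma' (fun τ => q τ + q τ) (fun y => -(s i y + s j y)) (fun τ y => by push_cast; ring) (hq.add hq)
        (fun τ hτ => by rw [Complex.add_re]; linarith [h1 τ hτ]) ((hsc i).add (hsc j)).neg (hp i j)).mul
      (((Nice.param (g := fun _ => (-1/π : ℂ)) (differentiableOn_const _)).mul
      (Nice.lin' (fun τ => 0) (fun y => -(s i y - s j y)) (fun τ y => by push_cast; ring) (differentiableOn_const _)
        ((hsc i).sub (hsc j)).neg (hm i j))).mul
      (Nice.sin' (fun τ => 0) (fun y => -(s i y - s j y)) (fun τ y => by push_cast; ring) (differentiableOn_const _)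
        ((hsc i).sub (hsc j)).neg))
  refine (e1.congr fun τ _ y => ?_).mono fun y => ?_
  · unfold PP Sf
    refine Finset.prod_congr rfl fun i _ => Finset.prod_congr rfl fun j _ => ?_
    ring
  · simp only [abs_neg, zero_add, Finset.sum_add_distrib, ← Finset.mul_sum]
    apply le_of_eq; ring

lemma niceW {m : ℕ} {α : ℂ → Fin m → ℂ} {c : ℂ → Fin (n+3) → ℂ} {q : ℂ → ℂ}
    (hα : ∀ i, DifferentiableOn ℂ (fun τ => α τ i) U) (hc : ∀ i, DifferentiableOn ℂ (fun τ => c τ i) U)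
    (hq : DifferentiableOn ℂ q U) (h0 : ∀ τ ∈ U, 0 < (q τ).re)
    (h1 : ∀ τ ∈ U, ∀ i, 0 < (α τ i - q τ).re)
    (h3 : ∀ τ ∈ U, ∀ k, 0 < (c τ k + q τ).re) :
    Nice U (fun y => -π * tw y) (fun τ (y : Fin n → ℝ) => W (α τ) (c τ) (fun j => q τ - I * sg y j)) := by
  have e1 : Nice U _ (fun τ (y : Fin n → ℝ) => ∏ j, Gf (α τ) (c τ) (q τ - I * sg y j)) :=
    Nice.prod Finset.univ fun j _ => niceGf (s := fun y => sg y j) hα hc hq (continuous_sg j) (fun y => abs_sg_le y j) h1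
      (fun τ hτ i => by
        have := h1 τ hτ i; have := h0 τ hτ
        rw [Complex.sub_re] at *; rw [Complex.add_re]; linarith) h3
  have e2 := nicePP (n := n) (s := fun j y => sg y j) hq continuous_sg (fun j y => abs_sg_le y j) h0
  refine (e1.mul e2).mono fun y => ?_
  have := exponent_le (sg y)
  have h4 := tw_le_sum_sg y
  rw [← Finset.mul_sum, ← Finset.mul_sum]
  push_cast at this ⊢
  have h5 := mul_le_mul_of_nonneg_left this (half_pos Real.pi_pos).le
  have h6 := mul_le_mul_of_nonneg_left h4 Real.pi_pos.le
  linarith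

end

end AnBeta

namespace AnBeta

lemma prod_erase_eq {M : ℕ} (j : Fin M) (f : Fin M → ℂ) :
    ∏ i ∈ Finset.univ.erase j, f i = ∏ i, if i = j then 1 else f i := by
  rw [← Finset.prod_filter_mul_prod_filter_not (s := Finset.univ) (p := fun i => i = j)]
  rw [Finset.prod_eq_one (s := Finset.filter (fun i => i = j) Finset.univ), one_mul]
  · rw [Finset.prod_congr (show Finset.filter (fun i => ¬ i = j) Finset.univ = Finset.univ.erase j by ext; simp) (fun _ _ => rfl)]
    refine Finset.prod_congr rfl fun i hi => ?_
    rw [if_neg (Finset.ne_of_mem_erase hi)]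
  · intro i hi
    rw [if_pos (Finset.mem_filter.1 hi).2]

lemma lagrange1 {M : ℕ} (x c : Fin M → ℂ) (hx : Function.Injective x) (hs : ∑ i, x i + ∑ i, c i = 0)
    (hM : 0 < M) :
    ∑ j, (∏ k, (x j + c k)) / ∏ i, (if i = j then 1 else (x j - x i)) = 0 := by
  set P : Polynomial ℂ := ∏ k, (Polynomial.X - Polynomial.C (-c k)) with hP
  set Q : Polynomial ℂ := ∏ k, (Polynomial.X - Polynomial.C (x k)) with hQ
  have mP : P.Monic := Polynomial.monic_prod_of_monic _ _ fun i _ => Polynomial.monic_X_sub_C _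
  have mQ : Q.Monic := Polynomial.monic_prod_of_monic _ _ fun i _ => Polynomial.monic_X_sub_C _
  have dP : P.degree = M := by rw [hP, Polynomial.degree_prod]; simp
  have dQ : Q.degree = M := by rw [hQ, Polynomial.degree_prod]; simp
  have hdeg : (P - Q).degree < (Finset.univ : Finset (Fin M)).card := by
    rw [Finset.card_univ, Fintype.card_fin]
    have := Polynomial.degree_sub_lt_left (dP.trans dQ.symm) mP.ne_zero (by rw [mP.leadingCoeff, mQ.leadingCoeff])
    rwa [dP] at this
  have h := Lagrange.coeff_eq_sum (s := Finset.univ) (v := x) hx.injOn hdeg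
  have c1 : P.coeff ((Finset.univ : Finset (Fin M)).card - 1) = -∑ i, -c i :=
    Polynomial.prod_X_sub_C_coeff_card_pred _ _ (by simpa using hM)
  have c2 : Q.coeff ((Finset.univ : Finset (Fin M)).card - 1) = -∑ i, x i :=
    Polynomial.prod_X_sub_C_coeff_card_pred _ _ (by simpa using hM)
  rw [Polynomial.coeff_sub, c1, c2] at h
  have h0 : (-∑ i, -c i) - -∑ i, x i = 0 := by rw [Finset.sum_neg_distrib]; linear_combination hs
  rw [h0] at h
  rw [h]
  refine Finset.sum_congr rfl fun j _ => ?_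
  rw [prod_erase_eq]
  congr 1
  rw [Polynomial.eval_sub, hP, hQ, Polynomial.eval_prod, Polynomial.eval_prod]
  rw [Finset.prod_eq_zero (f := fun i => Polynomial.eval (x j) (Polynomial.X - Polynomial.C (x i))) (Finset.mem_univ j) (by simp)]
  simp

lemma lagrange2 {N k : ℕ} (hk : k + 1 < N) (Y : Fin N → ℂ) (d : Fin k → ℂ) (hY : Function.Injective Y) :
    ∑ j, (∏ m, (d m - Y j)) / ∏ i, (if i = j then 1 else (Y j - Y i)) = 0 := by
  set P : Polynomial ℂ := ∏ m, (Polynomial.C (d m) - Polynomial.X) with hP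
  have dP : P.degree ≤ k := by
    refine (Polynomial.degree_prod_le _ _).trans ?_
    refine (Finset.sum_le_sum (g := fun _ => (1 : WithBot ℕ)) fun i _ => ?_).trans (by simp)
    exact (Polynomial.degree_sub_le _ _).trans (max_le (Polynomial.degree_C_le.trans (by simp)) (by simp))
  have hdeg : P.degree < (Finset.univ : Finset (Fin N)).card := by
    rw [Finset.card_univ, Fintype.card_fin]
    refine lt_of_le_of_lt dP ?_
    exact_mod_cast (by omega : k < N)
  have h := Lagrange.coeff_eq_sum (s := Finset.univ) (v := Y) hY.injOn hdeg
  have h0 : P.coeff ((Finset.univ : Finset (Fin N)).card - 1) = 0 := by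
    apply Polynomial.coeff_eq_zero_of_degree_lt
    rw [Finset.card_univ, Fintype.card_fin]
    refine lt_of_le_of_lt dP ?_
    exact_mod_cast (by omega : k < N - 1)
  rw [h0] at h
  rw [h]
  refine Finset.sum_congr rfl fun j _ => ?_
  rw [prod_erase_eq, hP, Polynomial.eval_prod]
  simp

lemma prod_swap_last {n : ℕ} (v : Fin (n+1) → ℂ) (j : Fin (n+1)) (g : ℂ → ℂ → ℂ) :
    ∏ i, (if i = j then 1 else g (v j) (v i)) =
      ∏ i : Fin n, g ((v ∘ Equiv.swap j (Fin.last n)) (Fin.last n)) ((v ∘ Equiv.swap j (Fin.last n)) i.castSucc) := by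
  rw [← Equiv.prod_comp (Equiv.swap j (Fin.last n)), Fin.prod_univ_castSucc]
  simp only [Function.comp, Equiv.swap_apply_right, if_true, mul_one]
  refine Finset.prod_congr rfl fun i _ => ?_
  rw [if_neg]
  intro h
  have := (Equiv.swap j (Fin.last n)).injective (h.trans (Equiv.swap_apply_right j (Fin.last n)).symm)
  exact (Fin.castSucc_lt_last i).ne this

/-- the last term of the partial fraction expansion -/
def XT {n r : ℕ} (α : ℂ) (c : Fin r → ℂ) (v : Fin (n+1) → ℂ) : ℂ :=
  (∏ i : Fin n, (α - v i.castSucc) / (v (Fin.last n) - v i.castSucc)) *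
    ((∏ k, (c k + v (Fin.last n))) / (α + v (Fin.last n)))

lemma identityA {n : ℕ} (α : ℂ) (c : Fin (n+3) → ℂ) (v : Fin (n+1) → ℂ) (hv : Function.Injective v)
    (hα : α ≠ 0) (h1 : ∀ j, α - v j ≠ 0) (h2 : ∀ j, α + v j ≠ 0) (hs : ∑ j, v j + ∑ k, c k = 0) :
    (∏ k, (α + c k)) - (∏ k, (α - c k)) * ∏ j, (α - v j) / (α + v j) =
      2 * α * ∑ j, XT α c (v ∘ Equiv.swap j (Fin.last n)) := by
  have hinj : Function.Injective (Fin.cons α (Fin.cons (-α) v) : Fin (n+3) → ℂ) := by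
    rw [Fin.cons_injective_iff, Fin.cons_injective_iff]
    refine ⟨?_, ?_, hv⟩
    · rintro ⟨i, hi⟩
      revert hi
      refine Fin.cases ?_ (fun i => ?_) i
      · intro hi
        have h3 : -α = α := hi
        apply hα
        linear_combination (-1/2) * h3
      · intro hi
        have h3 : v i = α := hi
        exact h1 i (by rw [h3, sub_self])
    · rintro ⟨i, hi⟩
      exact h2 i (by rw [hi]; ring)
  obtain ⟨Pz, hPz⟩ : ∃ Pz : ℂ → ℂ, ∀ z, Pz z = ∏ k, (z + c k) := ⟨_, fun _ => rfl⟩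
  have h := lagrange1 (Fin.cons α (Fin.cons (-α) v)) c hinj
    (by rw [Fin.sum_cons, Fin.sum_cons]; linear_combination hs) (by omega)
  simp only [← hPz] at h
  rw [Fin.sum_univ_succ, Fin.sum_univ_succ] at h
  simp only [Fin.prod_univ_succ (n := n+2) (M := ℂ), Fin.prod_univ_succ (n := n+1) (M := ℂ),
    Fin.cons_zero, Fin.cons_succ, Fin.succ_ne_zero, (Fin.succ_ne_zero _).symm, if_true, if_false, Fin.succ_inj, one_mul] at h
  have e1 : ∏ k, (α + c k) = Pz α := (hPz α).symm
  have e2 : ∏ k, (α - c k) = (-1)^(n+1) * Pz (-α) := by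
    rw [hPz, show (-1:ℂ)^(n+1) = ∏ k : Fin (n+3), (-1:ℂ) by simp [pow_succ], ← Finset.prod_mul_distrib]
    exact Finset.prod_congr rfl fun k _ => by ring
  have e3 : ∏ j, (α + v j) = (-1)^(n+1) * ∏ j, (-α - v j) := by
    rw [show (-1:ℂ)^(n+1) = ∏ k : Fin (n+1), (-1:ℂ) by simp, ← Finset.prod_mul_distrib]
    exact Finset.prod_congr rfl fun k _ => by ring
  have hA : ∏ j, (α - v j) ≠ 0 := Finset.prod_ne_zero_iff.2 fun j _ => h1 j
  have hB : ∏ j, (α + v j) ≠ 0 := Finset.prod_ne_zero_iff.2 fun j _ => h2 j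
  have hB' : ∏ j, (-α - v j) ≠ 0 := by
    intro h0; rw [e3, h0, mul_zero] at hB; exact hB rfl
  have hsgn : ((-1:ℂ)^(n+1)) ≠ 0 := pow_ne_zero _ (by norm_num)
  have e4 : ∀ j, XT α c (v ∘ Equiv.swap j (Fin.last n)) =
      -(∏ i, (α - v i)) * (Pz (v j) / ((v j - α) * ((v j - -α) * ∏ i, if i = j then 1 else (v j - v i)))) := by
    intro j
    have := prod_swap_last v j (fun x y => (α - y) / (x - y))
    unfold XT
    rw [← this]
    simp only [Function.comp, Equiv.swap_apply_right]
    have e5 : ∏ k, (c k + v j) = Pz (v j) := by rw [hPz]; exact Finset.prod_congr rfl fun k _ => add_comm _ _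
    have e6 : ∏ i, (if i = j then 1 else (α - v i) / (v j - v i)) =
        (∏ i, (if i = j then 1 else (α - v i))) / ∏ i, (if i = j then 1 else (v j - v i)) := by
      rw [← Finset.prod_div_distrib]
      exact Finset.prod_congr rfl fun i _ => by split_ifs <;> simp
    have e7 : ∏ i, (α - v i) = (α - v j) * ∏ i, (if i = j then 1 else (α - v i)) := by
      rw [← prod_erase_eq]
      exact (Finset.mul_prod_erase Finset.univ (fun i => α - v i) (Finset.mem_univ j)).symm
    have e8 : ∏ i, (if i = j then 1 else (v j - v i)) ≠ 0 := by
      refine Finset.prod_ne_zero_iff.2 fun i _ => ?_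
      split_ifs with hij
      · exact one_ne_zero
      · exact sub_ne_zero.2 fun h => hij (hv h).symm
    rw [e5, e6, e7]
    have q1 := h1 j
    have q2 := h2 j
    have q3 : v j - α ≠ 0 := by rw [← neg_ne_zero, neg_sub]; exact q1
    have q4 : v j - -α ≠ 0 := by rw [sub_neg_eq_add, add_comm]; exact q2
    have q5 : v j + α ≠ 0 := by rw [add_comm]; exact q2
    rw [sub_neg_eq_add]
    generalize (∏ i, (if i = j then 1 else (v j - v i))) = X at *
    generalize (∏ i, (if i = j then 1 else (α - v i))) = Y at *
    generalize Pz (v j) = Z at *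
    generalize v j = x at *
    rw [div_mul_div_comm, mul_div_assoc', div_eq_div_iff (mul_ne_zero e8 q2) (mul_ne_zero q3 (mul_ne_zero q5 e8))]
    ring
  simp_rw [e4]
  rw [← Finset.mul_sum, Finset.prod_div_distrib, e1, e2, e3]
  set S1 := ∑ x, Pz (v x) / ((v x - α) * ((v x - -α) * ∏ i, if i = x then 1 else (v x - v i))) with hS1
  have h' : S1 = -(Pz α / ((α - -α) * ∏ i, (α - v i)) + Pz (-α) / ((-α - α) * ∏ i, (-α - v i))) := by
    linear_combination h
  rw [h']
  have : α - -α = 2 * α := by ring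
  have t2 : -α - α = -(2 * α) := by ring
  rw [this, t2]
  field_simp
  ring

end AnBeta

namespace AnBeta

def Th {k r n : ℕ} (α0 : ℂ) (αt : Fin k → ℂ) (c : Fin r → ℂ) (w : Fin n → ℂ) (z : ℂ) : ℂ :=
  (∏ i, Gf (Fin.cons α0 αt : Fin (k+1) → ℂ) c (w i) * (α0 - w i)) *
  ((Complex.Gamma (α0 - z) * (Complex.Gamma (α0 + z + 1))⁻¹) *
    (∏ m, Complex.Gamma (αt m - z) * (Complex.Gamma (αt m + z))⁻¹) * ∏ l, Complex.Gamma (c l + z + 1)) *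
  (PP w * ∏ i, (Complex.Gamma (w i + z) * (Complex.sin (π * (w i - z)) / π)))

lemma Gf_cons {k r : ℕ} (α0 : ℂ) (αt : Fin k → ℂ) (c : Fin r → ℂ) (z : ℂ) :
    Gf (Fin.cons α0 αt : Fin (k+1) → ℂ) c z = (Complex.Gamma (α0 - z) * (Complex.Gamma (α0 + z))⁻¹) *
    (∏ m, Complex.Gamma (αt m - z) * (Complex.Gamma (αt m + z))⁻¹) * ∏ l, Complex.Gamma (c l + z) := by
  unfold Gf
  rw [Fin.prod_univ_succ]; simp

lemma W_castSucc {m r n : ℕ} (α : Fin m → ℂ) (c : Fin r → ℂ) (v : Fin (n+1) → ℂ) :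
    W α c v = (∏ i : Fin n, Gf α c (v i.castSucc)) * Gf α c (v (Fin.last n)) *
      (PP (fun i : Fin n => v i.castSucc) * ∏ i : Fin n, (Complex.Gamma (v i.castSucc + v (Fin.last n)) *
        Sf (v i.castSucc - v (Fin.last n)))) := by
  unfold W
  rw [PP_castSucc, Fin.prod_univ_castSucc]

lemma Th_left {k r n : ℕ} (α0 : ℂ) (αt : Fin k → ℂ) (c : Fin r → ℂ) (v : Fin (n+1) → ℂ)
    (h1 : α0 + v (Fin.last n) ≠ 0) (h2 : ∀ l, c l + v (Fin.last n) ≠ 0) :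
    Th α0 αt c (fun i : Fin n => v i.castSucc) (v (Fin.last n)) =
      W (Fin.cons α0 αt : Fin (k+1) → ℂ) c v * XT α0 c v := by
  rw [W_castSucc]
  unfold Th XT
  rw [Gf_cons _ _ _ (v (Fin.last n))]
  simp_rw [Complex.Gamma_add_one _ (h2 _)]
  rw [Complex.Gamma_add_one _ h1]
  simp only [Finset.prod_mul_distrib]
  have e : ∏ i : Fin n, (Complex.sin (π * (v i.castSucc - v (Fin.last n))) / π) =
      (∏ i : Fin n, Sf (v i.castSucc - v (Fin.last n))) / ∏ i : Fin n, (v (Fin.last n) - v i.castSucc) := by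
    rw [← Finset.prod_div_distrib]
    refine Finset.prod_congr rfl fun i _ => ?_
    rw [← neg_sub (v i.castSucc), div_neg, Sf_div, neg_neg]
  rw [e, mul_inv, Finset.prod_div_distrib]
  ring

lemma Th_right {k r n : ℕ} (α0 : ℂ) (αt : Fin k → ℂ) (c : Fin r → ℂ) (x : Fin (n+1) → ℂ)
    (h1 : α0 - x (Fin.last n) ≠ 0) (h2 : ∀ m, αt m - x (Fin.last n) ≠ 0)
    (h3 : ∀ m, αt m + x (Fin.last n) - 1 ≠ 0) (h4 : ∀ i : Fin n, x i.castSucc + x (Fin.last n) - 1 ≠ 0) :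
    Th α0 αt c (fun i : Fin n => x i.castSucc) (x (Fin.last n) - 1) =
      W (Fin.cons α0 αt : Fin (k+1) → ℂ) c x * (∏ i, (α0 - x i)) *
      ((∏ m, ((αt m - x (Fin.last n)) * (αt m + x (Fin.last n) - 1))) /
       ∏ i : Fin n, ((x i.castSucc + x (Fin.last n) - 1) * (x i.castSucc - x (Fin.last n)))) := by
  rw [W_castSucc]
  unfold Th
  rw [Gf_cons _ _ _ (x (Fin.last n)), Fin.prod_univ_castSucc (fun i => α0 - x i)]
  set z := x (Fin.last n)
  have a1 : Complex.Gamma (α0 - (z - 1)) = (α0 - z) * Complex.Gamma (α0 - z) := by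
    rw [← Complex.Gamma_add_one _ h1]; congr 1; ring
  have a2 : α0 + (z - 1) + 1 = α0 + z := by ring
  have a3 : ∏ m, Complex.Gamma (αt m - (z-1)) * (Complex.Gamma (αt m + (z-1)))⁻¹ =
      (∏ m, Complex.Gamma (αt m - z) * (Complex.Gamma (αt m + z))⁻¹) * ∏ m, ((αt m - z) * (αt m + z - 1)) := by
    rw [← Finset.prod_mul_distrib]
    refine Finset.prod_congr rfl fun m _ => ?_
    have b1 : Complex.Gamma (αt m - (z - 1)) = (αt m - z) * Complex.Gamma (αt m - z) := by
      rw [← Complex.Gamma_add_one _ (h2 m)]; congr 1; ring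
    have b2 : Complex.Gamma (αt m + z) = (αt m + z - 1) * Complex.Gamma (αt m + (z-1)) := by
      rw [← add_sub_assoc, ← Complex.Gamma_add_one _ (h3 m)]; congr 1; ring
    rw [b1, b2, mul_inv]
    have := h3 m
    field_simp
  have a4 : ∏ l, Complex.Gamma (c l + (z-1) + 1) = ∏ l, Complex.Gamma (c l + z) :=
    Finset.prod_congr rfl fun l _ => by congr 1; ring
  have a5 : ∏ i : Fin n, (Complex.Gamma (x i.castSucc + (z-1)) * (Complex.sin (π * (x i.castSucc - (z-1))) / π)) =
      (∏ i : Fin n, (Complex.Gamma (x i.castSucc + z) * Sf (x i.castSucc - z))) /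
        ∏ i : Fin n, ((x i.castSucc + z - 1) * (x i.castSucc - z)) := by
    rw [← Finset.prod_div_distrib]
    refine Finset.prod_congr rfl fun i _ => ?_
    have b2 : Complex.Gamma (x i.castSucc + z) = (x i.castSucc + z - 1) * Complex.Gamma (x i.castSucc + (z-1)) := by
      rw [← add_sub_assoc, ← Complex.Gamma_add_one _ (h4 i)]; congr 1; ring
    have b3 : Complex.sin (π * (x i.castSucc - (z-1))) / π = Sf (x i.castSucc - z) / (x i.castSucc - z) := by
      rw [Sf_div, show (π : ℂ) * (x i.castSucc - (z-1)) = π * (x i.castSucc - z) + π by ring, Complex.sin_add_pi, neg_div]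
    rw [b2, b3]
    have := h4 i
    field_simp
  rw [a1, a2, a3, a4, a5, Finset.prod_mul_distrib]
  ring

lemma Th_right_sum {k r n : ℕ} (hk : k < n) (α0 : ℂ) (αt : Fin k → ℂ) (c : Fin r → ℂ) (x : Fin (n+1) → ℂ)
    (h1 : ∀ j, α0 - x j ≠ 0) (h2 : ∀ m j, αt m - x j ≠ 0)
    (h3 : ∀ m j, αt m + x j - 1 ≠ 0) (h4 : ∀ i j, x i + x j - 1 ≠ 0) :
    ∑ j, Th α0 αt c (fun i : Fin n => (x ∘ Equiv.swap j (Fin.last n)) i.castSucc)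
      ((x ∘ Equiv.swap j (Fin.last n)) (Fin.last n) - 1) = 0 := by
  simp_rw [fun j => Th_right α0 αt c (x ∘ Equiv.swap j (Fin.last n)) (h1 _) (fun m => h2 m _) (fun m => h3 m _) (fun i => h4 _ _)]
  simp_rw [W_perm]
  by_cases hx : Function.Injective x
  · have e1 : ∀ j, ∏ i, (α0 - (x ∘ Equiv.swap j (Fin.last n)) i) = ∏ i, (α0 - x i) :=
      fun j => Equiv.prod_comp (Equiv.swap j (Fin.last n)) (fun i => α0 - x i)
    simp_rw [e1]
    rw [← Finset.mul_sum]
    have hY : Function.Injective (fun i => x i - x i * x i) := by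
      intro i j hij
      have h5 : (x i - x j) * (x i + x j - 1) = 0 := by
        have : x i - x i * x i = x j - x j * x j := hij
        linear_combination -this
      rcases mul_eq_zero.1 h5 with h | h
      · exact hx (sub_eq_zero.1 h)
      · exact absurd h (h4 i j)
    have h := lagrange2 (by omega : k + 1 < n + 1) (fun i => x i - x i * x i) (fun m => αt m - αt m * αt m) hY
    have e2 : ∀ j, ((∏ m, ((αt m - (x ∘ Equiv.swap j (Fin.last n)) (Fin.last n)) * (αt m + (x ∘ Equiv.swap j (Fin.last n)) (Fin.last n) - 1))) /
       ∏ i : Fin n, (((x ∘ Equiv.swap j (Fin.last n)) i.castSucc + (x ∘ Equiv.swap j (Fin.last n)) (Fin.last n) - 1) * ((x ∘ Equiv.swap j (Fin.last n)) i.castSucc - (x ∘ Equiv.swap j (Fin.last n)) (Fin.last n)))) =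
       (-1)^k * ((∏ m, ((αt m - αt m * αt m) - (x j - x j * x j))) / ∏ i, (if i = j then 1 else ((x j - x j * x j) - (x i - x i * x i)))) := by
      intro j
      rw [prod_swap_last x j (fun a b => (a - a * a) - (b - b * b)), mul_div_assoc']
      congr 1
      · rw [show (-1:ℂ)^k = ∏ m : Fin k, (-1:ℂ) by simp, ← Finset.prod_mul_distrib]
        refine Finset.prod_congr rfl fun m _ => ?_
        simp only [Function.comp, Equiv.swap_apply_right]; ring
      · exact Finset.prod_congr rfl fun m _ => by ring
    simp_rw [e2]
    rw [← Finset.mul_sum, h, mul_zero, mul_zero]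
  · have : W (Fin.cons α0 αt : Fin (k+1) → ℂ) c x = 0 := by
      unfold Function.Injective at hx
      push Not at hx
      obtain ⟨i, j, hij, hne⟩ := hx
      unfold W
      rw [PP_eq_zero x hne hij, mul_zero]
    simp [this]

lemma W_shift {k r N : ℕ} (α0 : ℂ) (αt : Fin k → ℂ) (c : Fin r → ℂ) (v : Fin N → ℂ)
    (h1 : ∀ j, α0 - v j ≠ 0) (h2 : ∀ j, α0 + v j ≠ 0) :
    W (Fin.cons (α0 + 1) αt : Fin (k+1) → ℂ) c v =
      W (Fin.cons α0 αt : Fin (k+1) → ℂ) c v * ∏ j, (α0 - v j) / (α0 + v j) := by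
  unfold W
  rw [mul_right_comm, ← Finset.prod_mul_distrib]
  congr 1
  refine Finset.prod_congr rfl fun j _ => ?_
  rw [Gf_cons, Gf_cons, show α0 + 1 - v j = (α0 - v j) + 1 by ring, show α0 + 1 + v j = (α0 + v j) + 1 by ring,
    Complex.Gamma_add_one _ (h1 j), Complex.Gamma_add_one _ (h2 j), mul_inv]
  ring

lemma Th_left_sum {k n : ℕ} (α0 : ℂ) (αt : Fin k → ℂ) (c : Fin (n+3) → ℂ) (v : Fin (n+1) → ℂ)
    (h0 : α0 ≠ 0)
    (h1 : ∀ j, α0 - v j ≠ 0) (h2 : ∀ j, α0 + v j ≠ 0) (h3 : ∀ l j, c l + v j ≠ 0) (hs : ∑ j, v j + ∑ k, c k = 0) :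
    2 * α0 * ∑ j, Th α0 αt c (fun i : Fin n => (v ∘ Equiv.swap j (Fin.last n)) i.castSucc)
      ((v ∘ Equiv.swap j (Fin.last n)) (Fin.last n)) =
    (∏ l, (α0 + c l)) * W (Fin.cons α0 αt : Fin (k+1) → ℂ) c v -
      (∏ l, (α0 - c l)) * W (Fin.cons (α0 + 1) αt : Fin (k+1) → ℂ) c v := by
  simp_rw [fun j => Th_left α0 αt c (v ∘ Equiv.swap j (Fin.last n)) (h2 _) (fun l => h3 l _)]
  simp_rw [W_perm]
  rw [W_shift _ _ _ _ h1 h2]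
  by_cases hx : Function.Injective v
  · have := identityA α0 c v hx h0 h1 h2 hs
    rw [← Finset.mul_sum]
    linear_combination (-W (Fin.cons α0 αt : Fin (k+1) → ℂ) c v) * this
  · have : W (Fin.cons α0 αt : Fin (k+1) → ℂ) c v = 0 := by
      unfold Function.Injective at hx
      push Not at hx
      obtain ⟨i, j, hij, hne⟩ := hx
      unfold W
      rw [PP_eq_zero v hne hij, mul_zero]
    simp [this]

end AnBeta

namespace AnBeta

lemma sum_pair_castSucc {n : ℕ} (h : Fin (n+1) → Fin (n+1) → ℝ) :
    ∑ i, ∑ j ∈ Finset.Ioi i, h i j =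
      (∑ i : Fin n, ∑ j ∈ Finset.Ioi i, h i.castSucc j.castSucc) + ∑ i : Fin n, h i.castSucc (Fin.last n) := by
  rw [Fin.sum_univ_castSucc]
  have h1 : Finset.Ioi (Fin.last n) = ∅ := by ext; simp [Fin.le_last]
  rw [h1, Finset.sum_empty, add_zero, ← Finset.sum_add_distrib]
  refine Finset.sum_congr rfl fun i _ => ?_
  have h2 : Finset.Ioi i.castSucc = insert (Fin.last n) ((Finset.Ioi i).map Fin.castSuccEmb) := by
    ext j
    refine Fin.lastCases ?_ (fun j => ?_) j
    · simp [Fin.castSucc_lt_last]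
    · simp only [Finset.mem_Ioi, Fin.castSucc_lt_castSucc_iff, Finset.mem_insert, (Fin.castSucc_lt_last j).ne, false_or, Finset.mem_map, Fin.castSuccEmb_apply, Fin.castSucc_inj, exists_eq_right]
  rw [h2, Finset.sum_insert, Finset.sum_map, add_comm]
  · rfl
  · simp [(Fin.castSucc_lt_last _).ne]

def strip (n : ℕ) (ε : ℝ) : Set ℂ := {τ | -ε < τ.re ∧ n * τ.re < 1}

lemma niceTh {k n : ℕ} (hn : 0 < n) (α0 : ℂ) (αt : Fin k → ℂ) (c : Fin (n+3) → ℂ) (p : ℂ) (ε : ℝ)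
    (hε : 0 < ε) (hnε : n * ε < 1) (hp : ε < p.re) (hp1 : 1 < 2 * p.re) (hc : ∀ l, ε < (c l + p).re)
    (h0 : 1 < (α0 - p).re) (ht : ∀ m, 1 < (αt m - p).re) :
    Nice (strip n ε) (fun y => -π * tw y) (fun τ (y : Fin n → ℝ) =>
      Th α0 αt c (fun i => p + τ - I * sg y i.castSucc) (p - n * τ - I * sg y (Fin.last n))) := by
  have hn1 : (1:ℝ) ≤ n := by exact_mod_cast hn
  have b1 : ∀ τ ∈ strip n ε, -ε < τ.re := fun τ h => h.1
  have b2 : ∀ τ ∈ strip n ε, n * τ.re < 1 := fun τ h => h.2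
  have b3 : ∀ τ ∈ strip n ε, τ.re < 1 := fun τ h => by
    by_contra hh
    push Not at hh
    have := b2 τ h
    nlinarith
  have b4 : ∀ τ ∈ strip n ε, -1 < n * τ.re := fun τ h => by
    have := b1 τ h
    nlinarith
  have b5 : ∀ τ ∈ strip n ε, n * τ.re - τ.re < 1 := fun τ h => by
    have h1 := b1 τ h
    have h2 := b2 τ h
    rcases le_or_gt 0 τ.re with h3 | h3
    · linarith
    · nlinarith
  have e1 : Nice (strip n ε) _ (fun τ (y : Fin n → ℝ) => ∏ i : Fin n, (Gf (Fin.cons α0 αt : Fin (k+1) → ℂ) c ((p+τ) - I * sg y i.castSucc) *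
      (α0 - ((p+τ) - I * sg y i.castSucc)))) := Nice.prod Finset.univ fun i _ =>
    (niceGf (α := fun _ => (Fin.cons α0 αt : Fin (k+1) → ℂ)) (c := fun _ => c) (q := fun τ => p + τ) (s := fun y => sg y i.castSucc)
      (fun i => differentiableOn_const _) (fun i => differentiableOn_const _) (by fun_prop) (continuous_sg _) (fun y => abs_sg_le y _)
      (fun τ hτ i => by
        have := b3 τ hτ
        refine Fin.cases ?_ (fun m => ?_) i
        · rw [Fin.cons_zero]; simp only [Complex.sub_re, Complex.add_re] at *; linarith
        · rw [Fin.cons_succ]; have := ht m; simp only [Complex.sub_re, Complex.add_re] at *; linarith)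
      (fun τ hτ i => by
        have := b1 τ hτ
        refine Fin.cases ?_ (fun m => ?_) i
        · rw [Fin.cons_zero]; simp only [Complex.sub_re, Complex.add_re] at *; linarith
        · rw [Fin.cons_succ]; have := ht m; simp only [Complex.sub_re, Complex.add_re] at *; linarith)
      (fun τ hτ l => by
        have := b1 τ hτ
        have := hc l
        simp only [Complex.add_re] at *; linarith)).mul
    (Nice.lin' (fun τ => α0 - (p + τ)) (fun y => sg y i.castSucc) (fun τ y => by ring) (by fun_prop) (continuous_sg _)
      (fun y => by linarith [abs_sg_le y i.castSucc, tw_nonneg y]))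
  have hs' : ∀ y : Fin n → ℝ, |sg y (Fin.last n)| ≤ 2 * tw y := fun y => by linarith [abs_sg_le y (Fin.last n), tw_nonneg y]
  have hs'' : ∀ y : Fin n → ℝ, |-sg y (Fin.last n)| ≤ 2 * tw y := fun y => by rw [abs_neg]; exact hs' y
  have e2 : Nice (strip n ε) _ (fun τ (y : Fin n → ℝ) => Complex.Gamma (α0 - (p - n * τ - I * sg y (Fin.last n))) *
      (Complex.Gamma (α0 + (p - n * τ - I * sg y (Fin.last n)) + 1))⁻¹) :=
    (Nice.Gamma' (fun τ => α0 - (p - n * τ)) (fun y => sg y (Fin.last n)) (fun τ y => by ring) (by fun_prop)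
      (fun τ hτ => by have := b4 τ hτ; simp at *; linarith) (continuous_sg _) hs').mul
    (Nice.invGamma' (fun τ => α0 + (p - n * τ) + 1) (fun y => -sg y (Fin.last n)) (fun τ y => by push_cast; ring) (by fun_prop)
      (fun τ hτ => by have := b2 τ hτ; simp at *; linarith) (continuous_sg _).neg hs'')
  have e3 : Nice (strip n ε) _ (fun τ (y : Fin n → ℝ) => ∏ m, (Complex.Gamma (αt m - (p - n * τ - I * sg y (Fin.last n))) *
      (Complex.Gamma (αt m + (p - n * τ - I * sg y (Fin.last n))))⁻¹)) := Nice.prod Finset.univ fun m _ =>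
    (Nice.Gamma' (fun τ => αt m - (p - n * τ)) (fun y => sg y (Fin.last n)) (fun τ y => by ring) (by fun_prop)
      (fun τ hτ => by have := b4 τ hτ; have := ht m; simp at *; linarith) (continuous_sg _) hs').mul
    (Nice.invGamma' (fun τ => αt m + (p - n * τ)) (fun y => -sg y (Fin.last n)) (fun τ y => by push_cast; ring) (by fun_prop)
      (fun τ hτ => by have := b2 τ hτ; have := ht m; simp at *; linarith) (continuous_sg _).neg hs'')
  have e4 : Nice (strip n ε) _ (fun τ (y : Fin n → ℝ) => ∏ l, Complex.Gamma (c l + (p - n * τ - I * sg y (Fin.last n)) + 1)) :=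
    Nice.prod Finset.univ fun l _ =>
    (Nice.Gamma' (fun τ => c l + (p - n * τ) + 1) (fun y => -sg y (Fin.last n)) (fun τ y => by push_cast; ring) (by fun_prop)
      (fun τ hτ => by have := b2 τ hτ; have := hc l; simp at *; linarith) (continuous_sg _).neg hs'')
  have e5 := nicePP (n := n) (U := strip n ε) (N := n) (q := fun τ => p + τ) (s := fun j y => sg y j.castSucc) (by fun_prop)
    (fun j => continuous_sg _) (fun j y => abs_sg_le y _) (fun τ hτ => by have := b1 τ hτ; simp; linarith)
  have e6 : Nice (strip n ε) _ (fun τ (y : Fin n → ℝ) => ∏ i : Fin n, (Complex.Gamma ((p + τ - I * sg y i.castSucc) + (p - n * τ - I * sg y (Fin.last n))) *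
      (Complex.sin (π * ((p + τ - I * sg y i.castSucc) - (p - n * τ - I * sg y (Fin.last n)))) * (1 / π)))) := Nice.prod Finset.univ fun i _ =>
    (Nice.Gamma' (fun τ => (p + τ) + (p - n * τ)) (fun y => -(sg y i.castSucc + sg y (Fin.last n))) (fun τ y => by push_cast; ring) (by fun_prop)
      (fun τ hτ => by have := b5 τ hτ; simp at *; linarith) ((continuous_sg _).add (continuous_sg _)).neg
      (fun y => by rw [abs_neg]; exact (abs_add_le _ _).trans (by linarith [abs_sg_le y i.castSucc, abs_sg_le y (Fin.last n)]))).mul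
    ((Nice.sin' (fun τ => (p + τ) - (p - n * τ)) (fun y => -(sg y i.castSucc - sg y (Fin.last n))) (fun τ y => by push_cast; ring) (by fun_prop)
      ((continuous_sg _).sub (continuous_sg _)).neg).mul
      (Nice.param (g := fun _ => (1/π : ℂ)) (differentiableOn_const _)))
  refine (((e1.mul ((e2.mul e3).mul e4)).mul (e5.mul e6)).congr fun τ _ y => ?_).mono fun y => ?_
  · unfold Th
    congr 2
    exact Finset.prod_congr rfl fun i _ => by ring
  · have := exponent_le (sg y)
    have h4 := tw_le_sum_sg y
    rw [sum_pair_castSucc, sum_pair_castSucc] at this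
    have h7 := Fin.sum_univ_castSucc (fun i => |sg y i|)
    simp only [abs_neg, Finset.sum_const, Finset.card_univ, Fintype.card_fin, nsmul_eq_mul, Finset.sum_add_distrib, ← Finset.mul_sum,
      add_zero]
    push_cast at this ⊢
    have h5 := mul_le_mul_of_nonneg_left this (half_pos Real.pi_pos).le
    have h6 := mul_le_mul_of_nonneg_left h4 Real.pi_pos.le
    rw [h7] at h5 h6
    linarith

lemma shift_const {n : ℕ} {ε : ℝ} (Φ : ℂ → ℂ) (hd : DifferentiableOn ℂ Φ (strip n ε))
    (hi : ∀ τ ∈ strip n ε, ∀ θ : ℝ, Φ (τ + θ * I) = Φ τ) {τ τ' : ℂ} (h : τ ∈ strip n ε) (h' : τ' ∈ strip n ε) :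
    Φ τ = Φ τ' := by
  have hconv : Convex ℝ (strip n ε) := by
    have e : strip n ε = Complex.reLm ⁻¹' ({x : ℝ | -ε < x} ∩ {x : ℝ | (n:ℝ) * x < 1}) := rfl
    rw [e]
    refine Convex.linear_preimage ?_ _
    refine (convex_Ioi (-ε)).inter ?_
    exact convex_halfSpace_lt (f := fun x : ℝ => (n:ℝ) * x) (LinearMap.mulLeft ℝ (n:ℝ)).isLinear 1
  have hopen : IsOpen (strip n ε) :=
    (isOpen_lt continuous_const Complex.continuous_re).inter (isOpen_lt (f := fun τ : ℂ => (n:ℝ) * τ.re) (by fun_prop) continuous_const)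
  refine hopen.is_const_of_deriv_eq_zero hconv.isPreconnected hd (fun τ hτ => ?_) h h'
  have h1 : HasDerivAt Φ (deriv Φ τ) τ := ((hd τ hτ).differentiableAt (hopen.mem_nhds hτ)).hasDerivAt
  have h2 : HasDerivAt (fun θ : ℝ => τ + θ * I) I 0 := by
    have := (((hasDerivAt_id (0:ℝ)).ofReal_comp).mul_const I).const_add τ
    simpa using this
  have h3 : HasDerivAt (fun θ : ℝ => Φ (τ + θ * I)) (deriv Φ τ * I) 0 := by
    have h1' : HasDerivAt Φ (deriv Φ τ) (τ + ((0:ℝ) : ℂ) * I) := by simpa using h1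
    exact h1'.comp 0 h2
  have h4 : (fun θ : ℝ => Φ (τ + θ * I)) = fun _ => Φ τ := funext fun θ => hi τ hτ θ
  rw [h4] at h3
  have h5 := h3.unique (hasDerivAt_const (0:ℝ) (Φ τ))
  simpa using h5

end AnBeta

namespace AnBeta

open Filter Topology


lemma exists_eps {ι : Type*} [Finite ι] (f : ι → ℝ) (hf : ∀ i, 0 < f i) : ∃ ε > 0, ∀ i, ε < f i := by
  have h : ∀ᶠ ε in 𝓝[>] (0:ℝ), ∀ i, ε < f i :=
    eventually_all.2 fun i => nhdsWithin_le_nhds (Iio_mem_nhds (hf i))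
  obtain ⟨ε, h1, h2⟩ := (h.and self_mem_nhdsWithin).exists
  exact ⟨ε, h2, h1⟩

lemma ne_of_re {z : ℂ} (h : 0 < z.re) : z ≠ 0 := by
  rintro rfl; simp at h

lemma integrableW {m n : ℕ} {α : Fin m → ℂ} {c : Fin (n+3) → ℂ} {p : ℂ}
    (h0 : 0 < p.re) (h1 : ∀ i, 0 < (α i - p).re) (h3 : ∀ k, 0 < (c k + p).re) :
    Integrable (fun y : Fin n → ℝ => W α c (fun j => p - I * sg y j)) :=
  (niceW (U := Set.univ) (α := fun _ => α) (c := fun _ => c) (q := fun _ => p)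
    (fun i => differentiableOn_const _) (fun i => differentiableOn_const _) (differentiableOn_const _)
    (fun _ _ => h0) (fun _ _ => h1) (fun _ _ => h3)).integrable Real.pi_pos (fun y => le_rfl) (Set.mem_univ 0)

lemma sg_translate {n : ℕ} (y : Fin n → ℝ) (θ : ℝ) (i : Fin n) :
    sg (y - fun _ => θ) i.castSucc = sg y i.castSucc - θ := by simp

lemma sg_translate_last {n : ℕ} (y : Fin n → ℝ) (θ : ℝ) :
    sg (y - fun _ => θ) (Fin.last n) = sg y (Fin.last n) + n * θ := by
  simp; ring

lemma stepA {k n : ℕ} (hk : k < n) (α0 : ℂ) (αt : Fin k → ℂ) (c : Fin (n+3) → ℂ) (p : ℂ)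
    (hcs : ∑ l, c l = -((n:ℂ)+1) * p) (hp1 : 1 < 2 * p.re) (hc : ∀ l, 0 < (c l + p).re)
    (h0 : 1 < (α0 - p).re) (ht : ∀ m, 1 < (αt m - p).re) :
    (∏ l, (α0 + c l)) * ∫ y : Fin n → ℝ, W (Fin.cons α0 αt : Fin (k+1) → ℂ) c (fun j => p - I * sg y j) =
    (∏ l, (α0 - c l)) * ∫ y : Fin n → ℝ, W (Fin.cons (α0+1) αt : Fin (k+1) → ℂ) c (fun j => p - I * sg y j) := by
  have hn : 0 < n := by omega
  have hn1 : (1:ℝ) ≤ n := by exact_mod_cast hn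
  obtain ⟨ε1, hε1, hε1'⟩ := exists_eps (fun l => (c l + p).re) hc
  obtain ⟨ε, hε, h1, h2, h3⟩ : ∃ ε > 0, ε ≤ ε1 ∧ ε < p.re ∧ n * ε < 1 := by
    refine ⟨min ε1 (min (p.re/2) (1/(2*n))), by have : 0 < p.re := by linarith
                                                positivity, min_le_left _ _, ?_, ?_⟩
    · refine lt_of_le_of_lt ((min_le_right _ _).trans (min_le_left _ _)) (by linarith)
    · refine lt_of_le_of_lt (mul_le_mul_of_nonneg_left ((min_le_right _ _).trans (min_le_right _ _)) (by linarith)) ?_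
      rw [mul_one_div, div_lt_one (by linarith)]; linarith
  have hN := niceTh hn α0 αt c p ε hε h3 h2 hp1 (fun l => lt_of_le_of_lt h1 (hε1' l)) h0 ht
  have hopen : IsOpen (strip n ε) :=
    (isOpen_lt continuous_const Complex.continuous_re).inter (isOpen_lt (f := fun τ : ℂ => (n:ℝ) * τ.re) (by fun_prop) continuous_const)
  have hd := hN.differentiableOn hopen Real.pi_pos (fun y => le_rfl)
  have m0 : (0:ℂ) ∈ strip n ε := by constructor <;> simp [hε]
  have m1 : (1/((n:ℂ)+1)) ∈ strip n ε := by
    have : (1/((n:ℂ)+1)) = ((1/((n:ℝ)+1) : ℝ) : ℂ) := by push_cast; rfl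
    rw [this]
    constructor
    · rw [Complex.ofReal_re]
      have : 0 < 1/((n:ℝ)+1) := by positivity
      linarith
    · rw [Complex.ofReal_re, mul_one_div, div_lt_one (by positivity)]; linarith
  have hconst := shift_const _ hd (fun τ hτ θ => by
    rw [← integral_sub_right_eq_self _ (fun _ : Fin n => -θ)]
    congr 1
    funext y
    congr 1
    · funext i
      rw [sg_translate]; push_cast; ring
    · rw [sg_translate_last]; push_cast; ring
    ) m0 m1
  set f : (Fin (n+1) → ℝ) → ℂ := fun s => Th α0 αt c (fun i => p + 0 - I * s i.castSucc) (p - n * 0 - I * s (Fin.last n)) with hf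
  set g : (Fin (n+1) → ℝ) → ℂ := fun s => Th α0 αt c (fun i => p + (1/((n:ℂ)+1)) - I * s i.castSucc) (p - n * (1/((n:ℂ)+1)) - I * s (Fin.last n)) with hg
  have if0 : Integrable (fun y : Fin n → ℝ => f (sg y)) := hN.integrable Real.pi_pos (fun y => le_rfl) m0
  have ig0 : Integrable (fun y : Fin n → ℝ => g (sg y)) := hN.integrable Real.pi_pos (fun y => le_rfl) m1
  have hfg : ∫ y : Fin n → ℝ, f (sg y) = ∫ y : Fin n → ℝ, g (sg y) := hconst
  have sf := integral_sum_swap (Fin.last n) f if0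
  have sgg := integral_sum_swap (Fin.last n) g ig0
  have hnC : (n:ℂ) + 1 ≠ 0 := by exact_mod_cast Nat.succ_ne_zero n
  -- right side vanishes
  have zg : ∀ y : Fin n → ℝ, ∑ j, g (sg y ∘ Equiv.swap j (Fin.last n)) = 0 := by
    intro y
    have h9 : (0:ℝ) < 1/((n:ℝ)+1) := by positivity
    have h10 : 1/((n:ℝ)+1) ≤ 1 := by rw [div_le_one (by positivity)]; linarith
    have hre : (1/((n:ℂ)+1)).re = 1/((n:ℝ)+1) := by
      have : (1/((n:ℂ)+1)) = ((1/((n:ℝ)+1) : ℝ) : ℂ) := by push_cast; rfl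
      rw [this, Complex.ofReal_re]
    have hx : ∀ j, ((p + 1/((n:ℂ)+1) - I * sg y j)).re = p.re + 1/((n:ℝ)+1) := fun j => by
      rw [Complex.sub_re, Complex.add_re, hre]; simp
    have := Th_right_sum hk α0 αt c (fun j => p + 1/((n:ℂ)+1) - I * sg y j)
      (fun j => ne_of_re (by rw [Complex.sub_re, hx]; rw [Complex.sub_re] at h0; linarith))
      (fun m j => ne_of_re (by have h0 := ht m; rw [Complex.sub_re, hx]; rw [Complex.sub_re] at h0; linarith))
      (fun m j => ne_of_re (by have h0 := ht m; rw [Complex.sub_re, Complex.add_re, hx]; rw [Complex.sub_re] at h0; rw [Complex.one_re]; linarith))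
      (fun i j => ne_of_re (by rw [Complex.sub_re, Complex.add_re, hx, hx]; rw [Complex.one_re]; linarith))
    rw [← this]
    refine Finset.sum_congr rfl fun j _ => ?_
    rw [hg]
    simp only [Function.comp]
    congr 1
    field_simp
    ring
  have hz : ∫ y : Fin n → ℝ, f (sg y) = 0 := by
    rw [hfg]
    simp_rw [zg] at sgg
    simp only [integral_zero] at sgg
    exact (mul_eq_zero.1 sgg.symm).resolve_left hnC
  rw [hz, mul_zero] at sf
  have hp0 : 0 < p.re := by linarith
  have zf : ∀ y : Fin n → ℝ, 2 * α0 * ∑ j, f (sg y ∘ Equiv.swap j (Fin.last n)) =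
      (∏ l, (α0 + c l)) * W (Fin.cons α0 αt : Fin (k+1) → ℂ) c (fun j => p - I * sg y j) -
      (∏ l, (α0 - c l)) * W (Fin.cons (α0 + 1) αt : Fin (k+1) → ℂ) c (fun j => p - I * sg y j) := by
    intro y
    have hx : ∀ j, ((p - I * sg y j)).re = p.re := fun j => by
      rw [Complex.sub_re]; simp
    have := Th_left_sum α0 αt c (fun j => p - I * sg y j)
      (ne_of_re (by rw [Complex.sub_re] at h0; linarith))
      (fun j => ne_of_re (by rw [Complex.sub_re, hx]; rw [Complex.sub_re] at h0; linarith))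
      (fun j => ne_of_re (by rw [Complex.add_re, hx]; rw [Complex.sub_re] at h0; linarith))
      (fun l j => ne_of_re (by have := hc l; rw [Complex.add_re, hx]; rwa [Complex.add_re] at this))
      (by
        rw [hcs, Finset.sum_sub_distrib, ← Finset.mul_sum, ← Complex.ofReal_sum, sum_sg]
        simp; ring)
    rw [← this, hf]
    congr 1
    refine Finset.sum_congr rfl fun j _ => ?_
    simp only [Function.comp, add_zero, mul_zero, sub_zero]
  have i1 : Integrable (fun y : Fin n → ℝ => W (Fin.cons α0 αt : Fin (k+1) → ℂ) c (fun j => p - I * sg y j)) :=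
    integrableW hp0 (fun i => by
      refine Fin.cases ?_ (fun m => ?_) i
      · rw [Fin.cons_zero]; linarith
      · rw [Fin.cons_succ]; linarith [ht m]) hc
  have i2 : Integrable (fun y : Fin n → ℝ => W (Fin.cons (α0+1) αt : Fin (k+1) → ℂ) c (fun j => p - I * sg y j)) :=
    integrableW hp0 (fun i => by
      refine Fin.cases ?_ (fun m => ?_) i
      · rw [Fin.cons_zero]; simp at *; linarith
      · rw [Fin.cons_succ]; linarith [ht m]) hc
  have hh : ∫ y : Fin n → ℝ, 2 * α0 * ∑ j, f (sg y ∘ Equiv.swap j (Fin.last n)) = 0 := by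
    rw [integral_const_mul, sf, mul_zero]
  simp_rw [zf] at hh
  rw [integral_sub (i1.const_mul _) (i2.const_mul _), integral_const_mul, integral_const_mul] at hh
  exact sub_eq_zero.1 hh

end AnBeta

namespace AnBeta

open Filter Topology


lemma cpow_sum' {ι : Type*} {x : ℂ} (hx : x ≠ 0) {s : Finset ι} {f : ι → ℂ} :
    x ^ (∑ i ∈ s, f i) = ∏ i ∈ s, x ^ (f i) := by
  simp only [Complex.cpow_def_of_ne_zero hx]
  rw [Finset.mul_sum, Complex.exp_sum]

lemma Gamma_add_nat {s : ℂ} (hs : 0 < s.re) (k : ℕ) :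
    Complex.Gamma (s + k + 1) = (∏ j ∈ Finset.range (k+1), (s + j)) * Complex.Gamma s := by
  induction k with
  | zero => simp [Complex.Gamma_add_one _ (ne_of_re hs)]
  | succ k ih =>
    rw [Finset.prod_range_succ, mul_right_comm, ← ih]
    push_cast
    rw [← add_assoc, mul_comm, ← Complex.Gamma_add_one]
    · apply ne_of_re; simp; positivity

lemma Gamma_asymp {s : ℂ} (hs : 0 < s.re) :
    Tendsto (fun k : ℕ => Complex.Gamma (s + k + 1) / ((k:ℂ) ^ s * (Nat.factorial k : ℂ))) atTop (𝓝 1) := by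
  have h0 := Complex.Gamma_ne_zero_of_re_pos hs
  have h := (tendsto_const_nhds (x := Complex.Gamma s)).div (Complex.GammaSeq_tendsto_Gamma s) h0
  rw [div_self h0] at h
  refine h.congr fun k => ?_
  rw [Gamma_add_nat hs]
  simp only [Pi.div_apply, Complex.GammaSeq]
  rw [div_div_eq_mul_div, mul_comm]

def Gk (α : ℂ) (k : ℕ) (v : ℂ) : ℂ :=
  Complex.Gamma (α + k + 1 - v) * (Complex.Gamma (α + k + 1 + v))⁻¹ * (k:ℂ) ^ (2 * v)

lemma Gk_tendsto {α v : ℂ} (h1 : 0 < (α - v).re) (h2 : 0 < (α + v).re) :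
    Tendsto (fun k => Gk α k v) atTop (𝓝 1) := by
  have h := (Gamma_asymp h1).div (Gamma_asymp h2) one_ne_zero
  rw [div_one] at h
  refine h.congr' ?_
  filter_upwards [eventually_gt_atTop 0] with k hk
  have hk0 : (k:ℂ) ≠ 0 := by exact_mod_cast hk.ne'
  have hf : (Nat.factorial k : ℂ) ≠ 0 := by exact_mod_cast Nat.factorial_ne_zero k
  have e : (k:ℂ) ^ (α + v) = (k:ℂ)^(α - v) * (k:ℂ)^(2*v) := by
    rw [← Complex.cpow_add _ _ hk0]; congr 1; ring
  have h3 : (k:ℂ)^(α - v) ≠ 0 := by rw [Complex.cpow_ne_zero_iff]; left; exact hk0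
  have h4 : (k:ℂ)^(2*v) ≠ 0 := by rw [Complex.cpow_ne_zero_iff]; left; exact hk0
  simp only [Pi.div_apply, Gk]
  rw [e, show α + k + 1 - v = α - v + k + 1 by ring, show α + k + 1 + v = α + v + k + 1 by ring]
  have h5 : Complex.Gamma (α + v + k + 1) ≠ 0 := by
    apply Complex.Gamma_ne_zero_of_re_pos
    simp only [Complex.add_re, Complex.natCast_re, Complex.one_re] at *
    positivity
  field_simp

lemma Gk_bound {x : ℝ} {v : ℂ} (h0 : 0 < v.re) (h1 : v.re < x) (k : ℕ) :
    ‖Gk x k v‖ ≤ ‖Gk x k (v.re : ℂ)‖ := by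
  rcases Nat.eq_zero_or_pos k with hk | hk
  · subst hk
    have : (2 * v) ≠ 0 := by apply ne_of_re; simp; exact h0
    unfold Gk
    rw [Nat.cast_zero, Complex.zero_cpow this, mul_zero, norm_zero]
    positivity
  · unfold Gk
    rw [norm_mul, norm_mul, norm_mul, norm_mul, Complex.norm_natCast_cpow_of_pos hk, Complex.norm_natCast_cpow_of_pos hk]
    have e : (2 * v).re = (2 * (v.re:ℂ)).re := by simp
    rw [e]
    apply mul_le_mul_of_nonneg_right _ (by positivity)
    have hk' : (0:ℝ) ≤ k := Nat.cast_nonneg k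
    set z : ℂ := (x:ℂ) + k + 1 - (starRingEnd ℂ) v with hz
    have hzre : z.re = x + k + 1 - v.re := by simp [hz]
    have hpos : 0 < z.re := by rw [hzre]; linarith
    have n1 : ‖Complex.Gamma ((x:ℂ) + k + 1 - v)‖ = ‖Complex.Gamma z‖ := by
      rw [← Complex.norm_conj, ← Complex.Gamma_conj]
      congr 2
      simp [hz]
    have e2 : (x:ℂ) + k + 1 + v = z + ((2 * v.re : ℝ) : ℂ) := by
      have := Complex.add_conj v
      rw [hz]; linear_combination this
    have key := norm_Gamma_mul_le hpos (s := 2 * v.re) (by linarith)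
    have g1 : Complex.Gamma ((x:ℂ) + k + 1 - (v.re:ℂ)) = (Real.Gamma z.re : ℂ) := by
      rw [← Complex.Gamma_ofReal, hzre]; push_cast; rfl
    have g2 : Complex.Gamma ((x:ℂ) + k + 1 + (v.re:ℂ)) = (Real.Gamma (z.re + 2 * v.re) : ℂ) := by
      rw [← Complex.Gamma_ofReal, hzre]; push_cast; congr 1; ring
    have p1 : 0 < Real.Gamma z.re := Real.Gamma_pos_of_pos hpos
    have p2 : 0 < Real.Gamma (z.re + 2 * v.re) := Real.Gamma_pos_of_pos (by linarith)
    rw [n1, e2, g1, g2, norm_inv, norm_inv, Complex.norm_real, Complex.norm_real, Real.norm_of_nonneg p1.le, Real.norm_of_nonneg p2.le]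
    have p3 : 0 < ‖Complex.Gamma (z + ((2 * v.re : ℝ) : ℂ))‖ := norm_pos_iff.2 (Complex.Gamma_ne_zero_of_re_pos (by
      rw [Complex.add_re, Complex.ofReal_re]; linarith))
    rw [← div_eq_mul_inv, ← div_eq_mul_inv, div_le_div_iff₀ p3 p2]
    rw [mul_comm (Real.Gamma z.re)]
    exact key

lemma W_cons {k r N : ℕ} (α0 : ℂ) (αt : Fin k → ℂ) (c : Fin r → ℂ) (v : Fin N → ℂ) :
    W (Fin.cons α0 αt : Fin (k+1) → ℂ) c v =
      (∏ j, Complex.Gamma (α0 - v j) * (Complex.Gamma (α0 + v j))⁻¹) * W αt c v := by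
  unfold W
  rw [← mul_assoc, ← Finset.prod_mul_distrib]
  congr 1
  refine Finset.prod_congr rfl fun j _ => ?_
  rw [Gf_cons]; unfold Gf; ring

lemma c_re {n : ℕ} {c : Fin (n+3) → ℂ} {p : ℂ} (hcs : ∑ l, c l = -((n:ℂ)+1) * p)
    (hc : ∀ l, 0 < (c l + p).re) (l : Fin (n+3)) : (c l).re < p.re := by
  have h1 : ∑ i, (c i + p).re = 2 * p.re := by
    rw [← Complex.re_sum, Finset.sum_add_distrib, hcs]
    simp; ring
  have h2 : (c l + p).re < ∑ i, (c i + p).re := by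
    have : ∃ l' : Fin (n+3), l' ≠ l := exists_ne l
    obtain ⟨l', hl'⟩ := this
    exact Finset.single_lt_sum hl' (Finset.mem_univ l) (Finset.mem_univ l') (hc l') fun i _ _ => (hc i).le
  rw [h1, Complex.add_re] at h2
  linarith

def Rc {r : ℕ} (c : Fin r → ℂ) (α0 : ℂ) : ℂ := ∏ l, Complex.Gamma (α0 - c l) * (Complex.Gamma (α0 + c l))⁻¹

lemma Rc_shift {r : ℕ} (c : Fin r → ℂ) (α0 : ℂ) (h1 : ∀ l, 0 < (α0 - c l).re) (h2 : ∀ l, 0 < (α0 + c l).re) :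
    (∏ l, (α0 + c l)) * Rc c (α0 + 1) = (∏ l, (α0 - c l)) * Rc c α0 := by
  unfold Rc
  rw [← Finset.prod_mul_distrib, ← Finset.prod_mul_distrib]
  refine Finset.prod_congr rfl fun l _ => ?_
  have h3 := ne_of_re (h1 l)
  have h4 := ne_of_re (h2 l)
  rw [show α0 + 1 - c l = (α0 - c l) + 1 by ring, show α0 + 1 + c l = (α0 + c l) + 1 by ring,
    Complex.Gamma_add_one _ h3, Complex.Gamma_add_one _ h4, mul_inv]
  field_simp

lemma stepA' {k n : ℕ} (hk : k < n) (α0 : ℂ) (αt : Fin k → ℂ) (c : Fin (n+3) → ℂ) (p : ℂ)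
    (hcs : ∑ l, c l = -((n:ℂ)+1) * p) (hp1 : 1 < 2 * p.re) (hc : ∀ l, 0 < (c l + p).re)
    (h0 : 1 < (α0 - p).re) (ht : ∀ m, 1 < (αt m - p).re) (K : ℕ) :
    Rc c (α0 + K) * ∫ y : Fin n → ℝ, W (Fin.cons (α0+K) αt : Fin (k+1) → ℂ) c (fun j => p - I * sg y j) =
    Rc c α0 * ∫ y : Fin n → ℝ, W (Fin.cons α0 αt : Fin (k+1) → ℂ) c (fun j => p - I * sg y j) := by
  induction K with
  | zero => simp
  | succ K ih =>
    rw [← ih]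
    have hK : (0:ℝ) ≤ K := Nat.cast_nonneg K
    have h0' : 1 < (α0 + K - p).re := by simp at *; linarith
    have h := stepA hk (α0 + K) αt c p hcs hp1 hc h0' ht
    have g1 : ∀ l, 0 < (α0 + K - c l).re := fun l => by
      have := c_re hcs hc l
      simp at *; linarith
    have g2 : ∀ l, 0 < (α0 + K + c l).re := fun l => by
      have := hc l
      simp at *; linarith
    have h2 := Rc_shift c (α0 + K) g1 g2
    have h3 : ∏ l, (α0 + K + c l) ≠ 0 := Finset.prod_ne_zero_iff.2 fun l _ => ne_of_re (g2 l)
    apply mul_left_cancel₀ h3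
    push_cast
    rw [← add_assoc]
    linear_combination (∫ y : Fin n → ℝ, W (Fin.cons (α0+K+1) αt : Fin (k+1) → ℂ) c (fun j => p - I * sg y j)) * h2 - (Rc c (α0+K)) * h

lemma stepB {k n : ℕ} (hk : k < n) (x : ℝ) (αt : Fin k → ℂ) (c : Fin (n+3) → ℂ) (p : ℂ)
    (hcs : ∑ l, c l = -((n:ℂ)+1) * p) (hp1 : 1 < 2 * p.re) (hc : ∀ l, 0 < (c l + p).re)
    (h0 : 1 < x - p.re) (ht : ∀ m, 1 < (αt m - p).re) :
    Rc c x * ∫ y : Fin n → ℝ, W (Fin.cons (x:ℂ) αt : Fin (k+1) → ℂ) c (fun j => p - I * sg y j) =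
      ∫ y : Fin n → ℝ, W αt c (fun j => p - I * sg y j) := by
  have hp0 : 0 < p.re := by linarith
  have hv : ∀ (y : Fin n → ℝ) j, (p - I * sg y j).re = p.re := fun y j => by simp
  have hInteg : Integrable (fun y : Fin n → ℝ => W αt c (fun j => p - I * sg y j)) :=
    integrableW hp0 (fun i => by linarith [ht i]) hc
  -- bound
  have hb := (Gk_tendsto (α := x) (v := (p.re:ℂ)) (by simp; linarith) (by simp; linarith)).norm.bddAbove_range
  obtain ⟨M, hM⟩ := hb
  have hM' : ∀ K, ‖Gk x K (p.re:ℂ)‖ ≤ M := fun K => hM ⟨K, rfl⟩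
  have lim : Tendsto (fun K : ℕ => ∫ y : Fin n → ℝ, (∏ j, Gk x K (p - I * sg y j)) * W αt c (fun j => p - I * sg y j))
      atTop (𝓝 (∫ y : Fin n → ℝ, W αt c (fun j => p - I * sg y j))) := by
    refine tendsto_integral_of_dominated_convergence (fun y => M ^ (n+1) * ‖W αt c (fun j => p - I * sg y j)‖) ?_ (hInteg.norm.const_mul _) ?_ ?_
    · intro K
      refine AEStronglyMeasurable.mul ?_ hInteg.aestronglyMeasurable
      refine Continuous.aestronglyMeasurable ?_
      refine continuous_finsetProd _ fun j _ => ?_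
      unfold Gk
      have hsg := continuous_sg (n := n) j
      refine (Continuous.mul ?_ ?_).mul ?_
      · rw [continuous_iff_continuousAt]
        intro y
        refine ContinuousAt.comp (f := fun y : Fin n → ℝ => (x:ℂ) + K + 1 - (p - I * sg y j)) (g := Complex.Gamma)
          (differentiableAt_Gamma_pos ?_).continuousAt (by fun_prop)
        have hK : (0:ℝ) ≤ K := Nat.cast_nonneg K
        rw [Complex.sub_re, hv]; simp; linarith
      · exact Complex.differentiable_one_div_Gamma.continuous.comp (f := fun y : Fin n → ℝ => (x:ℂ) + K + 1 + (p - I * sg y j)) (by fun_prop)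
      · rw [continuous_iff_continuousAt]
        intro y
        rcases Nat.eq_zero_or_pos K with hK | hK
        · subst hK
          have : ∀ y : Fin n → ℝ, ((0:ℕ):ℂ) ^ (2 * (p - I * sg y j)) = 0 := fun y => by
            rw [Nat.cast_zero, Complex.zero_cpow]
            apply ne_of_re
            have := hv y j
            simp at *; linarith
          simp_rw [this]
          exact continuousAt_const
        · exact ContinuousAt.const_cpow (by fun_prop) (Or.inl (by exact_mod_cast hK.ne'))
    · intro K
      refine Eventually.of_forall fun y => ?_
      rw [norm_mul, norm_prod]
      refine mul_le_mul_of_nonneg_right ?_ (norm_nonneg _)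
      refine (Finset.prod_le_prod (fun _ _ => norm_nonneg _) (g := fun _ => M) fun j _ => ?_).trans (by simp)
      have := Gk_bound (x := x) (v := p - I * sg y j) (by rw [hv]; exact hp0) (by rw [hv]; linarith) K
      rw [hv] at this
      exact this.trans (hM' K)
    · refine Eventually.of_forall fun y => ?_
      have : Tendsto (fun K : ℕ => (∏ j, Gk x K (p - I * sg y j)) * W αt c (fun j => p - I * sg y j)) atTop
          (𝓝 ((∏ j : Fin (n+1), (1:ℂ)) * W αt c (fun j => p - I * sg y j))) := by
        refine Tendsto.mul_const _ (tendsto_finsetProd _ fun j _ => Gk_tendsto ?_ ?_)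
        · rw [Complex.sub_re, hv]; simp; linarith
        · rw [Complex.add_re, hv]; simp; linarith
      simpa using this
  have lim2 : Tendsto (fun K : ℕ => ∏ l, Gk x K (c l)) atTop (𝓝 1) := by
    have : Tendsto (fun K : ℕ => ∏ l, Gk x K (c l)) atTop (𝓝 (∏ l : Fin (n+3), (1:ℂ))) := by
      refine tendsto_finsetProd _ fun l _ => Gk_tendsto ?_ ?_
      · have := c_re hcs hc l
        simp; linarith
      · have := hc l
        simp at *; linarith
    simpa using this
  have lim3 := lim2.mul lim
  rw [one_mul] at lim3
  refine tendsto_nhds_unique (tendsto_const_nhds.congr' ?_) lim3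
  filter_upwards [eventually_gt_atTop 0] with K hK
  have hK0 : (K:ℂ) ≠ 0 := by exact_mod_cast hK.ne'
  rw [← stepA' hk x αt c p hcs hp1 hc (by simpa using h0) ht (K+1)]
  have e1 : ∏ l, Gk x K (c l) = Rc c (x + (K+1:ℕ)) * (K:ℂ)^(2 * ∑ l, c l) := by
    unfold Rc Gk
    rw [Finset.mul_sum, cpow_sum' hK0, ← Finset.prod_mul_distrib]
    refine Finset.prod_congr rfl fun l _ => ?_
    push_cast; rw [← add_assoc]
  have e2 : ∀ y : Fin n → ℝ, (∏ j, Gk x K (p - I * sg y j)) * W αt c (fun j => p - I * sg y j) =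
      (K:ℂ)^(2 * (((n:ℂ)+1) * p)) * W (Fin.cons ((x:ℂ)+(K+1:ℕ)) αt : Fin (k+1) → ℂ) c (fun j => p - I * sg y j) := by
    intro y
    have hs : ((n:ℂ)+1) * p = ∑ j, (p - I * sg y j) := by
      rw [Finset.sum_sub_distrib, ← Finset.mul_sum, ← Complex.ofReal_sum, sum_sg]
      simp
    rw [W_cons, ← mul_assoc]
    congr 1
    unfold Gk
    rw [hs, Finset.mul_sum, cpow_sum' hK0, ← Finset.prod_mul_distrib]
    refine Finset.prod_congr rfl fun l _ => ?_
    push_cast; rw [← add_assoc, mul_comm]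
  simp_rw [e2]
  rw [integral_const_mul, e1, hcs]
  have e3 : (K:ℂ)^(2 * (-((n:ℂ)+1) * p)) * (K:ℂ)^(2 * (((n:ℂ)+1) * p)) = 1 := by
    rw [← Complex.cpow_add _ _ hK0]; ring_nf; simp
  linear_combination (-Rc c (x + (K+1:ℕ)) * ∫ y : Fin n → ℝ, W (Fin.cons ((x:ℂ)+(K+1:ℕ)) αt : Fin (k+1) → ℂ) c (fun j => p - I * sg y j)) * e3

end AnBeta

namespace AnBeta

open Filter Topology


lemma ident_real {U : Set ℂ} (hU : IsOpen U) (hc : IsPreconnected U) {F G : ℂ → ℂ}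
    (hF : DifferentiableOn ℂ F U) (hG : DifferentiableOn ℂ G U) {z0 : ℂ} (hz : z0 ∈ U)
    (h : ∀ t : ℝ, 0 < t → F (z0 + t) = G (z0 + t)) : Set.EqOn F G U := by
  refine (hF.analyticOnNhd hU).eqOn_of_preconnected_of_frequently_eq (hG.analyticOnNhd hU) hc hz ?_
  have h1 : Tendsto (fun t : ℝ => z0 + (t:ℂ)) (𝓝[>] 0) (𝓝[≠] z0) := by
    refine tendsto_nhdsWithin_iff.2 ⟨?_, ?_⟩
    · refine Tendsto.mono_left ?_ nhdsWithin_le_nhds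
      have : ContinuousAt (fun t : ℝ => z0 + (t:ℂ)) 0 := by fun_prop
      simpa [ContinuousAt] using this
    · filter_upwards [self_mem_nhdsWithin] with t ht
      have : (t:ℂ) ≠ 0 := by exact_mod_cast (ne_of_gt ht)
      simpa using this
  refine h1.frequently ?_
  refine Eventually.frequently ?_
  filter_upwards [self_mem_nhdsWithin] with t ht using h t ht

lemma isOpen_re_gt (r : ℝ) : IsOpen {z : ℂ | r < z.re} := isOpen_lt continuous_const Complex.continuous_re
lemma precon_re_gt (r : ℝ) : IsPreconnected {z : ℂ | r < z.re} := (convex_halfSpace_re_gt r).isPreconnected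

lemma stepC0 {k n : ℕ} (hk : k < n) (α0 : ℂ) (αt : Fin k → ℂ) (c : Fin (n+3) → ℂ) (p : ℂ)
    (hcs : ∑ l, c l = -((n:ℂ)+1) * p) (hp1 : 1 < 2 * p.re) (hc : ∀ l, 0 < (c l + p).re)
    (h0 : 0 < (α0 - p).re) (ht : ∀ m, 1 < (αt m - p).re) :
    Rc c α0 * ∫ y : Fin n → ℝ, W (Fin.cons α0 αt : Fin (k+1) → ℂ) c (fun j => p - I * sg y j) =
      ∫ y : Fin n → ℝ, W αt c (fun j => p - I * sg y j) := by
  set U : Set ℂ := {z : ℂ | p.re < z.re}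
  have hp0 : 0 < p.re := by linarith
  have hN := niceW (n := n) (U := U) (α := fun z => (Fin.cons z αt : Fin (k+1) → ℂ)) (c := fun _ => c) (q := fun _ => p)
    (fun i => by
      refine Fin.cases ?_ (fun m => ?_) i
      · simp only [Fin.cons_zero]; fun_prop
      · simp only [Fin.cons_succ]; fun_prop) (fun i => by fun_prop) (by fun_prop)
    (fun _ _ => hp0) (fun z hz i => by
      refine Fin.cases ?_ (fun m => ?_) i
      · simp only [Fin.cons_zero]; simpa [U] using hz
      · simp only [Fin.cons_succ]; linarith [ht m]) (fun _ _ => hc)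
  have hD := hN.differentiableOn (isOpen_re_gt _) Real.pi_pos (fun y => le_rfl)
  have hR : DifferentiableOn ℂ (fun z => Rc c z) U := by
    unfold Rc
    refine DifferentiableOn.fun_finsetProd fun l _ => ?_
    intro z hz
    refine DifferentiableAt.differentiableWithinAt (DifferentiableAt.mul ?_ ?_)
    · refine DifferentiableAt.comp z (f := fun z => z - c l) (g := Complex.Gamma) (differentiableAt_Gamma_pos ?_) (by fun_prop)
      have := c_re hcs hc l
      have hz' : p.re < z.re := hz
      simp; linarith
    · exact DifferentiableAt.comp z (f := fun z => z + c l) (g := fun z => (Complex.Gamma z)⁻¹)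
        (Complex.differentiable_one_div_Gamma _) (by fun_prop)
  refine ident_real (isOpen_re_gt _) (precon_re_gt _) (hR.mul hD) (differentiableOn_const (c := ∫ y : Fin n → ℝ, W αt c (fun j => p - I * sg y j))) (z0 := ((p.re + 1 : ℝ) : ℂ))
    (by simp [U]) ?_ (show α0 ∈ U by simp [U] at *; linarith)
  intro t ht'
  have := stepB hk (p.re + 1 + t) αt c p hcs hp1 hc (by linarith) ht
  simpa using this

lemma stepC {k n : ℕ} (hk : k < n) (α0 : ℂ) (αt : Fin k → ℂ) (c : Fin (n+3) → ℂ) (p : ℂ)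
    (hcs : ∑ l, c l = -((n:ℂ)+1) * p) (hp1 : 1 < 2 * p.re) (hc : ∀ l, 0 < (c l + p).re)
    (h0 : 0 < (α0 - p).re) (ht : ∀ m, 1 < (αt m - p).re) :
    ∫ y : Fin n → ℝ, W (Fin.cons α0 αt : Fin (k+1) → ℂ) c (fun j => p - I * sg y j) =
      (∏ l, Complex.Gamma (α0 + c l) * (Complex.Gamma (α0 - c l))⁻¹) *
      ∫ y : Fin n → ℝ, W αt c (fun j => p - I * sg y j) := by
  rw [← stepC0 hk α0 αt c p hcs hp1 hc h0 ht, ← mul_assoc, Rc, ← Finset.prod_mul_distrib, Finset.prod_eq_one, one_mul]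
  intro l _
  have h1 : Complex.Gamma (α0 + c l) ≠ 0 := Complex.Gamma_ne_zero_of_re_pos (by have := hc l; simp at *; linarith)
  have h2 : Complex.Gamma (α0 - c l) ≠ 0 := Complex.Gamma_ne_zero_of_re_pos (by have := c_re hcs hc l; simp at *; linarith)
  field_simp

end AnBeta

namespace AnBeta

open Filter Topology


lemma boundary_unique {ψ : ℂ → ℂ} (hd : DifferentiableOn ℂ ψ {z : ℂ | 0 < z.re})
    (hb : ∀ y : ℝ, 0 < y → Tendsto ψ (𝓝[{z : ℂ | 0 < z.re}] (I * y)) (𝓝 0)) :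
    ∀ z : ℂ, 0 < z.re → ψ z = 0 := by
  classical
  set H : Set ℂ := {z : ℂ | 0 < z.re}
  have hH : IsOpen H := isOpen_re_gt 0
  set Ψ : ℂ → ℂ := fun z => if 0 < z.re then ψ z else 0 with hΨ
  set Φ : ℂ → ℂ := fun ζ => Ψ (1 + 3 * I + ζ) with hΦ
  set S : Set ℂ := {ζ : ℂ | |ζ.re| < 1 ∧ |ζ.im| < 1} with hS
  set S' : Set ℂ := {ζ : ℂ | |ζ.re| ≤ 1 ∧ |ζ.im| ≤ 1} with hS'
  have hSo : IsOpen S := IsOpen.inter (isOpen_lt (f := fun ζ : ℂ => |ζ.re|) (g := fun _ => 1) (by fun_prop) (by fun_prop))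
    (isOpen_lt (f := fun ζ : ℂ => |ζ.im|) (g := fun _ => 1) (by fun_prop) (by fun_prop))
  have hS'c : IsClosed S' := IsClosed.inter (isClosed_le (f := fun ζ : ℂ => |ζ.re|) (g := fun _ => 1) (by fun_prop) (by fun_prop))
    (isClosed_le (f := fun ζ : ℂ => |ζ.im|) (g := fun _ => 1) (by fun_prop) (by fun_prop))
  have hcl : closure S ⊆ S' := closure_minimal (fun ζ h => ⟨h.1.le, h.2.le⟩) hS'c
  have hΨc : ∀ z : ℂ, 0 ≤ z.re → 0 < z.im → ContinuousWithinAt Ψ {z : ℂ | 0 ≤ z.re} z := by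
    intro z h1 h2
    rcases h1.lt_or_eq with h | h
    · have : ContinuousAt Ψ z := by
        have h3 : ContinuousAt ψ z := (hd.differentiableAt (hH.mem_nhds h)).continuousAt
        refine h3.congr ?_
        filter_upwards [hH.mem_nhds h] with w hw
        have hw' : 0 < w.re := hw
        simp [hΨ, hw']
      exact this.continuousWithinAt
    · have hz : z = I * (z.im : ℂ) := by apply Complex.ext <;> simp [← h]
      have h3 := hb z.im h2
      rw [← hz] at h3
      have h4 : Ψ z = 0 := by simp [hΨ, ← h]
      rw [ContinuousWithinAt, h4]
      have h5 : {z : ℂ | 0 ≤ z.re} ⊆ H ∪ {z : ℂ | z.re ≤ 0} := by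
        intro w _
        rcases lt_or_ge 0 w.re with h | h
        · left; exact h
        · right; exact h
      refine Tendsto.mono_left ?_ (nhdsWithin_mono _ h5)
      rw [nhdsWithin_union]
      refine Tendsto.sup ?_ ?_
      · refine h3.congr' ?_
        filter_upwards [self_mem_nhdsWithin] with w hw
        have hw' : 0 < w.re := hw
        simp [hΨ, hw']
      · refine tendsto_const_nhds.congr' ?_
        filter_upwards [self_mem_nhdsWithin] with w hw
        have hw' : w.re ≤ 0 := hw
        simp [hΨ, hw']
  have hΦc : ContinuousOn Φ S' := by
    intro ζ hζ
    have h1 := abs_le.1 hζ.1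
    have h2 := abs_le.1 hζ.2
    refine ContinuousWithinAt.comp (t := {z : ℂ | 0 ≤ z.re}) (f := fun ζ => 1 + 3 * I + ζ) (g := Ψ) (hΨc _ ?_ ?_) (by fun_prop) ?_
    · simp; linarith
    · simp; linarith
    · intro w hw
      have h1 := abs_le.1 hw.1
      simp; linarith
  have hΦd : DifferentiableOn ℂ Φ S := by
    intro ζ hζ
    have h1 := abs_lt.1 hζ.1
    refine DifferentiableAt.differentiableWithinAt ?_
    have h2 : (1 + 3 * I + ζ) ∈ H := by simp [H]; linarith
    refine DifferentiableAt.comp ζ (f := fun ζ => 1 + 3 * I + ζ) (g := Ψ) ?_ (by fun_prop)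
    refine (hd.differentiableAt (hH.mem_nhds h2)).congr_of_eventuallyEq ?_
    filter_upwards [hH.mem_nhds h2] with w hw
    have hw' : 0 < w.re := hw
    simp [hΨ, hw']
  have hrot : ∀ ζ : ℂ, (ζ ∈ S → I * ζ ∈ S) ∧ (ζ ∈ S' → I * ζ ∈ S') := by
    intro ζ
    simp only [hS, hS', Set.mem_ofPred_eq]
    simp
    tauto
  have hneg : ∀ ζ : ℂ, (ζ ∈ S → -ζ ∈ S) ∧ (ζ ∈ S' → -ζ ∈ S') := by
    intro ζ
    simp [hS, hS']
  set P : ℂ → ℂ := fun ζ => (Φ ζ * Φ (-ζ)) * (Φ (I * ζ) * Φ (-(I * ζ))) with hP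
  have hPd : DiffContOnCl ℂ P S := by
    constructor
    · refine (hΦd.mul (hΦd.comp (by fun_prop) fun ζ h => (hneg ζ).1 h)).mul
        ((hΦd.comp (by fun_prop) fun ζ h => (hrot ζ).1 h).mul (hΦd.comp (by fun_prop) fun ζ h => (hneg _).1 ((hrot ζ).1 h)))
    · refine ContinuousOn.mono ?_ hcl
      refine (hΦc.mul (hΦc.comp (by fun_prop) fun ζ h => (hneg ζ).2 h)).mul
        ((hΦc.comp (by fun_prop) fun ζ h => (hrot ζ).2 h).mul (hΦc.comp (by fun_prop) fun ζ h => (hneg _).2 ((hrot ζ).2 h)))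
  have hbd : Bornology.IsBounded S := by
    refine (Metric.isBounded_iff_subset_closedBall 0).2 ⟨2, fun ζ hζ => ?_⟩
    have := Complex.norm_le_abs_re_add_abs_im ζ
    simp [hS] at hζ
    simp; linarith
  have hΦ0 : ∀ ζ : ℂ, ζ.re = -1 → Φ ζ = 0 := by
    intro ζ h
    simp [hΦ, hΨ, h]
  have hfr : ∀ ζ ∈ frontier S, ‖P ζ‖ ≤ 0 := by
    intro ζ hζ
    rw [hSo.frontier_eq] at hζ
    have h1 := hcl hζ.1
    have h2 : |ζ.re| = 1 ∨ |ζ.im| = 1 := by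
      by_contra hcon
      push Not at hcon
      exact hζ.2 ⟨lt_of_le_of_ne h1.1 hcon.1, lt_of_le_of_ne h1.2 hcon.2⟩
    have : P ζ = 0 := by
      simp only [hP]
      rcases h2 with h | h <;> rcases eq_or_eq_neg_of_abs_eq h with h | h
      · rw [hΦ0 (-ζ) (by simp [h])]; simp
      · rw [hΦ0 ζ h]; simp
      · rw [hΦ0 (I * ζ) (by simp [h])]; simp
      · rw [hΦ0 (-(I * ζ)) (by simp [h])]; simp
    simp [this]
  have hP0 : ∀ ζ ∈ S, P ζ = 0 := fun ζ hζ => norm_le_zero_iff.1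
    (Complex.norm_le_of_forall_mem_frontier_norm_le hbd hPd hfr (subset_closure hζ))
  have h0S : (0:ℂ) ∈ S := by simp [hS]
  have hΦa : AnalyticAt ℂ Φ 0 := (hΦd.analyticOnNhd hSo) 0 h0S
  have hΦz : ∀ᶠ ζ in 𝓝 (0:ℂ), Φ ζ = 0 := by
    rcases hΦa.eventually_eq_zero_or_eventually_ne_zero with h | h
    · exact h
    exfalso
    have hmul : ∀ w : ℂ, w ≠ 0 → Tendsto (fun ζ : ℂ => w * ζ) (𝓝[≠] 0) (𝓝[≠] 0) := by
      intro w hw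
      refine tendsto_nhdsWithin_iff.2 ⟨?_, ?_⟩
      · refine Tendsto.mono_left ?_ nhdsWithin_le_nhds
        have : ContinuousAt (fun t : ℂ => w * t) 0 := by fun_prop
        simpa [ContinuousAt] using this
      · filter_upwards [self_mem_nhdsWithin] with t ht
        have : t ≠ 0 := ht
        simp [hw, this]
    have e1 := (hmul (-1) (by simp)).eventually h
    have e2 := (hmul I (by simp)).eventually h
    have e3 := (hmul (-I) (by simp)).eventually h
    have e4 : ∀ᶠ ζ in 𝓝[≠] (0:ℂ), ζ ∈ S := nhdsWithin_le_nhds (hSo.mem_nhds h0S)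
    obtain ⟨ζ, k0, k1, k2, k3, k4⟩ := (h.and (e1.and (e2.and (e3.and e4)))).exists
    have := hP0 ζ k4
    simp only [hP] at this
    rw [neg_one_mul] at k1
    rw [neg_mul] at k3
    simp [k0, k1, k2, k3] at this
  have hψz : ∀ᶠ z in 𝓝 (1 + 3 * I : ℂ), ψ z = 0 := by
    have h2 : (1 + 3 * I : ℂ) ∈ H := by simp [H]
    have h3 : Tendsto (fun z : ℂ => z - (1 + 3 * I)) (𝓝 (1 + 3 * I)) (𝓝 0) := by
      have : ContinuousAt (fun z : ℂ => z - (1 + 3 * I)) (1 + 3 * I) := by fun_prop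
      simpa [ContinuousAt] using this
    filter_upwards [hH.mem_nhds h2, h3.eventually hΦz] with z hz hz'
    have hw' : 0 < z.re := hz
    simpa [hΦ, hΨ, hw'] using hz'
  have := (hd.analyticOnNhd hH).eqOn_zero_of_preconnected_of_eventuallyEq_zero (precon_re_gt 0) (show (1 + 3 * I : ℂ) ∈ H by simp [H]) hψz
  intro z hz
  exact this hz

end AnBeta

namespace AnBeta

open Filter Topology


def qf (z : ℂ) (s : ℝ) : ℝ := z.re ^ 2 + (s - z.im) ^ 2

lemma qf_nonneg (z : ℂ) (s : ℝ) : 0 ≤ qf z s := by unfold qf; positivity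

lemma qf_pos {z : ℂ} (hz : 0 < z.re) (s : ℝ) : 0 < qf z s := by unfold qf; positivity

def Qf {N : ℕ} (z : ℂ) (s : Fin N → ℝ) : ℝ := ∑ l, ∏ i ∈ Finset.univ.erase l, qf z (s i)

lemma prod_erase_perm {N : ℕ} (σ : Equiv.Perm (Fin N)) (l : Fin N) (g : Fin N → ℝ) :
    ∏ i ∈ Finset.univ.erase l, g (σ i) = ∏ i ∈ Finset.univ.erase (σ l), g i :=
  Finset.prod_equiv σ (by simp) (by simp)

lemma prod_erase_zero {N : ℕ} (g : Fin (N+1) → ℝ) :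
    ∏ i ∈ Finset.univ.erase 0, g i = ∏ i : Fin N, g i.succ := by
  rw [Fin.univ_succ, Finset.cons_eq_insert, Finset.erase_insert (by simp), Finset.prod_map]
  rfl

lemma Qf_perm {N : ℕ} (z : ℂ) (s : Fin N → ℝ) (σ : Equiv.Perm (Fin N)) : Qf z (s ∘ σ) = Qf z s := by
  unfold Qf
  rw [← Equiv.sum_comp σ (fun l => ∏ i ∈ Finset.univ.erase l, qf z (s i))]
  exact Finset.sum_congr rfl fun l _ => prod_erase_perm σ l (fun i => qf z (s i))

lemma Qf_pos {N : ℕ} {z : ℂ} (hz : 0 < z.re) (s : Fin (N+1) → ℝ) : 0 < Qf z s :=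
  Finset.sum_pos (fun l _ => Finset.prod_pos fun i _ => qf_pos hz _) Finset.univ_nonempty

lemma le_Qf {N : ℕ} (z : ℂ) (s : Fin N → ℝ) (l : Fin N) : ∏ i ∈ Finset.univ.erase l, qf z (s i) ≤ Qf z s :=
  Finset.single_le_sum (f := fun l => ∏ i ∈ Finset.univ.erase l, qf z (s i)) (fun l _ => Finset.prod_nonneg fun i _ => qf_nonneg _ _) (Finset.mem_univ l)

lemma Qf_inv {N : ℕ} {z : ℂ} (hz : 0 < z.re) (s : Fin (N+1) → ℝ) :
    (∏ i, qf z (s i))⁻¹ = ∑ l, (Qf z s * qf z (s l))⁻¹ := by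
  have h1 := (Qf_pos hz s).ne'
  have h2 : ∏ i, qf z (s i) ≠ 0 := (Finset.prod_pos fun i _ => qf_pos hz _).ne'
  have h3 : ∀ l, (Qf z s * qf z (s l))⁻¹ = (∏ i ∈ Finset.univ.erase l, qf z (s i)) * ((Qf z s)⁻¹ * (∏ i, qf z (s i))⁻¹) := by
    intro l
    have h4 := (qf_pos hz (s l)).ne'
    rw [← Finset.mul_prod_erase Finset.univ (fun i => qf z (s i)) (Finset.mem_univ l)] at h2 ⊢
    have h5 := right_ne_zero_of_mul h2
    field_simp
  simp_rw [h3]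
  rw [← Finset.sum_mul]
  change _ = Qf z s * _
  field_simp

lemma pair_succ_real {n : ℕ} (h : Fin (n+1) → Fin (n+1) → ℝ) :
    ∏ i, ∏ j ∈ Finset.Ioi i, h i j =
      (∏ j : Fin n, h 0 j.succ) * ∏ i : Fin n, ∏ j ∈ Finset.Ioi i, h i.succ j.succ := by
  have := prod_pair_succ (fun i j => (h i j : ℂ))
  exact_mod_cast this

lemma pair_perm_real {N : ℕ} (σ : Equiv.Perm (Fin N)) (h : Fin N → Fin N → ℝ) (hs : ∀ i j, h i j = h j i) :
    ∏ i, ∏ j ∈ Finset.Ioi i, h (σ i) (σ j) = ∏ i, ∏ j ∈ Finset.Ioi i, h i j := by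
  have := prod_pair_perm σ (fun i j => (h i j : ℂ)) (fun i j => by rw [hs])
  exact_mod_cast this

lemma vdm0 {N : ℕ} (s q : Fin (N+1) → ℝ) (hq : ∀ i : Fin N, (s 0 - s i.succ)^2 ≤ 4 * q i.succ) :
    ∏ i, ∏ j ∈ Finset.Ioi i, (s i - s j)^2 ≤ 4^N * (∏ i : Fin N, q i.succ) * ∏ i, ∏ j ∈ Finset.Ioi i, (1 + (s i - s j)^2) := by
  rw [pair_succ_real (fun i j => (s i - s j)^2)]
  have h1 : ∏ j : Fin N, (s 0 - s j.succ)^2 ≤ 4^N * ∏ i : Fin N, q i.succ := by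
    calc _ ≤ ∏ j : Fin N, (4 * q j.succ) := Finset.prod_le_prod (fun _ _ => sq_nonneg _) fun i _ => hq i
      _ = _ := by rw [Finset.prod_mul_distrib]; simp
  have h2 : ∏ i : Fin N, ∏ j ∈ Finset.Ioi i, (s i.succ - s j.succ)^2 ≤ ∏ i, ∏ j ∈ Finset.Ioi i, (1 + (s i - s j)^2) := by
    rw [pair_succ_real (fun i j => 1 + (s i - s j)^2)]
    have h3 : (1:ℝ) ≤ ∏ j : Fin N, (1 + (s 0 - s j.succ)^2) := by
      refine Finset.prod_induction _ (fun x => (1:ℝ) ≤ x) (fun a b ha hb => one_le_mul_of_one_le_of_one_le ha hb) le_rfl ?_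
      intro i _
      have := sq_nonneg (s 0 - s i.succ)
      linarith
    have h4 : ∏ i : Fin N, ∏ j ∈ Finset.Ioi i, (s i.succ - s j.succ)^2 ≤ ∏ i : Fin N, ∏ j ∈ Finset.Ioi i, (1 + (s i.succ - s j.succ)^2) :=
      Finset.prod_le_prod (fun _ _ => Finset.prod_nonneg fun _ _ => sq_nonneg _) fun i _ =>
        Finset.prod_le_prod (fun _ _ => sq_nonneg _) fun j _ => by linarith
    have h5 : 0 ≤ ∏ i : Fin N, ∏ j ∈ Finset.Ioi i, (1 + (s i.succ - s j.succ)^2) :=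
      Finset.prod_nonneg fun _ _ => Finset.prod_nonneg fun _ _ => by positivity
    nlinarith
  refine mul_le_mul h1 h2 (Finset.prod_nonneg fun _ _ => Finset.prod_nonneg fun _ _ => sq_nonneg _) ?_
  exact (Finset.prod_nonneg fun _ _ => sq_nonneg _).trans h1

lemma vdm {N : ℕ} (z : ℂ) (s : Fin (N+1) → ℝ) :
    ∏ i, ∏ j ∈ Finset.Ioi i, (s i - s j)^2 ≤ 4^N * Qf z s * ∏ i, ∏ j ∈ Finset.Ioi i, (1 + (s i - s j)^2) := by
  obtain ⟨l, _, hl⟩ := Finset.exists_min_image Finset.univ (fun i => |s i - z.im|) Finset.univ_nonempty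
  set σ := Equiv.swap 0 l
  have h := vdm0 (fun i => s (σ i)) (fun i => qf z (s (σ i))) (fun i => by
    have h1 := hl (σ i.succ) (Finset.mem_univ _)
    have h2 := sq_le_sq.2 h1
    have h3 : σ 0 = l := Equiv.swap_apply_left _ _
    simp only [h3, qf]
    nlinarith [sq_nonneg (s l - z.im + (s (σ i.succ) - z.im)), sq_nonneg z.re])
  rw [pair_perm_real σ (fun i j => (s i - s j)^2) (fun i j => by ring),
    pair_perm_real σ (fun i j => 1 + (s i - s j)^2) (fun i j => by ring)] at h
  refine h.trans ?_
  have h4 : ∏ i : Fin N, qf z (s (σ i.succ)) ≤ Qf z s := by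
    rw [← prod_erase_zero (fun i => qf z (s (σ i))), prod_erase_perm σ 0 (fun i => qf z (s i))]
    exact le_Qf z s _
  have h5 : 0 ≤ ∏ i, ∏ j ∈ Finset.Ioi i, (1 + (s i - s j)^2) :=
      Finset.prod_nonneg fun _ _ => Finset.prod_nonneg fun _ _ => by positivity
  gcongr

lemma abs_sinh_le (x : ℝ) : |Real.sinh x| ≤ |x| * Real.exp |x| := by
  rw [Real.abs_sinh]
  set t := |x|
  have h0 : 0 ≤ t := abs_nonneg x
  have h1 := Real.add_one_le_exp (-(2*t))
  rw [Real.sinh_eq]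
  have h2 : Real.exp (-t) = Real.exp t * Real.exp (-(2*t)) := by rw [← Real.exp_add]; ring_nf
  rw [h2]
  nlinarith [Real.exp_pos t]

lemma norm_Sf_le (d : ℝ) : ‖Sf (I * d)‖ ≤ d ^ 2 * Real.exp (π * |d|) := by
  unfold Sf
  have h1 : Complex.sin (π * (I * d)) = I * (Real.sinh (π * d) : ℝ) := by
    rw [show (π:ℂ) * (I * d) = ((π * d : ℝ) : ℂ) * I by push_cast; ring, Complex.sin_mul_I]
    push_cast; ring
  rw [h1, norm_neg, norm_div, norm_mul, norm_mul, norm_mul]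
  simp only [Complex.norm_I, Complex.norm_real, one_mul, Real.norm_eq_abs]
  have h2 := abs_sinh_le (π * d)
  rw [abs_mul, abs_of_pos Real.pi_pos] at h2
  rw [abs_of_pos Real.pi_pos, div_le_iff₀ Real.pi_pos]
  calc |d| * |Real.sinh (π * d)| ≤ |d| * (π * |d| * Real.exp (π * |d|)) := by gcongr
    _ = |d|^2 * Real.exp (π * |d|) * π := by ring
    _ = _ := by rw [sq_abs]

end AnBeta

namespace AnBeta

open Filter Topology


/-- the one-variable factors of the regularised integrand -/
def Ht {r : ℕ} (β : Fin r → ℂ) (z : ℂ) (s : ℝ) : ℂ :=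
  Complex.Gamma (1 + (starRingEnd ℂ) z + I * s) * Complex.Gamma (1 + z - I * s) *
    (Complex.Gamma ((starRingEnd ℂ) z + z + ∑ k, β k - I * s))⁻¹ * ∏ k, Complex.Gamma (β k - I * s)

def Wt {r N : ℕ} (β : Fin r → ℂ) (z : ℂ) (s : Fin N → ℝ) : ℂ :=
  (∏ j, Ht β z (s j)) * PP (fun j => (z + ∑ k, β k) / 2 - I * s j)

lemma Wt_perm {r N : ℕ} (β : Fin r → ℂ) (z : ℂ) (s : Fin N → ℝ) (σ : Equiv.Perm (Fin N)) :
    Wt β z (s ∘ σ) = Wt β z s := by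
  unfold Wt
  rw [← PP_perm σ (fun j => (z + ∑ k, β k) / 2 - I * s j), ← Equiv.prod_comp σ (fun j => Ht β z (s j))]
  rfl

def Ft {r N : ℕ} (β : Fin r → ℂ) (z : ℂ) (s : Fin N → ℝ) : ℂ := Wt β z s / (Qf z s : ℂ)

section
variable {n : ℕ}

lemma EB.congr' {T : Type*} {K : Set T} {l : (Fin n → ℝ) → ℝ} {f g : T → (Fin n → ℝ) → ℂ} (h : EB K l f)
    (e : ∀ τ y, g τ y = f τ y) : EB K l g := h.of_le fun τ _ y => by rw [e]

lemma EB_Ht {r : ℕ} {K : Set ℂ} (hK : IsCompact K) (hK0 : ∀ z ∈ K, 0 ≤ z.re) (β : Fin (r+1) → ℂ)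
    (hβ : ∀ k, 0 < (β k).re) (s : (Fin n → ℝ) → ℝ) (hs : ∀ y, |s y| ≤ tw y) :
    EB K (fun y => -(π/2) * ((r+2) * |s y|)) (fun z y => Ht β z (s y)) := by
  have hs' : ∀ y, |s y| ≤ 2 * tw y := fun y => by linarith [hs y, tw_nonneg y]
  have hs'' : ∀ y, |-s y| ≤ 2 * tw y := fun y => by rw [abs_neg]; exact hs' y
  have hB : 0 < (∑ k, β k).re := by
    rw [Complex.re_sum]; exact Finset.sum_pos (fun k _ => hβ k) Finset.univ_nonempty
  have e1 := EB.Gamma (n := n) hK (g := fun z => 1 + (starRingEnd ℂ) z) (by fun_prop) (fun z hz => by have := hK0 z hz; simp; linarith) hs'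
  have e2 := EB.Gamma (n := n) hK (g := fun z => 1 + z) (by fun_prop) (fun z hz => by have := hK0 z hz; simp; linarith) hs''
  have e3 := EB.invGamma (n := n) hK (g := fun z => (starRingEnd ℂ) z + z + ∑ k, β k) (by fun_prop) (fun z hz => by
    have := hK0 z hz; rw [Complex.add_re, Complex.add_re, Complex.conj_re]; linarith) hs''
  have e4 := EB.prod (Finset.univ : Finset (Fin (r+1))) fun k _ => EB.Gamma (n := n) hK (g := fun _ => β k) (by fun_prop) (fun z _ => hβ k) hs''
  refine ((((e1.mul e2).mul e3).mul e4).congr' fun z y => ?_).mono fun y => ?_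
  · unfold Ht
    push_cast
    simp only [mul_neg, sub_eq_add_neg]
  · simp only [abs_neg, Finset.sum_const, Finset.card_univ, Fintype.card_fin, nsmul_eq_mul]
    push_cast
    apply le_of_eq; ring

lemma EB_exp {T : Type*} {K : Set T} (l : (Fin n → ℝ) → ℝ) :
    EB K l (fun _ y => ((Real.exp (l y) : ℝ) : ℂ)) := by
  intro η hη
  refine ⟨1, one_pos, fun τ _ y => ?_⟩
  have := tw_nonneg y
  rw [Complex.norm_real, Real.norm_eq_abs, abs_of_pos (Real.exp_pos _), one_mul]
  exact Real.exp_le_exp.2 (by nlinarith)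

lemma EB_Ft {K : Set ℂ} (hK : IsCompact K) (hK0 : ∀ z ∈ K, 0 ≤ z.re) (β : Fin (n+2) → ℂ)
    (hβ : ∀ k, 0 < (β k).re) :
    EB K (fun y => -π * tw y) (fun z (y : Fin n → ℝ) => Ft β z (sg y)) := by
  have hB : 0 < (∑ k, β k).re := by
    rw [Complex.re_sum]; exact Finset.sum_pos (fun k _ => hβ k) Finset.univ_nonempty
  have hp : ∀ i j (y : Fin n → ℝ), |-(sg y i + sg y j)| ≤ 2 * tw y := fun i j y => by
    rw [abs_neg]; exact (abs_add_le _ _).trans (by linarith [abs_sg_le y i, abs_sg_le y j])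
  have hm : ∀ i j (y : Fin n → ℝ), |(sg y i - sg y j)| ≤ 2 * tw y := fun i j y => by
    exact (abs_sub _ _).trans (by linarith [abs_sg_le y i, abs_sg_le y j])
  have e1 := EB.prod (Finset.univ : Finset (Fin (n+1))) fun j _ =>
    EB_Ht hK hK0 β hβ (fun y : Fin n → ℝ => sg y j) (fun y => abs_sg_le y j)
  have e2 := EB.prod (K := K) (Finset.univ : Finset (Fin (n+1))) fun i _ => EB.prod (Finset.Ioi i) fun j _ =>
    (EB.Gamma (n := n) hK (g := fun z => z + ∑ k, β k) (by fun_prop) (fun z hz => by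
      have := hK0 z hz; rw [Complex.add_re]; linarith) (hp i j)).mul
    ((EB_exp (K := K) (fun y : Fin n → ℝ => π * |sg y i - sg y j|)).mul
    ((EB.lin hK (g := fun _ => 1) (by fun_prop) (hm i j)).mul (EB.lin hK (g := fun _ => 1) (by fun_prop) (hm i j))))
  have e3 := EB.cont (n := n) hK (g := fun _ => (4:ℂ)^n) (by fun_prop)
  refine (((e1.mul e2).mul e3).of_le fun z hz y => ?_).mono fun y => ?_
  · unfold Ft Wt PP
    rw [norm_div, norm_mul, norm_mul, norm_mul, mul_div_assoc, mul_assoc]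
    refine mul_le_mul_of_nonneg_left ?_ (norm_nonneg _)
    have hQ : 0 ≤ Qf z (sg y) := Finset.sum_nonneg fun l _ => Finset.prod_nonneg fun i _ => qf_nonneg _ _
    rw [Complex.norm_real, Real.norm_of_nonneg hQ]
    refine div_le_of_le_mul₀ hQ (by positivity) ?_
    simp only [norm_prod]
    have v := vdm z (sg y)
    set D := ∏ i, ∏ j ∈ Finset.Ioi i, (‖Complex.Gamma (z + ∑ k, β k + I * (-(sg y i + sg y j) : ℝ))‖ * Real.exp (π * |sg y i - sg y j|)) with hD
    have hD0 : 0 ≤ D := Finset.prod_nonneg fun _ _ => Finset.prod_nonneg fun _ _ => by positivity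
    calc _ ≤ ∏ i, ∏ j ∈ Finset.Ioi i, ((‖Complex.Gamma (z + ∑ k, β k + I * (-(sg y i + sg y j) : ℝ))‖ * Real.exp (π * |sg y i - sg y j|)) * (sg y i - sg y j)^2) := by
          refine Finset.prod_le_prod (fun _ _ => Finset.prod_nonneg fun _ _ => norm_nonneg _) fun i _ =>
            Finset.prod_le_prod (fun _ _ => norm_nonneg _) fun j _ => ?_
          rw [norm_mul, mul_assoc]
          refine mul_le_mul (le_of_eq ?_) ?_ (norm_nonneg _) (norm_nonneg _)
          · congr 2; push_cast; ring
          · have := norm_Sf_le (-(sg y i - sg y j))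
            rw [abs_neg, neg_sq, mul_comm (_ ^ 2)] at this
            refine le_trans (le_of_eq ?_) this
            congr 2; push_cast; ring
      _ = D * ∏ i, ∏ j ∈ Finset.Ioi i, (sg y i - sg y j)^2 := by
          simp only [Finset.prod_mul_distrib, hD]
      _ ≤ D * (4^n * Qf z (sg y) * ∏ i, ∏ j ∈ Finset.Ioi i, (1 + (sg y i - sg y j)^2)) := by gcongr
      _ = _ := by
          have : ∀ i j, ‖(Complex.Gamma (z + ∑ k, β k + I * (-(sg y i + sg y j) : ℝ))) * (((Real.exp (π * |sg y i - sg y j|) : ℝ) : ℂ) * ((1 + I * (sg y i - sg y j : ℝ)) * (1 + I * (sg y i - sg y j : ℝ))))‖ =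
              (‖Complex.Gamma (z + ∑ k, β k + I * (-(sg y i + sg y j) : ℝ))‖ * Real.exp (π * |sg y i - sg y j|)) * (1 + (sg y i - sg y j)^2) := by
            intro i j
            rw [norm_mul, norm_mul, norm_mul, Complex.norm_real, Real.norm_of_nonneg (Real.exp_pos _).le, mul_assoc]
            congr 2
            rw [← sq, ← Complex.normSq_eq_norm_sq, Complex.normSq_apply]
            simp; ring
          simp only [this, Finset.prod_mul_distrib, hD]
          simp only [norm_pow, Complex.norm_ofNat]
          ring
  · have := exponent_le (sg y)
    have h4 := tw_le_sum_sg y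
    simp only [abs_neg, Finset.sum_add_distrib, ← Finset.mul_sum]
    push_cast at this ⊢
    have h5 := mul_le_mul_of_nonneg_left this (half_pos Real.pi_pos).le
    have h6 := mul_le_mul_of_nonneg_left h4 Real.pi_pos.le
    simp only [Finset.sum_const_zero]
    linarith

end
end AnBeta

namespace AnBeta

open Filter Topology


lemma Ht_eq {r : ℕ} (β : Fin r → ℂ) {z : ℂ} (hz : 0 < z.re) (s : ℝ) :
    Complex.Gamma ((starRingEnd ℂ) z + I * s) * Complex.Gamma (z - I * s) *
    (Complex.Gamma ((starRingEnd ℂ) z + z + ∑ k, β k - I * s))⁻¹ * ∏ k, Complex.Gamma (β k - I * s)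
     = Ht β z s * ((qf z s)⁻¹ : ℝ) := by
  have h1 : (starRingEnd ℂ) z + I * s ≠ 0 := ne_of_re (by simpa using hz)
  have h2 : z - I * s ≠ 0 := ne_of_re (by simpa using hz)
  have h3 : (qf z s : ℂ) = ((starRingEnd ℂ) z + I * s) * (z - I * s) := by
    apply Complex.ext
    · rw [Complex.ofReal_re]; simp [qf]; ring
    · simp; ring
  unfold Ht
  rw [Complex.ofReal_inv, h3, show 1 + (starRingEnd ℂ) z + I * s = ((starRingEnd ℂ) z + I * s) + 1 by ring,
    show 1 + z - I * s = (z - I * s) + 1 by ring, Complex.Gamma_add_one _ h1, Complex.Gamma_add_one _ h2]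
  field_simp

lemma W_sym {n : ℕ} (β : Fin (n+2) → ℂ) {z : ℂ} (hz : 0 < z.re) (αt : Fin 0 → ℂ) (s : Fin (n+1) → ℝ) (p : ℂ)
    (hp : p = (z + ∑ k, β k) / 2) :
    W (Fin.cons ((starRingEnd ℂ) z + p) αt : Fin 1 → ℂ) (Fin.cons (z - p) (fun k => β k - p) : Fin (n+3) → ℂ)
      (fun j => p - I * s j) = ∑ l, Ft β z (s ∘ Equiv.swap l 0) / (qf z ((s ∘ Equiv.swap l 0) 0) : ℝ) := by
  have h1 : ∀ l, Ft β z (s ∘ Equiv.swap l 0) / (qf z ((s ∘ Equiv.swap l 0) 0) : ℝ) =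
      Wt β z s * (((Qf z s * qf z (s l))⁻¹ : ℝ) : ℂ) := by
    intro l
    unfold Ft
    rw [Wt_perm, Qf_perm, Function.comp_apply, Equiv.swap_apply_right, div_div, div_eq_mul_inv]
    push_cast; rfl
  simp_rw [h1]
  rw [← Finset.mul_sum, ← Complex.ofReal_sum, ← Qf_inv hz]
  unfold W Wt
  have h2 : ∀ j, Gf (Fin.cons ((starRingEnd ℂ) z + p) αt : Fin 1 → ℂ) (Fin.cons (z - p) (fun k => β k - p) : Fin (n+3) → ℂ) (p - I * s j) = Ht β z (s j) * ((qf z (s j))⁻¹ : ℝ) := by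
    intro j
    rw [← Ht_eq β hz, Gf_cons, Fin.prod_univ_succ]
    simp only [Finset.univ_eq_empty, Finset.prod_empty, Fin.cons_zero, Fin.cons_succ]
    rw [show (starRingEnd ℂ) z + p - (p - I * s j) = (starRingEnd ℂ) z + I * s j by ring,
      show (starRingEnd ℂ) z + p + (p - I * s j) = (starRingEnd ℂ) z + z + ∑ k, β k - I * s j by rw [hp]; ring,
      show z - p + (p - I * s j) = z - I * s j by ring]
    have : ∀ k, β k - p + (p - I * s j) = β k - I * s j := fun k => by ring
    simp_rw [this]
    ring
  simp_rw [h2]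
  rw [Finset.prod_mul_distrib, ← hp]
  push_cast
  rw [Finset.prod_inv_distrib]
  ring

lemma contPP {N : ℕ} {X : Type*} [TopologicalSpace X] {x : X} {v : X → Fin N → ℂ} (hv : ∀ j, ContinuousAt (fun x => v x j) x)
    (h : ∀ j, 0 < (v x j).re) : ContinuousAt (fun x => PP (v x)) x := by
  unfold PP
  refine tendsto_finsetProd _ fun i _ => tendsto_finsetProd _ fun j _ => ?_
  refine ContinuousAt.mul ?_ ?_
  · exact ContinuousAt.comp (f := fun x => v x i + v x j) (g := Complex.Gamma) (differentiableAt_Gamma_pos (by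
      have := h i; have := h j; rw [Complex.add_re]; linarith)).continuousAt ((hv i).add (hv j))
  · unfold Sf
    have := (hv i).sub (hv j)
    fun_prop

lemma contGamma {X : Type*} [TopologicalSpace X] {x : X} {g : X → ℂ} (hg : ContinuousAt g x) (h : 0 < (g x).re) :
    ContinuousAt (fun x => Complex.Gamma (g x)) x :=
  ContinuousAt.comp (f := g) (g := Complex.Gamma) (differentiableAt_Gamma_pos h).continuousAt hg

lemma contFt {r N : ℕ} {X : Type*} [TopologicalSpace X] {x : X} (β : Fin (r+1) → ℂ) (hβ : ∀ k, 0 < (β k).re)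
    {z : X → ℂ} {s : X → Fin N → ℝ}
    (hz : ContinuousAt z x) (hs : ∀ j, ContinuousAt (fun x => s x j) x) (h0 : 0 ≤ (z x).re) (hQ : Qf (z x) (s x) ≠ 0) :
    ContinuousAt (fun x => Ft β (z x) (s x)) x := by
  have hB : 0 < (∑ k, β k).re := by
    rw [Complex.re_sum]; exact Finset.sum_pos (fun k _ => hβ k) Finset.univ_nonempty
  have hzc : ContinuousAt (fun x => (starRingEnd ℂ) (z x)) x := Complex.continuous_conj.continuousAt.comp hz
  have hsc : ∀ j, ContinuousAt (fun x => I * (s x j : ℂ)) x := fun j =>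
    continuousAt_const.mul (Complex.continuous_ofReal.continuousAt.comp (hs j))
  unfold Ft Wt
  refine ContinuousAt.div (ContinuousAt.mul ?_ (contPP ?_ ?_)) ?_ (by exact_mod_cast hQ)
  · refine tendsto_finsetProd _ fun j _ => ?_
    have hj := hsc j
    refine ContinuousAt.mul (ContinuousAt.mul (ContinuousAt.mul ?_ ?_) ?_) (tendsto_finsetProd _ fun k _ => ?_)
    · refine contGamma ((continuousAt_const.add hzc).add hj) ?_
      simp; linarith
    · refine contGamma ((continuousAt_const.add hz).sub hj) ?_
      simp; linarith
    · exact ContinuousAt.comp (f := fun x => (starRingEnd ℂ) (z x) + z x + ∑ k, β k - I * (s x j : ℂ)) (g := fun w => (Complex.Gamma w)⁻¹)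
        (Complex.differentiable_one_div_Gamma _).continuousAt (((hzc.add hz).add continuousAt_const).sub hj)
    · refine contGamma (continuousAt_const.sub hj) ?_
      simpa using hβ k
  · intro j
    exact ((hz.add continuousAt_const).div_const _).sub (hsc j)
  · intro j
    have : ((z x + ∑ k, β k) / 2 - I * (s x j : ℂ)).re = ((z x).re + (∑ k, β k).re) / 2 := by
      simp
    rw [this]; linarith
  · refine Complex.continuous_ofReal.continuousAt.comp ?_
    unfold Qf qf
    refine tendsto_finsetSum _ fun l _ => tendsto_finsetProd _ fun i _ => ?_
    have h1 : ContinuousAt (fun x => (z x).re) x := Complex.continuous_re.continuousAt.comp hz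
    have h2 : ContinuousAt (fun x => (z x).im) x := Complex.continuous_im.continuousAt.comp hz
    exact (h1.pow 2).add (((hs i).sub h2).pow 2)

lemma sg_cons {m : ℕ} (s0 : ℝ) (w : Fin m → ℝ) :
    sg (Fin.cons s0 (w - fun _ => s0 / ((m:ℝ)+1)) : Fin (m+1) → ℝ) = Fin.cons s0 (fun j => sg w j - s0 / ((m:ℝ)+1)) := by
  have hm : (m:ℝ) + 1 ≠ 0 := by positivity
  funext j
  refine Fin.lastCases ?_ (fun j => ?_) j
  · rw [sg_last, show Fin.last (m+1) = (Fin.last m).succ from rfl, Fin.cons_succ, sg_last, Fin.sum_univ_succ]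
    simp only [Fin.cons_zero, Fin.cons_succ, Pi.sub_apply, Finset.sum_sub_distrib]
    simp
    field_simp
    ring
  · rw [sg_castSucc]
    refine Fin.cases ?_ (fun i => ?_) j
    · simp
    · rw [Fin.cons_succ, ← Fin.succ_castSucc, Fin.cons_succ, sg_castSucc]
      simp

lemma tw_cons_ge {m : ℕ} (s0 : ℝ) (w : Fin m → ℝ) :
    tw w ≤ tw (Fin.cons s0 (w - fun _ => s0 / ((m:ℝ)+1)) : Fin (m+1) → ℝ) := by
  unfold tw
  rw [Fin.sum_univ_succ]
  simp only [Fin.cons_zero, Fin.cons_succ, Pi.sub_apply]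
  have hm : (0:ℝ) < (m:ℝ) + 1 := by positivity
  have h1 : ∑ i, |w i| ≤ ∑ i : Fin m, (|w i - s0 / ((m:ℝ)+1)| + |s0| / ((m:ℝ)+1)) := by
    refine Finset.sum_le_sum fun i _ => ?_
    have := abs_add_le (w i - s0 / ((m:ℝ)+1)) (s0 / ((m:ℝ)+1))
    rw [sub_add_cancel, abs_div, abs_of_pos hm] at this
    exact this
  rw [Finset.sum_add_distrib] at h1
  simp only [Finset.sum_const, Finset.card_univ, Fintype.card_fin, nsmul_eq_mul] at h1
  have h2 : (m:ℝ) * (|s0| / ((m:ℝ)+1)) ≤ |s0| := by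
    rw [← mul_div_assoc, div_le_iff₀ hm]
    nlinarith [abs_nonneg s0]
  linarith

lemma integral_split {m : ℕ} (g : (Fin (m+1) → ℝ) → ℂ) (hg : Integrable g) :
    ∫ y, g y = ∫ s0 : ℝ, ∫ w : Fin m → ℝ, g (Fin.cons s0 (w - fun _ => s0 / ((m:ℝ)+1)) : Fin (m+1) → ℝ) := by
  have h1 := volume_preserving_piFinSuccAbove (fun _ : Fin (m+1) => ℝ) 0
  have h2 := h1.symm
  have h3 := h2.integral_comp (MeasurableEquiv.measurableEmbedding _) g
  rw [← h3]
  have h4 := h2.integrable_comp_of_integrable hg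
  rw [Measure.volume_eq_prod] at h4 ⊢
  rw [integral_prod]
  · refine integral_congr_ae (Eventually.of_forall fun s0 => ?_)
    have := integral_sub_right_eq_self (μ := (volume : Measure (Fin m → ℝ))) (fun w : Fin m → ℝ => g (Fin.cons s0 w : Fin (m+1) → ℝ)) (fun _ => s0 / ((m:ℝ)+1))
    refine Eq.trans ?_ this.symm
    refine integral_congr_ae (Eventually.of_forall fun w => ?_)
    simp [MeasurableEquiv.piFinSuccAbove]
    rfl
  · exact h4

end AnBeta

namespace AnBeta

open Filter Topology


lemma sg_affine {m : ℕ} (c : ℝ) (a b d : Fin m → ℝ) (i : Fin (m+1)) :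
    sg (c • (a - b) + d) i = c * (sg a i - sg b i) + sg d i := by
  refine Fin.lastCases ?_ (fun j => ?_) i
  · simp only [sg_last, Pi.add_apply, Pi.smul_apply, Pi.sub_apply, smul_eq_mul, Finset.sum_add_distrib, ← Finset.mul_sum, Finset.sum_sub_distrib]
    ring
  · simp

lemma ae_sg_ne {m : ℕ} (i : Fin (m+1)) {θ : ℝ} (hθ : θ ≠ 0) : ∀ᵐ w : Fin m → ℝ, sg w i ≠ θ := by
  let S : AffineSubspace ℝ (Fin m → ℝ) :=
    { carrier := {w | sg w i = θ}
      smul_vsub_vadd_mem' := fun c a b d ha hb hd => by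
        simp only [Set.mem_ofPred_eq] at *
        rw [vsub_eq_sub, vadd_eq_add, sg_affine, ha, hb, hd]; ring }
  have hS : S ≠ ⊤ := by
    intro h
    have h0 : (0 : Fin m → ℝ) ∈ S := by rw [h]; trivial
    have h1 : sg (0 : Fin m → ℝ) i = θ := h0
    apply hθ
    rw [← h1]
    refine Fin.lastCases ?_ (fun j => ?_) i <;> simp
  have := Measure.addHaar_affineSubspace (volume : Measure (Fin m → ℝ)) S hS
  rw [ae_iff]
  simp only [not_not]
  exact this

/-- spliced coordinates -/
def spl {m : ℕ} (s0 : ℝ) (w : Fin m → ℝ) : Fin (m+2) → ℝ := Fin.cons s0 (fun j => sg w j - s0 / ((m:ℝ)+1))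

lemma spl_eq {m : ℕ} (s0 : ℝ) (w : Fin m → ℝ) :
    spl s0 w = sg (Fin.cons s0 (w - fun _ => s0 / ((m:ℝ)+1)) : Fin (m+1) → ℝ) := (sg_cons s0 w).symm

lemma cont_spl {m : ℕ} (j : Fin (m+2)) : Continuous (fun x : ℝ × (Fin m → ℝ) => spl x.1 x.2 j) := by
  unfold spl
  refine Fin.cases ?_ (fun i => ?_) j
  · simp only [Fin.cons_zero]; fun_prop
  · simp only [Fin.cons_succ]
    have := (continuous_sg i).comp (continuous_snd (X := ℝ) (Y := Fin m → ℝ))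
    exact this.sub (by fun_prop)

def Hh {m : ℕ} (β : Fin (m+3) → ℂ) (z : ℂ) (s0 : ℝ) : ℂ := ∫ w : Fin m → ℝ, Ft β z (spl s0 w)

lemma Ft_dom {m : ℕ} (β : Fin (m+3) → ℂ) (hβ : ∀ k, 0 < (β k).re) {K : Set ℂ} (hK : IsCompact K) (hK0 : ∀ z ∈ K, 0 ≤ z.re) :
    ∃ C : ℝ, 0 < C ∧ ∀ z ∈ K, ∀ s0 (w : Fin m → ℝ), ‖Ft β z (spl s0 w)‖ ≤ C * Real.exp (-(π/2) * tw w) := by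
  obtain ⟨C, hC, h⟩ := (EB_Ft hK hK0 β hβ).dom Real.pi_pos (fun y => le_rfl)
  refine ⟨C, hC, fun z hz s0 w => ?_⟩
  rw [spl_eq]
  refine (h z hz _).trans ?_
  have := tw_cons_ge s0 w
  have := Real.pi_pos
  gcongr C * Real.exp ?_
  nlinarith

lemma Hh_bound {m : ℕ} (β : Fin (m+3) → ℂ) (hβ : ∀ k, 0 < (β k).re) {K : Set ℂ} (hK : IsCompact K) (hK0 : ∀ z ∈ K, 0 ≤ z.re) :
    ∃ C : ℝ, 0 < C ∧ ∀ z ∈ K, ∀ s0, ‖Hh β z s0‖ ≤ C := by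
  obtain ⟨C, hC, h⟩ := Ft_dom β hβ hK hK0
  refine ⟨C * (∫ w : Fin m → ℝ, Real.exp (-(π/2) * tw w)) + 1, ?_, fun z hz s0 => ?_⟩
  · have : 0 ≤ ∫ w : Fin m → ℝ, Real.exp (-(π/2) * tw w) := integral_nonneg fun w => (Real.exp_pos _).le
    positivity
  · refine (norm_integral_le_of_norm_le ((integrable_exp_tw m (half_pos Real.pi_pos)).const_mul C) (Eventually.of_forall fun w => h z hz s0 w)).trans ?_
    rw [integral_const_mul]
    linarith

lemma tendsto_comp_aux (F : ℂ → ℝ → ℂ) {X : Type*} {l : Filter X} {zf : X → ℂ} {sf : X → ℝ} {z : ℂ} {s0 : ℝ}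
    (h : ContinuousAt (fun q : ℂ × ℝ => F q.1 q.2) (z, s0)) (h6 : Tendsto (fun x => (zf x, sf x)) l (𝓝 (z, s0))) :
    Tendsto (fun x => F (zf x) (sf x)) l (𝓝 (F z s0)) := h.tendsto.comp h6

lemma Hh_tendsto {m : ℕ} (β : Fin (m+3) → ℂ) (hβ : ∀ k, 0 < (β k).re) {X : Type*} {l : Filter X} [l.IsCountablyGenerated]
    {zf : X → ℂ} {sf : X → ℝ} {z : ℂ} {s0 : ℝ} (hz : Tendsto zf l (𝓝 z)) (hs : Tendsto sf l (𝓝 s0))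
    (hz0 : 0 ≤ z.re) (hpos : ∀ᶠ x in l, 0 < (zf x).re) (hQ : ∀ᵐ w : Fin m → ℝ, Qf z (spl s0 w) ≠ 0) :
    Tendsto (fun x => Hh β (zf x) (sf x)) l (𝓝 (Hh β z s0)) := by
  set K : Set ℂ := Metric.closedBall z 1 ∩ {z | 0 ≤ z.re}
  have hK : IsCompact K := (isCompact_closedBall z 1).inter_right (isClosed_le continuous_const Complex.continuous_re)
  obtain ⟨C, hC, h⟩ := Ft_dom β hβ hK (fun z hz => hz.2)
  have hKe : ∀ᶠ x in l, zf x ∈ K := by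
    filter_upwards [hpos, hz (Metric.closedBall_mem_nhds z one_pos)] with x h1 h2 using ⟨h2, h1.le⟩
  refine tendsto_integral_filter_of_dominated_convergence (fun w => C * Real.exp (-(π/2) * tw w)) ?_ ?_
    ((integrable_exp_tw m (half_pos Real.pi_pos)).const_mul C) ?_
  · filter_upwards [hpos] with x hx
    refine Continuous.aestronglyMeasurable (continuous_iff_continuousAt.2 fun w => ?_)
    have hcs : ∀ j, Continuous (fun w : Fin m → ℝ => spl (sf x) w j) := fun j =>
      (cont_spl j).comp (g := fun x : ℝ × (Fin m → ℝ) => spl x.1 x.2 j) (f := fun w : Fin m → ℝ => (sf x, w)) (by fun_prop)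
    exact contFt β hβ (z := fun _ => zf x) (s := fun w => spl (sf x) w) continuousAt_const
      (fun j => (hcs j).continuousAt) hx.le (Qf_pos hx _).ne'
  · filter_upwards [hKe] with x hx
    exact Eventually.of_forall fun w => h (zf x) hx (sf x) w
  · filter_upwards [hQ] with w hw
    have hcs : ∀ j, Continuous (fun q : ℂ × ℝ => spl q.2 w j) := fun j =>
      (cont_spl j).comp (g := fun x : ℝ × (Fin m → ℝ) => spl x.1 x.2 j) (f := fun q : ℂ × ℝ => (q.2, w)) (by fun_prop)
    have := contFt β hβ (X := ℂ × ℝ) (x := (z, s0)) (z := fun q => q.1) (s := fun q => spl q.2 w) (by fun_prop)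
      (fun j => (hcs j).continuousAt) hz0 hw
    have h6 : Tendsto (fun x => (zf x, sf x)) l (𝓝 (z, s0)) := hz.prodMk_nhds hs
    exact tendsto_comp_aux (fun q s => Ft β q (spl s w)) this h6

lemma Fint {n : ℕ} (β : Fin (n+2) → ℂ) (hβ : ∀ k, 0 < (β k).re) {z : ℂ} (hz : 0 < z.re) :
    Integrable (fun y : Fin n → ℝ => Ft β z (sg y) / (qf z (sg y 0) : ℝ)) := by
  obtain ⟨C, hC, h⟩ := (EB_Ft (n := n) (isCompact_singleton (x := z)) (fun w hw => by
    rw [Set.mem_singleton_iff.1 hw]; exact hz.le) β hβ).dom Real.pi_pos (fun y => le_rfl)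
  refine Integrable.mono' (((integrable_exp_tw n (half_pos Real.pi_pos)).const_mul C).mul_const ((z.re^2)⁻¹)) ?_ ?_
  · refine Continuous.aestronglyMeasurable (Continuous.div ?_ ?_ ?_)
    · refine continuous_iff_continuousAt.2 fun w => ?_
      exact contFt β hβ (z := fun _ => z) (s := fun w => sg w) continuousAt_const (fun j => (continuous_sg j).continuousAt) hz.le (Qf_pos hz _).ne'
    · unfold qf
      have := continuous_sg (n := n) 0
      fun_prop
    · intro y
      exact_mod_cast (qf_pos hz _).ne'
  · refine Eventually.of_forall fun y => ?_
    rw [norm_div, Complex.norm_real, Real.norm_of_nonneg (qf_nonneg _ _), div_eq_mul_inv]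
    refine mul_le_mul (h z rfl y) ?_ (inv_nonneg.2 (qf_nonneg _ _)) (by positivity)
    refine inv_anti₀ (by positivity) ?_
    unfold qf
    nlinarith [sq_nonneg (sg y 0 - z.im)]

lemma int_eq {m : ℕ} (β : Fin (m+3) → ℂ) (hβ : ∀ k, 0 < (β k).re) {z : ℂ} (hz : 0 < z.re) (αt : Fin 0 → ℂ) (p : ℂ)
    (hp : p = (z + ∑ k, β k) / 2) :
    (z.re:ℂ) * ∫ y : Fin (m+1) → ℝ, W (Fin.cons ((starRingEnd ℂ) z + p) αt : Fin 1 → ℂ) (Fin.cons (z - p) (fun k => β k - p) : Fin (m+1+3) → ℂ)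
      (fun j => p - I * sg y j) = ((m:ℂ)+2) * ∫ t : ℝ, (((1 + t^2)⁻¹ : ℝ) : ℂ) * Hh β z (z.im + z.re * t) := by
  simp_rw [W_sym β hz αt _ p hp]
  have h1 := integral_sum_swap (n := m+1) 0 (fun s => Ft β z s / (qf z (s 0) : ℝ)) (Fint β hβ hz)
  rw [h1, integral_split _ (Fint β hβ hz)]
  have h2 : ∀ s0 : ℝ, ∫ w : Fin m → ℝ, Ft β z (sg (Fin.cons s0 (w - fun _ => s0 / ((m:ℝ)+1)) : Fin (m+1) → ℝ)) /
      (qf z (sg (Fin.cons s0 (w - fun _ => s0 / ((m:ℝ)+1)) : Fin (m+1) → ℝ) 0) : ℝ) = (((qf z s0)⁻¹ : ℝ) : ℂ) * Hh β z s0 := by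
    intro s0
    unfold Hh
    rw [← integral_const_mul]
    refine integral_congr_ae (Eventually.of_forall fun w => ?_)
    simp only [← spl_eq]
    rw [div_eq_mul_inv, mul_comm, Complex.ofReal_inv]
    rfl
  simp_rw [h2]
  have h3 : ∫ s0 : ℝ, (((qf z s0)⁻¹ : ℝ) : ℂ) * Hh β z s0 = z.re • ∫ t : ℝ, (((qf z (z.im + z.re * t))⁻¹ : ℝ) : ℂ) * Hh β z (z.im + z.re * t) := by
    rw [Measure.integral_comp_mul_left (fun s => (((qf z (z.im + s))⁻¹ : ℝ) : ℂ) * Hh β z (z.im + s)) z.re,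
      integral_add_left_eq_self (fun s => (((qf z s)⁻¹ : ℝ) : ℂ) * Hh β z s) z.im, smul_smul, abs_of_pos (inv_pos.2 hz), mul_inv_cancel₀ hz.ne', one_smul]
  rw [h3, Complex.real_smul]
  have h4 : ∀ t : ℝ, (((1 + t^2)⁻¹ : ℝ) : ℂ) * Hh β z (z.im + z.re * t) = (z.re:ℂ)^2 * ((((qf z (z.im + z.re * t))⁻¹ : ℝ) : ℂ) * Hh β z (z.im + z.re * t)) := by
    intro t
    rw [← mul_assoc]
    congr 1
    have : qf z (z.im + z.re * t) = z.re^2 * (1 + t^2) := by unfold qf; ring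
    rw [this]
    have h5 : (1:ℝ) + t^2 ≠ 0 := by positivity
    have h6 := hz.ne'
    norm_cast
    field_simp
  simp_rw [h4]
  rw [integral_const_mul]
  push_cast
  ring

end AnBeta

namespace AnBeta

open Filter Topology


lemma Gamma_refl_Sf {σ : ℝ} (hσ : σ ≠ 0) :
    Complex.Gamma (1 + I * σ) * Complex.Gamma (1 - I * σ) * Sf (I * σ) = (σ:ℂ)^2 := by
  have hx : I * (σ:ℂ) ≠ 0 := mul_ne_zero I_ne_zero (by exact_mod_cast hσ)
  have h1 : Complex.Gamma (1 + I * σ) = (I * σ) * Complex.Gamma (I * σ) := by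
    rw [add_comm, Complex.Gamma_add_one _ hx]
  have h2 : Complex.Gamma (1 - I * σ) = (-(I * σ)) * Complex.Gamma (-(I * σ)) := by
    rw [← Complex.Gamma_add_one _ (neg_ne_zero.2 hx)]
    congr 1; ring
  have h3 : Complex.Gamma (I * σ) ≠ 0 := by
    refine Complex.Gamma_ne_zero fun k hk => hσ ?_
    have := congrArg Complex.im hk
    simpa using this
  have h4 : Complex.Gamma (-(I * σ)) ≠ 0 := by
    refine Complex.Gamma_ne_zero fun k hk => hσ ?_
    have := congrArg Complex.im hk
    simpa using this
  rw [h1, h2, ← Sf_eq]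
  field_simp
  simp

lemma Qf_limit {m : ℕ} (y0 : ℝ) (w : Fin m → ℝ) :
    Qf (I * y0) (spl y0 w) = ∏ j, (sg w j - y0 / ((m:ℝ)+1) - y0)^2 := by
  unfold Qf
  rw [Finset.sum_eq_single 0]
  · rw [prod_erase_zero]
    refine Finset.prod_congr rfl fun j _ => ?_
    simp [spl, qf]
  · intro l _ hl
    refine Finset.prod_eq_zero (i := 0) (by simp [hl.symm]) ?_
    simp [spl, qf]
  · simp

lemma Ft_limit {m : ℕ} (β : Fin (m+3) → ℂ) (hβ : ∀ k, 0 < (β k).re) (αt : Fin 0 → ℂ) (y0 : ℝ) (w : Fin m → ℝ)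
    (hw : ∀ j, sg w j - y0 / ((m:ℝ)+1) - y0 ≠ 0) :
    Ft β (I * y0) (spl y0 w) = ((Complex.Gamma (∑ k, β k - I * y0))⁻¹ * ∏ k, Complex.Gamma (β k - I * y0)) *
      W αt (fun k => β k - (I * y0 + ∑ k, β k) / 2)
        (fun j => ((I * y0 + ∑ k, β k) / 2 + I * y0 / ((m:ℂ)+1)) - I * sg w j) := by
  have hS : 0 < (∑ k, β k).re := by
    rw [Complex.re_sum]
    exact Finset.sum_pos (fun k _ => hβ k) Finset.univ_nonempty
  unfold Ft
  rw [Qf_limit]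
  have hQ : ((∏ j, (sg w j - y0 / ((m:ℝ)+1) - y0)^2 : ℝ) : ℂ) ≠ 0 := by
    exact_mod_cast Finset.prod_ne_zero_iff.2 fun j _ => pow_ne_zero 2 (hw j)
  rw [div_eq_iff hQ]
  unfold Wt W
  rw [Fin.prod_univ_succ, PP_succ]
  set p := (I * (y0:ℂ) + ∑ k, β k) / 2 with hp
  have e0 : Ht β (I * y0) (spl y0 w 0) = (Complex.Gamma (∑ k, β k - I * y0))⁻¹ * ∏ k, Complex.Gamma (β k - I * y0) := by
    simp [Ht, spl]
  have e1 : ∀ j : Fin (m+1), (p - I * (spl y0 w j.succ : ℂ)) = (p + I * y0 / ((m:ℂ)+1)) - I * sg w j := by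
    intro j
    simp only [spl, Fin.cons_succ]
    push_cast
    ring
  have e2 : ∀ j : Fin (m+1), Ht β (I * y0) (spl y0 w j.succ) *
      (Complex.Gamma (p - I * (spl y0 w 0 : ℂ) + (p - I * (spl y0 w j.succ : ℂ))) *
        Sf (p - I * (spl y0 w 0 : ℂ) - (p - I * (spl y0 w j.succ : ℂ)))) =
      Gf αt (fun k => β k - p) ((p + I * y0 / ((m:ℂ)+1)) - I * sg w j) * ((sg w j - y0 / ((m:ℝ)+1) - y0 : ℝ) : ℂ)^2 := by
    intro j
    rw [← Gamma_refl_Sf (hw j), ← e1 j]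
    unfold Gf
    simp only [Finset.univ_eq_empty, Finset.prod_empty, one_mul]
    have hs : spl y0 w j.succ = sg w j - y0 / ((m:ℝ)+1) := by simp [spl]
    have hs0 : spl y0 w 0 = y0 := by simp [spl]
    set τ := spl y0 w j.succ
    rw [← hs, hs0]
    unfold Ht
    have a1 : p - I * (y0:ℂ) + (p - I * (τ:ℂ)) = ∑ k, β k - I * τ := by rw [hp]; ring
    have a2 : p - I * (y0:ℂ) - (p - I * (τ:ℂ)) = I * ((τ - y0 : ℝ) : ℂ) := by push_cast; ring
    have a3 : 1 + (starRingEnd ℂ) (I * (y0:ℂ)) + I * τ = 1 + I * ((τ - y0 : ℝ) : ℂ) := by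
      simp; ring
    have a4 : 1 + I * (y0:ℂ) - I * τ = 1 - I * ((τ - y0 : ℝ) : ℂ) := by push_cast; ring
    have a5 : (starRingEnd ℂ) (I * (y0:ℂ)) + I * (y0:ℂ) + ∑ k, β k - I * τ = ∑ k, β k - I * τ := by
      simp
    have a6 : ∀ k, β k - p + (p - I * (τ:ℂ)) = β k - I * τ := fun k => by ring
    simp only [a1, a2, a3, a4, a5, a6]
    have hG : Complex.Gamma (∑ k, β k - I * τ) ≠ 0 := by
      refine Complex.Gamma_ne_zero_of_re_pos ?_
      simpa using hS
    field_simp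
  have e3 : (∏ j : Fin (m+1), Ht β (I * y0) (spl y0 w j.succ)) *
      ∏ j : Fin (m+1), (Complex.Gamma (p - I * (spl y0 w 0 : ℂ) + (p - I * (spl y0 w j.succ : ℂ))) *
        Sf (p - I * (spl y0 w 0 : ℂ) - (p - I * (spl y0 w j.succ : ℂ)))) =
      (∏ j, Gf αt (fun k => β k - p) ((p + I * y0 / ((m:ℂ)+1)) - I * sg w j)) * ((∏ j, (sg w j - y0 / ((m:ℝ)+1) - y0)^2 : ℝ) : ℂ) := by
    rw [← Finset.prod_mul_distrib, Finset.prod_congr rfl (fun j _ => e2 j), Finset.prod_mul_distrib]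
    push_cast
    rfl
  rw [e0]
  simp_rw [e1] at e3 ⊢
  linear_combination ((Complex.Gamma (∑ k, β k - I * y0))⁻¹ * ∏ k, Complex.Gamma (β k - I * y0)) * PP (fun j : Fin (m+1) => (p + I * y0 / ((m:ℂ)+1)) - I * sg w j) * e3

lemma ae_good {m : ℕ} {y0 : ℝ} (hy : 0 < y0) : ∀ᵐ w : Fin m → ℝ, ∀ j, sg w j - y0 / ((m:ℝ)+1) - y0 ≠ 0 := by
  rw [ae_all_iff]
  intro j
  have : y0 / ((m:ℝ)+1) + y0 ≠ 0 := by positivity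
  filter_upwards [ae_sg_ne (m := m) j this] with w hw h
  apply hw
  linarith

lemma Hh_limit {m : ℕ} (β : Fin (m+3) → ℂ) (hβ : ∀ k, 0 < (β k).re) (αt : Fin 0 → ℂ) {y0 : ℝ} (hy : 0 < y0) :
    Hh β (I * y0) y0 = ((Complex.Gamma (∑ k, β k - I * y0))⁻¹ * ∏ k, Complex.Gamma (β k - I * y0)) *
      ∫ w : Fin m → ℝ, W αt (fun k => β k - (I * y0 + ∑ k, β k) / 2)
        (fun j => ((I * y0 + ∑ k, β k) / 2 + I * y0 / ((m:ℂ)+1)) - I * sg w j) := by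
  unfold Hh
  rw [← integral_const_mul]
  refine integral_congr_ae ?_
  filter_upwards [ae_good (m := m) hy] with w hw
  exact Ft_limit β hβ αt y0 w hw

lemma Hh_cont {m : ℕ} (β : Fin (m+3) → ℂ) (hβ : ∀ k, 0 < (β k).re) {z : ℂ} (hz : 0 < z.re) :
    Continuous (fun s => Hh β z s) := by
  refine continuous_iff_continuousAt.2 fun s => ?_
  exact Hh_tendsto β hβ (zf := fun _ => z) (sf := fun s => s) tendsto_const_nhds tendsto_id hz.le
    (Eventually.of_forall fun _ => hz) (Eventually.of_forall fun w => (Qf_pos hz _).ne')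

lemma int_limit {m : ℕ} (β : Fin (m+3) → ℂ) (hβ : ∀ k, 0 < (β k).re) {y0 : ℝ} (hy : 0 < y0) :
    Tendsto (fun z : ℂ => ∫ t : ℝ, (((1 + t^2)⁻¹ : ℝ) : ℂ) * Hh β z (z.im + z.re * t))
      (𝓝[{z : ℂ | 0 < z.re}] (I * y0)) (𝓝 (π * Hh β (I * y0) y0)) := by
  have hlim : (π:ℂ) * Hh β (I * y0) y0 = ∫ t : ℝ, (((1 + t^2)⁻¹ : ℝ) : ℂ) * Hh β (I * y0) y0 := by
    rw [integral_mul_const, integral_complex_ofReal, integral_univ_inv_one_add_sq]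
  rw [hlim]
  set K : Set ℂ := Metric.closedBall (I * (y0:ℂ)) 1 ∩ {z | 0 ≤ z.re}
  have hK : IsCompact K := (isCompact_closedBall _ 1).inter_right (isClosed_le continuous_const Complex.continuous_re)
  obtain ⟨C, hC, h⟩ := Hh_bound β hβ hK (fun z hz => hz.2)
  have hpos : ∀ᶠ z in 𝓝[{z : ℂ | 0 < z.re}] (I * (y0:ℂ)), 0 < z.re := eventually_mem_nhdsWithin
  have hid : Tendsto (fun z : ℂ => z) (𝓝[{z : ℂ | 0 < z.re}] (I * (y0:ℂ))) (𝓝 (I * (y0:ℂ))) := tendsto_id.mono_left nhdsWithin_le_nhds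
  have hKe : ∀ᶠ z in 𝓝[{z : ℂ | 0 < z.re}] (I * (y0:ℂ)), z ∈ K := by
    filter_upwards [hpos, hid (Metric.closedBall_mem_nhds _ one_pos)] with x h1 h2 using ⟨h2, h1.le⟩
  refine tendsto_integral_filter_of_dominated_convergence (fun t => (1 + t^2)⁻¹ * C) ?_ ?_ (integrable_inv_one_add_sq.mul_const C) ?_
  · filter_upwards [hpos] with z hz
    refine Continuous.aestronglyMeasurable (Continuous.mul ?_ ?_)
    · refine Complex.continuous_ofReal.comp (Continuous.inv₀ (by fun_prop) fun t => by positivity)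
    · exact (Hh_cont β hβ hz).comp (by fun_prop : Continuous fun t : ℝ => z.im + z.re * t)
  · filter_upwards [hKe] with z hz
    refine Eventually.of_forall fun t => ?_
    rw [norm_mul, Complex.norm_real, Real.norm_of_nonneg (by positivity)]
    exact mul_le_mul_of_nonneg_left (h z hz _) (by positivity)
  · refine Eventually.of_forall fun t => Tendsto.mul tendsto_const_nhds ?_
    refine Hh_tendsto β hβ (zf := fun z => z) (sf := fun z => z.im + z.re * t) hid ?_ (by simp) hpos ?_
    · have hc : Continuous (fun z : ℂ => z.im + z.re * t) := by fun_prop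
      have := (hc.tendsto (I * (y0:ℂ))).mono_left (nhdsWithin_le_nhds (s := {z : ℂ | 0 < z.re}))
      simpa using this
    · filter_upwards [ae_good (m := m) hy] with w hw
      rw [Qf_limit]
      exact Finset.prod_ne_zero_iff.2 fun j _ => pow_ne_zero 2 (hw j)

end AnBeta

namespace AnBeta

open Filter Topology


lemma sum_sub_pos {r : ℕ} (β : Fin (r+1) → ℂ) (hβ : ∀ k, 0 < (β k).re) (k : Fin (r+1)) : 0 ≤ (∑ l, β l - β k).re := by
  rw [← Finset.sum_erase_eq_sub (Finset.mem_univ k), Complex.re_sum]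
  exact Finset.sum_nonneg fun l _ => (hβ l).le

lemma sum_sub_sub_pos {r : ℕ} (β : Fin (r+3) → ℂ) (hβ : ∀ k, 0 < (β k).re) {i j : Fin (r+3)} (hij : i ≠ j) :
    0 < (∑ l, β l - β i - β j).re := by
  have hj : j ∈ Finset.univ.erase i := by simp [hij.symm]
  rw [← Finset.sum_erase_eq_sub (Finset.mem_univ i), ← Finset.sum_erase_eq_sub hj, Complex.re_sum]
  refine Finset.sum_pos (fun l _ => hβ l) ?_
  rw [← Finset.card_pos, Finset.card_erase_of_mem hj, Finset.card_erase_of_mem (Finset.mem_univ i)]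
  simp

lemma sum_sub_pos' {r : ℕ} (β : Fin (r+3) → ℂ) (hβ : ∀ k, 0 < (β k).re) (k : Fin (r+3)) : 0 < (∑ l, β l - β k).re := by
  obtain ⟨j, hj⟩ := exists_ne k
  have := sum_sub_sub_pos β hβ hj.symm
  have h2 := hβ j
  simp only [Complex.sub_re] at *
  linarith

lemma sum_pos_re {r : ℕ} (β : Fin (r+3) → ℂ) (hβ : ∀ k, 0 < (β k).re) : 0 < (∑ l, β l).re := by
  rw [Complex.re_sum]
  exact Finset.sum_pos (fun l _ => hβ l) Finset.univ_nonempty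

/-- the integral without `α`, with `b = (z, β)` -/
def I0 {m : ℕ} (αt : Fin 0 → ℂ) (β : Fin (m+3) → ℂ) (z : ℂ) : ℂ :=
  ∫ y : Fin (m+1) → ℝ, W αt (Fin.cons (z - (z + ∑ k, β k)/2) (fun k => β k - (z + ∑ k, β k)/2) : Fin (m+1+3) → ℂ)
    (fun j => (z + ∑ k, β k)/2 - I * sg y j)

def Yf {r : ℕ} (β : Fin r → ℂ) (z : ℂ) : ℂ :=
  1/2 * Complex.Gamma (1 + ((starRingEnd ℂ) z + z)) * (Complex.Gamma ((starRingEnd ℂ) z + ∑ k, β k))⁻¹ *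
    ∏ k, Complex.Gamma ((starRingEnd ℂ) z + β k) * (Complex.Gamma ((starRingEnd ℂ) z + z + ∑ l, β l - β k))⁻¹

lemma Yf_eq {m : ℕ} (αt : Fin 0 → ℂ) (β : Fin (m+3) → ℂ) (hβ : ∀ k, 1 < (β k).re) {z : ℂ} (hz : 0 < z.re) :
    Yf β z * I0 αt β z = ((m:ℂ)+2) * ∫ t : ℝ, (((1 + t^2)⁻¹ : ℝ) : ℂ) * Hh β z (z.im + z.re * t) := by
  have hβ0 : ∀ k, 0 < (β k).re := fun k => by linarith [hβ k]
  rw [← int_eq β hβ0 hz αt _ rfl, stepC (by omega)]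
  · unfold I0
    rw [← mul_assoc]
    congr 1
    rw [Fin.prod_univ_succ]
    simp only [Fin.cons_zero, Fin.cons_succ]
    unfold Yf
    set zb := (starRingEnd ℂ) z
    have e1 : zb + (z + ∑ k, β k)/2 + (z - (z + ∑ k, β k)/2) = zb + z := by ring
    have e2 : zb + (z + ∑ k, β k)/2 - (z - (z + ∑ k, β k)/2) = zb + ∑ k, β k := by ring
    have e3 : ∀ i, zb + (z + ∑ k, β k)/2 + (β i - (z + ∑ k, β k)/2) = zb + β i := fun i => by ring
    have e4 : ∀ i, zb + (z + ∑ k, β k)/2 - (β i - (z + ∑ k, β k)/2) = zb + z + ∑ k, β k - β i := fun i => by ring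
    simp only [e1, e2, e3, e4]
    have e5 : zb + z = ((2 * z.re : ℝ) : ℂ) := by rw [add_comm, Complex.add_conj]
    have e6 : Complex.Gamma (1 + (zb + z)) = (zb + z) * Complex.Gamma (zb + z) := by
      rw [add_comm, Complex.Gamma_add_one]
      rw [e5]
      exact_mod_cast (by positivity)
    rw [e6, e5]
    push_cast
    ring
  · rw [Fin.sum_univ_succ]
    simp only [Fin.cons_zero, Fin.cons_succ, Finset.sum_sub_distrib]
    simp
    ring
  · have := sum_pos_re β hβ0
    have h1 : 1 < (∑ k, β k).re := by
      have h2 := sum_sub_pos' β hβ0 0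
      have h3 := hβ 0
      simp only [Complex.sub_re] at h2
      linarith
    have : (2:ℝ) * ((z + ∑ k, β k)/2).re = z.re + (∑ k, β k).re := by
      simp; ring
    rw [this]; linarith
  · intro l
    refine Fin.cases ?_ (fun k => ?_) l
    · simpa using hz
    · simpa using hβ0 k
  · simpa using hz
  · intro k; exact k.elim0

lemma I0_limit {m : ℕ} (αt : Fin 0 → ℂ) (β : Fin (m+3) → ℂ) (hβ : ∀ k, 1 < (β k).re) {y0 : ℝ} (hy : 0 < y0) :
    Tendsto (I0 αt β) (𝓝[{z : ℂ | 0 < z.re}] (I * y0)) (𝓝 (2 * π * ((m:ℂ)+2) * (∏ k, Complex.Gamma (∑ l, β l - β k)) *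
      ∫ w : Fin m → ℝ, W αt (fun k => β k - (I * y0 + ∑ k, β k) / 2)
        (fun j => ((I * y0 + ∑ k, β k) / 2 + I * y0 / ((m:ℂ)+1)) - I * sg w j))) := by
  have hβ0 : ∀ k, 0 < (β k).re := fun k => by linarith [hβ k]
  have hS := sum_pos_re β hβ0
  have hS1 := sum_sub_pos' β hβ0
  have hcj : ContinuousAt (fun z : ℂ => (starRingEnd ℂ) z) (I * y0) := Complex.continuous_conj.continuousAt
  have hY : ContinuousAt (Yf β) (I * y0) := by
    unfold Yf
    refine ContinuousAt.mul (ContinuousAt.mul (ContinuousAt.mul continuousAt_const ?_) ?_) ?_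
    · exact contGamma (by fun_prop) (by simp)
    · refine ContinuousAt.inv₀ (contGamma (by fun_prop) (by simpa using hS)) (Complex.Gamma_ne_zero_of_re_pos (by simpa using hS))
    · refine tendsto_finsetProd _ fun k _ => ?_
      refine ContinuousAt.mul (contGamma (by fun_prop) (by simpa using hβ0 k)) ?_
      have h : 0 < ((starRingEnd ℂ) (I * (y0:ℂ)) + I * y0 + ∑ l, β l - β k).re := by
        simpa using hS1 k
      exact ContinuousAt.inv₀ (contGamma (by fun_prop) h) (Complex.Gamma_ne_zero_of_re_pos h)
  have hYv : Yf β (I * y0) = 1/2 * ((Complex.Gamma (∑ k, β k - I * y0))⁻¹ * ∏ k, Complex.Gamma (β k - I * y0)) *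
      (∏ k, Complex.Gamma (∑ l, β l - β k))⁻¹ := by
    unfold Yf
    rw [Finset.prod_mul_distrib, Finset.prod_inv_distrib]
    have e1 : (starRingEnd ℂ) (I * (y0:ℂ)) = - (I * y0) := by simp
    simp only [e1, neg_add_cancel, add_zero, zero_add, Complex.Gamma_one, neg_add_eq_sub]
    ring
  have hA : ((Complex.Gamma (∑ k, β k - I * y0))⁻¹ * ∏ k, Complex.Gamma (β k - I * y0)) ≠ 0 := by
    refine mul_ne_zero (inv_ne_zero (Complex.Gamma_ne_zero_of_re_pos (by simpa using hS))) ?_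
    exact Finset.prod_ne_zero_iff.2 fun k _ => Complex.Gamma_ne_zero_of_re_pos (by simpa using hβ0 k)
  have hP : (∏ k, Complex.Gamma (∑ l, β l - β k)) ≠ 0 :=
    Finset.prod_ne_zero_iff.2 fun k _ => Complex.Gamma_ne_zero_of_re_pos (hS1 k)
  have hY0 : Yf β (I * y0) ≠ 0 := by
    rw [hYv]
    exact mul_ne_zero (mul_ne_zero (by norm_num) hA) (inv_ne_zero hP)
  have hYt : Tendsto (Yf β) (𝓝[{z : ℂ | 0 < z.re}] (I * y0)) (𝓝 (Yf β (I * y0))) := hY.tendsto.mono_left nhdsWithin_le_nhds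
  have h1 := ((int_limit β hβ0 hy).const_mul ((m:ℂ)+2)).div hYt hY0
  have h2 : Tendsto (I0 αt β) (𝓝[{z : ℂ | 0 < z.re}] (I * y0)) (𝓝 (((m:ℂ)+2) * (π * Hh β (I * y0) y0) / Yf β (I * y0))) := by
    refine h1.congr' ?_
    have hpos : ∀ᶠ z in 𝓝[{z : ℂ | 0 < z.re}] (I * (y0:ℂ)), 0 < z.re := eventually_mem_nhdsWithin
    filter_upwards [hpos, hYt.eventually_ne hY0] with z hz hne
    simp only [Pi.div_apply]
    rw [← Yf_eq αt β hβ hz]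
    field_simp
  convert h2 using 2
  rw [Hh_limit β hβ0 αt hy, hYv]
  set A := ((Complex.Gamma (∑ k, β k - I * y0))⁻¹ * ∏ k, Complex.Gamma (β k - I * y0))
  set P := (∏ k, Complex.Gamma (∑ l, β l - β k))
  field_simp

end AnBeta

namespace AnBeta

open Filter Topology


lemma diffGamma {U : Set ℂ} {g : ℂ → ℂ} (hg : DifferentiableOn ℂ g U) (hp : ∀ z ∈ U, 0 < (g z).re) :
    DifferentiableOn ℂ (fun z => Complex.Gamma (g z)) U := fun z hz =>
  (differentiableAt_Gamma_pos (hp z hz)).comp_differentiableWithinAt z (hg z hz)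

def Rz {r : ℕ} (β : Fin r → ℂ) (z : ℂ) : ℂ :=
  (∏ k, Complex.Gamma (∑ l, β l - β k)) * ∏ i, ∏ j ∈ Finset.Ioi i, Complex.Gamma (z + ∑ l, β l - β i - β j)

lemma Rz_diff {m : ℕ} (β : Fin (m+3) → ℂ) (hβ : ∀ k, 0 < (β k).re) {z : ℂ} (hz : 0 ≤ z.re) :
    DifferentiableAt ℂ (Rz β) z := by
  unfold Rz
  refine DifferentiableAt.const_mul ?_ _
  refine DifferentiableAt.fun_finsetProd fun i _ => DifferentiableAt.fun_finsetProd fun j hj => ?_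
  have h1 := sum_sub_sub_pos β hβ (Finset.mem_Ioi.1 hj).ne
  have h2 : 0 < (z + ∑ l, β l - β i - β j).re := by
    simp only [Complex.sub_re, Complex.add_re] at h1 ⊢
    linarith
  exact (differentiableAt_Gamma_pos h2).comp z (f := fun z => z + ∑ l, β l - β i - β j) (by fun_prop)

lemma I0_diff {m : ℕ} (αt : Fin 0 → ℂ) (β : Fin (m+3) → ℂ) (hβ : ∀ k, 0 < (β k).re) :
    DifferentiableOn ℂ (I0 αt β) {z : ℂ | 0 < z.re} := by
  have hS := sum_pos_re β hβ
  have := (niceW (n := m+1) (U := {z : ℂ | 0 < z.re}) (α := fun _ => αt)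
    (c := fun z => (Fin.cons (z - (z + ∑ k, β k)/2) (fun k => β k - (z + ∑ k, β k)/2) : Fin (m+1+3) → ℂ))
    (q := fun z => (z + ∑ k, β k)/2) (fun i => i.elim0) ?_ (by fun_prop) ?_ (fun _ _ i => i.elim0) ?_).differentiableOn
      (isOpen_re_gt 0) Real.pi_pos (fun y => le_rfl)
  · exact this
  · intro i
    refine Fin.cases ?_ (fun k => ?_) i
    · simp only [Fin.cons_zero]; fun_prop
    · simp only [Fin.cons_succ]; fun_prop
  · intro z hz
    have : ((z + ∑ k, β k)/2).re = (z.re + (∑ k, β k).re)/2 := by simp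
    rw [this]
    have hz' : 0 < z.re := hz
    positivity
  · intro z hz k
    refine Fin.cases ?_ (fun k => ?_) k
    · simpa using hz
    · simpa using hβ k

lemma base_prod (c : Fin 3 → ℂ) (p : ℂ) (hs : ∑ l, c l = -p) :
    ∏ k, Complex.Gamma (c k + p) = ∏ i, ∏ j ∈ Finset.Ioi i, Complex.Gamma (-c i - c j) := by
  rw [Fin.sum_univ_three] at hs
  have a1 : c 0 + p = -c 1 - c 2 := by linear_combination hs
  have a2 : c 1 + p = -c 0 - c 2 := by linear_combination hs
  have a3 : c 2 + p = -c 0 - c 1 := by linear_combination hs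
  have s0 : Finset.Ioi (0 : Fin 3) = {1, 2} := by decide
  have s1 : Finset.Ioi (1 : Fin 3) = {2} := by decide
  have s2 : Finset.Ioi (2 : Fin 3) = ∅ := by decide
  rw [Fin.prod_univ_three, Fin.prod_univ_three, a1, a2, a3, s0, s1, s2, Finset.prod_pair (by decide), Finset.prod_singleton, Finset.prod_empty]
  ring

lemma claim0 (n : ℕ) : ∀ (α : Fin 0 → ℂ) (c : Fin (n+3) → ℂ) (p : ℂ), ∑ l, c l = -((n:ℂ)+1) * p →
    (∀ l, 1 < (c l + p).re) →
    ∫ y : Fin n → ℝ, W α c (fun j => p - I * sg y j) =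
      (2 * π)^n * ((n+1).factorial : ℂ) * ∏ i, ∏ j ∈ Finset.Ioi i, Complex.Gamma (-c i - c j) := by
  induction n with
  | zero =>
    intro α c p hs hc
    have h0 : ∀ y : Fin 0 → ℝ, W α c (fun j : Fin (0+1) => p - I * sg y j) = ∏ k, Complex.Gamma (c k + p) := by
      intro y
      have : sg y 0 = 0 := by
        have := sg_last y
        simpa using this
      unfold W
      simp [Gf, PP, this]
    simp_rw [h0]
    rw [integral_const]
    have hv : (volume : Measure (Fin 0 → ℝ)).real Set.univ = 1 := by
      rw [measureReal_def, volume_pi, Measure.pi_of_empty]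
      simp
    rw [hv, base_prod c p (by rw [hs]; push_cast; ring)]
    simp

  | succ m ih =>
    intro α c p hs hc
    set z := c 0 + p with hzd
    set β : Fin (m+3) → ℂ := fun k => c k.succ + p with hβd
    have hβ : ∀ k, 1 < (β k).re := fun k => hc k.succ
    have hβ0 : ∀ k, 0 < (β k).re := fun k => by linarith [hβ k]
    have hz : 0 < z.re := by linarith [hc 0]
    have hp : (z + ∑ k, β k)/2 = p := by
      rw [Fin.sum_univ_succ] at hs
      simp only [hzd, hβd, Finset.sum_add_distrib]
      simp only [Finset.sum_const, Finset.card_univ, Fintype.card_fin, nsmul_eq_mul]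
      push_cast at hs ⊢
      linear_combination hs/2
    have hcc : c = (Fin.cons (z - (z + ∑ k, β k)/2) (fun k => β k - (z + ∑ k, β k)/2) : Fin (m+1+3) → ℂ) := by
      rw [hp]
      funext i
      refine Fin.cases ?_ (fun k => ?_) i
      · simp [hzd]
      · simp [hβd]
    have hI : ∫ y : Fin (m+1) → ℝ, W α c (fun j => p - I * sg y j) = I0 α β z := by
      unfold I0
      rw [← hcc, hp]
    rw [hI]
    have hR : ∏ i, ∏ j ∈ Finset.Ioi i, Complex.Gamma (-c i - c j) = Rz β z := by
      have e := prod_pair_succ (n := m+3) (fun i j => Complex.Gamma (-c i - c j))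
      refine e.trans ?_
      unfold Rz
      congr 1
      · refine Finset.prod_congr rfl fun k _ => ?_
        congr 1
        simp only [hzd, hβd] at hp ⊢
        linear_combination -2*hp
      · refine Finset.prod_congr rfl fun i _ => Finset.prod_congr rfl fun j _ => ?_
        congr 1
        simp only [hzd, hβd] at hp ⊢
        linear_combination -2*hp
    rw [hR]
    have key := boundary_unique (ψ := fun z => I0 α β z - (2 * π)^(m+1) * ((m+1+1).factorial : ℂ) * Rz β z) ?_ ?_ z hz
    · exact sub_eq_zero.1 key
    · exact (I0_diff α β hβ0).sub (DifferentiableOn.const_mul (fun w hw => (Rz_diff β hβ0 (le_of_lt hw)).differentiableWithinAt) _)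
    · intro y0 hy
      have hL := ih α (fun k => β k - (I * y0 + ∑ k, β k) / 2) ((I * y0 + ∑ k, β k) / 2 + I * y0 / ((m:ℂ)+1)) ?_ ?_
      · have h1 := I0_limit α β hβ hy
        rw [hL] at h1
        have h2 : Tendsto (Rz β) (𝓝[{z : ℂ | 0 < z.re}] (I * y0)) (𝓝 (Rz β (I * y0))) :=
          (Rz_diff β hβ0 (by simp)).continuousAt.tendsto.mono_left nhdsWithin_le_nhds
        have h3 := h1.sub (h2.const_mul ((2 * π : ℂ)^(m+1) * ((m+1+1).factorial : ℂ)))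
        refine h3.trans (le_of_eq ?_)
        congr 1
        unfold Rz
        have e : ∀ i j, -(β i - (I * y0 + ∑ k, β k) / 2) - (β j - (I * y0 + ∑ k, β k) / 2) = I * y0 + ∑ k, β k - β i - β j := fun i j => by ring
        simp only [e]
        rw [Nat.factorial_succ (m+1)]
        push_cast
        ring
      · rw [Finset.sum_sub_distrib]
        simp only [Finset.sum_const, Finset.card_univ, Fintype.card_fin, nsmul_eq_mul]
        have : (m:ℂ)+1 ≠ 0 := by exact_mod_cast Nat.succ_ne_zero m
        push_cast
        field_simp
        ring
      · intro l
        have : β l - (I * y0 + ∑ k, β k) / 2 + ((I * y0 + ∑ k, β k) / 2 + I * y0 / ((m:ℂ)+1)) = β l + ((y0 / ((m:ℝ)+1) : ℝ) : ℂ) * I := by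
          push_cast; ring
        rw [this, Complex.add_re, Complex.re_ofReal_mul, Complex.I_re, mul_zero, add_zero]
        exact hβ l

lemma claimE {n : ℕ} (k : ℕ) : ∀ (_ : k ≤ n) (α : Fin k → ℂ) (c : Fin (n+3) → ℂ) (p : ℂ), ∑ l, c l = -((n:ℂ)+1) * p →
    (∀ l, 1 < (c l + p).re) → (∀ i, 1 < (α i - p).re) →
    ∫ y : Fin n → ℝ, W α c (fun j => p - I * sg y j) =
      (∏ i, ∏ l, Complex.Gamma (α i + c l) * (Complex.Gamma (α i - c l))⁻¹) *
      ((2 * π)^n * ((n+1).factorial : ℂ) * ∏ i, ∏ j ∈ Finset.Ioi i, Complex.Gamma (-c i - c j)) := by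
  induction k with
  | zero =>
    intro _ α c p hs hc _
    rw [claim0 n α c p hs hc]
    simp
  | succ k ih =>
    intro hk α c p hs hc hα
    have h1 : α = (Fin.cons (α 0) (fun i : Fin k => α i.succ) : Fin (k+1) → ℂ) := by
      funext i
      refine Fin.cases ?_ (fun k => ?_) i <;> simp
    have hp : 1 < 2 * p.re := by
      have h2 : ∑ l, (c l + p).re = 2 * p.re := by
        rw [← Complex.re_sum, Finset.sum_add_distrib, hs]
        simp only [Finset.sum_const, Finset.card_univ, Fintype.card_fin, nsmul_eq_mul]
        have : -((n:ℂ)+1) * p + ((n+3 : ℕ) : ℂ) * p = ((2:ℝ):ℂ) * p := by push_cast; ring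
        rw [this, Complex.re_ofReal_mul]
      rw [← h2]
      refine (hc 0).trans_le ?_
      exact Finset.single_le_sum (f := fun l => (c l + p).re) (fun l _ => by linarith [hc l]) (Finset.mem_univ 0)
    have h2 := stepC (n := n) (by omega) (α 0) (fun i : Fin k => α i.succ) c p hs hp (fun l => by linarith [hc l])
      (by linarith [hα 0]) (fun i => hα i.succ)
    rw [← h1] at h2
    have h4 := Fin.prod_univ_succ (fun i : Fin (k+1) => ∏ l, Complex.Gamma (α i + c l) * (Complex.Gamma (α i - c l))⁻¹)
    rw [h2, ih (by omega) _ c p hs hc (fun i => hα i.succ), h4, ← mul_assoc]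

lemma claimF {n : ℕ} (a : Fin n → ℂ) (b : Fin (n+3) → ℂ) (ha : ∀ i, 0 < (a i).re) (hb : ∀ i, 0 < (b i).re) :
    ∫ y : Fin n → ℝ, W (fun i => a i + (∑ k, b k)/2) (fun k => b k - (∑ k, b k)/2) (fun j => (∑ k, b k)/2 - I * sg y j) =
      (2 * π)^n * ((n+1).factorial : ℂ) *
      ((∏ i, ∏ l, Complex.Gamma (a i + b l) * (Complex.Gamma (∑ k, b k + a i - b l))⁻¹) *
       ∏ i, ∏ j ∈ Finset.Ioi i, Complex.Gamma (∑ k, b k - b i - b j)) := by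
  obtain ⟨δ1, hδ1, h1⟩ := exists_eps (fun i => (a i).re) ha
  obtain ⟨δ2, hδ2, h2⟩ := exists_eps (fun i => (b i).re) hb
  set δ := min δ1 δ2 with hδd
  have hδ : 0 < δ := lt_min hδ1 hδ2
  have haδ : ∀ i, δ < (a i).re := fun i => (min_le_left _ _).trans_lt (h1 i)
  have hbδ : ∀ i, δ < (b i).re := fun i => (min_le_right _ _).trans_lt (h2 i)
  set U : Set ℂ := {ζ | -δ < ζ.re} with hU
  have haU : ∀ ζ ∈ U, ∀ i, 0 < (a i + ζ).re := fun ζ hζ i => by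
    have : -δ < ζ.re := hζ
    rw [Complex.add_re]; linarith [haδ i]
  have hbU : ∀ ζ ∈ U, ∀ i, 0 < (b i + ζ).re := fun ζ hζ i => by
    have : -δ < ζ.re := hζ
    rw [Complex.add_re]; linarith [hbδ i]
  set B : ℂ → ℂ := fun ζ => ∑ k, (b k + ζ) with hB
  have hBd : DifferentiableOn ℂ B U := by
    refine DifferentiableOn.fun_sum fun i _ => by fun_prop
  have hBp : ∀ ζ ∈ U, 0 < (B ζ).re := fun ζ hζ => sum_pos_re (fun k => b k + ζ) (hbU ζ hζ)
  set F : ℂ → ℂ := fun ζ => ∫ y : Fin n → ℝ, W (fun i => a i + ζ + B ζ/2) (fun k => b k + ζ - B ζ/2) (fun j => B ζ/2 - I * sg y j) with hF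
  set G : ℂ → ℂ := fun ζ => (2 * π)^n * ((n+1).factorial : ℂ) *
      ((∏ i, ∏ l, Complex.Gamma (a i + ζ + (b l + ζ)) * (Complex.Gamma (B ζ + (a i + ζ) - (b l + ζ)))⁻¹) *
       ∏ i, ∏ j ∈ Finset.Ioi i, Complex.Gamma (B ζ - (b i + ζ) - (b j + ζ))) with hG
  have key : Set.EqOn F G U := by
    refine ident_real (isOpen_re_gt _) (precon_re_gt _) (z0 := 1) ?_ ?_ ?_ ?_
    · refine (niceW (U := U) (α := fun ζ i => a i + ζ + B ζ/2) (c := fun ζ k => b k + ζ - B ζ/2) (q := fun ζ => B ζ/2)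
        ?_ ?_ ?_ ?_ ?_ ?_).differentiableOn (isOpen_re_gt _) Real.pi_pos (fun y => le_rfl)
      · intro i; fun_prop
      · intro i; fun_prop
      · fun_prop
      · intro ζ hζ
        have := hBp ζ hζ
        simpa using this
      · intro ζ hζ i
        have e : a i + ζ + B ζ/2 - B ζ/2 = a i + ζ := by ring
        rw [e]; exact haU ζ hζ i
      · intro ζ hζ i
        have e : b i + ζ - B ζ/2 + B ζ/2 = b i + ζ := by ring
        rw [e]; exact hbU ζ hζ i
    · refine DifferentiableOn.const_mul (DifferentiableOn.mul ?_ ?_) _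
      · refine DifferentiableOn.fun_finsetProd fun i _ => DifferentiableOn.fun_finsetProd fun l _ => ?_
        have hp : ∀ ζ ∈ U, 0 < (B ζ + (a i + ζ) - (b l + ζ)).re := by
          intro ζ hζ
          have h1 := sum_sub_pos' (fun k => b k + ζ) (hbU ζ hζ) l
          have h2 := haU ζ hζ i
          have e : B ζ + (a i + ζ) - (b l + ζ) = (B ζ - (b l + ζ)) + (a i + ζ) := by ring
          rw [e, Complex.add_re]
          exact add_pos h1 h2
        refine DifferentiableOn.mul (diffGamma (by fun_prop) fun ζ hζ => ?_) (DifferentiableOn.inv (diffGamma (by fun_prop) hp)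
          fun ζ hζ => Complex.Gamma_ne_zero_of_re_pos (hp ζ hζ))
        rw [Complex.add_re]
        exact add_pos (haU ζ hζ i) (hbU ζ hζ l)
      · refine DifferentiableOn.fun_finsetProd fun i _ => DifferentiableOn.fun_finsetProd fun j hj => ?_
        exact diffGamma (by fun_prop) fun ζ hζ => sum_sub_sub_pos (fun k => b k + ζ) (hbU ζ hζ) (Finset.mem_Ioi.1 hj).ne
    · change -δ < (1:ℂ).re
      rw [Complex.one_re]; linarith
    · intro t ht
      set ζ : ℂ := 1 + t with hζ
      have hre : 1 < ζ.re := by simp [hζ, ht]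
      have h3 := claimE (n := n) n le_rfl (fun i => a i + ζ + B ζ/2) (fun k => b k + ζ - B ζ/2) (B ζ/2) ?_ ?_ ?_
      · simp only [hF, hG]
        rw [h3]
        have e1 : ∀ i l, a i + ζ + B ζ/2 + (b l + ζ - B ζ/2) = a i + ζ + (b l + ζ) := fun i l => by ring
        have e2 : ∀ i l, a i + ζ + B ζ/2 - (b l + ζ - B ζ/2) = B ζ + (a i + ζ) - (b l + ζ) := fun i l => by ring
        have e3 : ∀ i j, -(b i + ζ - B ζ/2) - (b j + ζ - B ζ/2) = B ζ - (b i + ζ) - (b j + ζ) := fun i j => by ring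
        simp only [e1, e2, e3]
        ring
      · rw [Finset.sum_sub_distrib]
        simp only [Finset.sum_const, Finset.card_univ, Fintype.card_fin, nsmul_eq_mul]
        change B ζ - _ = _
        push_cast
        ring
      · intro l
        have e : b l + ζ - B ζ/2 + B ζ/2 = b l + ζ := by ring
        rw [e, Complex.add_re]; linarith [hb l]
      · intro i
        have e : a i + ζ + B ζ/2 - B ζ/2 = a i + ζ := by ring
        rw [e, Complex.add_re]; linarith [ha i]
  have h0 : (0:ℂ) ∈ U := by
    change -δ < (0:ℂ).re
    rw [Complex.zero_re]; linarith
  have := key h0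
  simpa only [hF, hG, hB, add_zero] using this

end AnBeta

namespace AnBeta

lemma prod_ite_lt {N : ℕ} (h : Fin N → ℂ) (i : Fin N) :
    (∏ j, if i < j then h j else 1) = ∏ j ∈ Finset.Ioi i, h j := by
  rw [← Finset.prod_filter, Finset.filter_lt_eq_Ioi]

lemma W_eq_integrand {n : ℕ} (a : Fin n → ℂ) (b : Fin (n+3) → ℂ) (s : Fin (n+1) → ℝ) :
    W (fun i => a i + (∑ k, b k)/2) (fun k => b k - (∑ k, b k)/2) (fun j => (∑ k, b k)/2 - I * s j) =
    (∏ j : Fin (n + 1), (∏ i, Complex.Gamma (a i + I * (s j : ℂ))) * (∏ i, Complex.Gamma (b i - I * (s j : ℂ))) /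
      ∏ i, Complex.Gamma ((∑ k, b k) + a i - I * (s j : ℂ))) *
    ∏ i : Fin (n + 1), ∏ j ∈ Finset.Ioi i, Complex.Gamma ((∑ k, b k) - I * (s i : ℂ) - I * (s j : ℂ)) /
      (Complex.Gamma (I * (s i : ℂ) - I * (s j : ℂ)) * Complex.Gamma (I * (s j : ℂ) - I * (s i : ℂ))) := by
  unfold W
  congr 1
  · refine Finset.prod_congr rfl fun j _ => ?_
    unfold Gf
    rw [Finset.prod_mul_distrib, Finset.prod_inv_distrib]
    have e1 : ∀ i, a i + (∑ k, b k)/2 - ((∑ k, b k)/2 - I * (s j : ℂ)) = a i + I * (s j : ℂ) := fun i => by ring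
    have e2 : ∀ i, a i + (∑ k, b k)/2 + ((∑ k, b k)/2 - I * (s j : ℂ)) = (∑ k, b k) + a i - I * (s j : ℂ) := fun i => by ring
    have e3 : ∀ i, b i - (∑ k, b k)/2 + ((∑ k, b k)/2 - I * (s j : ℂ)) = b i - I * (s j : ℂ) := fun i => by ring
    simp only [e1, e2, e3]
    ring
  · unfold PP
    refine Finset.prod_congr rfl fun i _ => Finset.prod_congr rfl fun j _ => ?_
    rw [← Sf_neg, ← Sf_eq, div_eq_mul_inv]
    congr 2
    · ring
    · congr 2 <;> ring

end AnBeta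

/-- the classical gamma-function limit of the new A_n beta integral.
The variables `u_j = I * y_j` run along the imaginary axis, so `du_j = I dy_j`. -/
theorem new_An_classical_beta_integral (n : ℕ) (hn : 1 ≤ n)
    (a : Fin n → ℂ) (b : Fin (n + 3) → ℂ)
    (ha : ∀ i, 0 < (a i).re) (hb : ∀ i, 0 < (b i).re) :
    (1 / (2 * (π : ℂ) * Complex.I)) ^ n *
      ∫ y : Fin n → ℝ, Complex.I ^ n *
        (((∏ j : Fin (n + 1),
            (∏ i, Complex.Gamma (a i + uext n (fun k => Complex.I * (y k : ℂ)) j)) *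
              (∏ i, Complex.Gamma (b i - uext n (fun k => Complex.I * (y k : ℂ)) j)) /
            ∏ i, Complex.Gamma ((∑ k, b k) + a i -
              uext n (fun k => Complex.I * (y k : ℂ)) j)) *
          ∏ i : Fin (n + 1), ∏ j : Fin (n + 1), if i < j then
            Complex.Gamma ((∑ k, b k) - uext n (fun k => Complex.I * (y k : ℂ)) i -
                uext n (fun k => Complex.I * (y k : ℂ)) j) /
              (Complex.Gamma (uext n (fun k => Complex.I * (y k : ℂ)) i -
                  uext n (fun k => Complex.I * (y k : ℂ)) j) *
                Complex.Gamma (uext n (fun k => Complex.I * (y k : ℂ)) j -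
                  uext n (fun k => Complex.I * (y k : ℂ)) i)) else 1)) =
    (Nat.factorial (n + 1) : ℂ) *
      ((∏ i : Fin n, ∏ j : Fin (n + 3),
          Complex.Gamma (a i + b j) / Complex.Gamma ((∑ k, b k) + a i - b j)) *
        ∏ i : Fin (n + 3), ∏ j : Fin (n + 3), if i < j then
          Complex.Gamma ((∑ k, b k) - b i - b j) else 1) := by
  have hu : ∀ (y : Fin n → ℝ) (j : Fin (n+1)), uext n (fun k => Complex.I * (y k : ℂ)) j = Complex.I * (AnBeta.sg y j : ℂ) := by
    intro y j
    refine Fin.lastCases ?_ (fun i => ?_) j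
    · simp [uext, Finset.mul_sum]
    · simp [uext]
  simp only [hu, AnBeta.prod_ite_lt]
  have hW : ∀ y : Fin n → ℝ, _ = _ := fun y => AnBeta.W_eq_integrand a b (AnBeta.sg y)
  simp only [← hW]
  rw [integral_const_mul, AnBeta.claimF a b ha hb, ← mul_assoc, ← mul_pow]
  have hpi : (π:ℂ) ≠ 0 := AnBeta.pi_ne
  have e : 1 / (2 * (π:ℂ) * Complex.I) * Complex.I = (2 * (π:ℂ))⁻¹ := by
    have := Complex.I_ne_zero
    field_simp
  have e2 : (2 * (π:ℂ))⁻¹ ^ n * (2 * (π:ℂ)) ^ n = 1 := by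
    rw [← mul_pow, inv_mul_cancel₀ (by simpa using hpi), one_pow]
  rw [e]
  simp only [div_eq_mul_inv]
  rw [mul_assoc ((2 * (π:ℂ)) ^ n), ← mul_assoc, e2, one_mul]
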